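/- Let E be an elliptic curve over an algebraically closed field k, let Γ be a group of automorphisms of E (as a curve) preserving a nonempty finite subset Z ⊂ E. Then Γ is finite and |Γ| ≤ 24 · |Z|. -/

import Mathlib

open AlgebraicGeometry CategoryTheory TopologicalSpace MvPolynomial Matrix
attribute [local instance] MvPolynomial.gradedAlgebra

/-- The inclusion of constants into the degree-zero part of the polynomial ring. -/
noncomputable def constHom (k : Type) [CommRing k] (n : ℕ) :
    k →+* (homogeneousSubmodule (Fin (n + 1)) k 0) where
  toFun c := ⟨C c, isHomogeneous_C _ _⟩
  map_one' := by ext; simp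
  map_mul' x y := by ext; simp
  map_zero' := by ext; simp
  map_add' x y := by ext; simp

/-- Projective `n`-space over `k`, as `Proj` of the standard graded polynomial ring in
`n + 1` variables. -/
noncomputable def ProjSpace (k : Type) [CommRing k] (n : ℕ) : Scheme :=
  Proj (homogeneousSubmodule (Fin (n + 1)) k)

/-- The structure morphism of projective space over `k`. -/
noncomputable def ProjSpace.str (k : Type) [CommRing k] (n : ℕ) :
    ProjSpace k n ⟶ Spec (CommRingCat.of k) :=
  Proj.toSpecZero _ ≫ Spec.map (CommRingCat.ofHom (constHom k n))

/-- A scheme over `k` is projective over `k` if it admits a closed immersion into some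
projective space over `k`, compatible with the structure morphisms. -/
def IsProjectiveOver (k : Type) [Field k] (X : Scheme)
    (sX : X ⟶ Spec (CommRingCat.of k)) : Prop :=
  ∃ (n : ℕ) (f : X ⟶ ProjSpace k n), IsClosedImmersion f ∧ f ≫ ProjSpace.str k n = sX

/-- A scheme over `k` is quasi-projective over `k` if it admits a (locally closed)
immersion into some projective space over `k`, compatible with the structure morphisms. -/
def IsQuasiProjectiveOver (k : Type) [Field k] (X : Scheme)
    (sX : X ⟶ Spec (CommRingCat.of k)) : Prop :=
  ∃ (n : ℕ) (f : X ⟶ ProjSpace k n), IsImmersion f ∧ f ≫ ProjSpace.str k n = sX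
/-- Two `k`-schemes are birational over `k` if they contain isomorphic dense open
subschemes, the isomorphism being compatible with the structure morphisms. -/
def BirationalOver (k : Type) [Field k] (X Y : Scheme)
    (sX : X ⟶ Spec (CommRingCat.of k)) (sY : Y ⟶ Spec (CommRingCat.of k)) : Prop :=
  ∃ (U : X.Opens) (V : Y.Opens), Dense (U : Set X) ∧ Dense (V : Set Y) ∧
    ∃ e : (U : Scheme) ≅ (V : Scheme), e.hom ≫ V.ι ≫ sY = U.ι ≫ sX

/-- A morphism of schemes is birational if it restricts to an isomorphism between dense
open subschemes. -/
def IsBirationalHom {X Y : Scheme} (f : X ⟶ Y) : Prop :=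
  ∃ (U : X.Opens) (V : Y.Opens), Dense (U : Set X) ∧ Dense (V : Set Y) ∧
    ∃ e : (U : Scheme) ≅ (V : Scheme), e.hom ≫ V.ι = U.ι ≫ f

/-- The product `ℙ¹ × E` over `k`, as a fibre product of schemes over `Spec k`. -/
noncomputable def P1Prod (k : Type) [Field k] (E : Scheme)
    (sE : E ⟶ Spec (CommRingCat.of k)) : Scheme :=
  Limits.pullback (ProjSpace.str k 1) sE

/-- The structure morphism of the product `ℙ¹ × E` over `k`. -/
noncomputable def P1Prod.str (k : Type) [Field k] (E : Scheme)
    (sE : E ⟶ Spec (CommRingCat.of k)) : P1Prod k E sE ⟶ Spec (CommRingCat.of k) :=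
  Limits.pullback.snd (ProjSpace.str k 1) sE ≫ sE
/-- The base change of a `k`-scheme to the algebraic closure of `k`. -/
noncomputable def BaseChangeToClosure (k : Type) [Field k] (X : Scheme)
    (sX : X ⟶ Spec (CommRingCat.of k)) : Scheme :=
  Limits.pullback sX (Spec.map (CommRingCat.ofHom (algebraMap k (AlgebraicClosure k))))

/-- The structure morphism of the base change to the algebraic closure. -/
noncomputable def BaseChangeToClosure.str (k : Type) [Field k] (X : Scheme)
    (sX : X ⟶ Spec (CommRingCat.of k)) :
    BaseChangeToClosure k X sX ⟶ Spec (CommRingCat.of (AlgebraicClosure k)) :=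
  Limits.pullback.snd _ _

/-- A `k`-scheme is geometrically non-rational if its base change to the algebraic
closure is not birational to the projective line.  For a smooth projective curve this
says exactly that the curve has positive genus. -/
def GeometricallyNonRational (k : Type) [Field k] (X : Scheme)
    (sX : X ⟶ Spec (CommRingCat.of k)) : Prop :=
  ¬ BirationalOver (AlgebraicClosure k) (BaseChangeToClosure k X sX)
      (ProjSpace (AlgebraicClosure k) 1)
      (BaseChangeToClosure.str k X sX) (ProjSpace.str (AlgebraicClosure k) 1)

/-- A point of a scheme is a closed point. -/
def Scheme.IsClosedPoint {X : Scheme} (x : X) : Prop := IsClosed ({x} : Set X)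

/-- A smooth projective integral curve over `k`. -/
structure SmoothProjectiveCurve (k : Type) [Field k] where
  X : Scheme
  str : X ⟶ Spec (CommRingCat.of k)
  integral : IsIntegral X
  smooth : IsSmooth str
  projective : IsProjectiveOver k X str
  dim_one : topologicalKrullDim X = 1

/-- A smooth projective curve has positive genus if and only if it is not (geometrically)
rational; this is the classical characterization `genus = 0 ↔ rational` of smooth
projective curves over an algebraically closed field. -/
def SmoothProjectiveCurve.PositiveGenus {k : Type} [Field k]
    (C : SmoothProjectiveCurve k) : Prop :=
  GeometricallyNonRational k C.X C.str
/-- An elliptic curve over `k`: a smooth projective integral curve with a chosen rational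
point, which geometrically (after base change to the algebraic closure) is non-rational
(genus ≥ 1) and homogeneous, i.e. its automorphism group acts transitively on closed
points (this fails for curves of genus ≥ 2, whose automorphism groups are finite).  For
smooth projective curves over an algebraically closed field these two conditions
characterize exactly the curves of genus one, so this structure encodes a smooth
projective curve of genus `1` with a chosen point. -/
structure EllipticCurveOver (k : Type) [Field k] extends SmoothProjectiveCurve k where
  origin : Spec (CommRingCat.of k) ⟶ X
  origin_section : origin ≫ str = 𝟙 _
  geom_nonrational : GeometricallyNonRational k X str
  geom_homogeneous :
    ∀ x y : BaseChangeToClosure k X str, Scheme.IsClosedPoint x → Scheme.IsClosedPoint y →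
      ∃ g : Aut (Over.mk (BaseChangeToClosure.str k X str)), g.hom.left.base x = y


section
open Polynomial

namespace CurveField

/-- A one-variable function field, described through the linear dependence of elements
over the rational subfields generated by nonconstant elements. -/
class IsCurveField (k K : Type*) [Field k] [Field K] [Algebra k K] : Prop where
  exists_rel : ∀ t : K, t ∉ (algebraMap k K).range → ∃ n : ℕ, ∀ a : Fin (n + 1) → K,
    ∃ φ : Fin (n + 1) → k[X], φ ≠ 0 ∧ ∑ i, Polynomial.aeval t (φ i) * a i = 0
  exists_nonconst : ∃ t : K, t ∉ (algebraMap k K).range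

theorem finite_of_not_linearIndependent {k M : Type*} [Field k] [AddCommGroup M] [Module k M]
    {n : ℕ} (h : ∀ a : Fin (n + 1) → M, ¬ LinearIndependent k a) :
    Module.Finite k M ∧ Module.finrank k M ≤ n := by
  have h1 : Module.rank k M ≤ n := by
    by_contra hc
    rw [not_le] at hc
    have h2 : ((n + 1 : ℕ) : Cardinal) ≤ Module.rank k M := by
      rw [Nat.cast_succ, ← Cardinal.succ_natCast] 
      exact Order.succ_le_of_lt hc
    obtain ⟨v, hv⟩ := le_rank_iff_exists_linearIndependent_finset.1 h2
    obtain ⟨hv1, hv2⟩ := hv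
    exact h (fun i => ((v.equivFinOfCardEq hv1).symm i : M))
      (hv2.comp _ (v.equivFinOfCardEq hv1).symm.injective)
  have h3 : Module.Finite k M := by
    rw [← Module.rank_lt_aleph0_iff]
    exact h1.trans_lt (Cardinal.natCast_lt_aleph0)
  exact ⟨h3, Module.finrank_le_of_rank_le h1⟩

variable {k K : Type*} [Field k] [Field K] [Algebra k K]

theorem exists_primitive_rel {n : ℕ} {t : K} (ht : t ≠ 0) (a : Fin (n + 1) → K)
    (h : ∃ φ : Fin (n + 1) → k[X], φ ≠ 0 ∧ ∑ i, Polynomial.aeval t (φ i) * a i = 0) :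
    ∃ c : Fin (n + 1) → k, c ≠ 0 ∧ ∃ ψ : Fin (n + 1) → k[X],
      ∑ i, algebraMap k K (c i) * a i = t * ∑ i, Polynomial.aeval t (ψ i) * a i := by
  obtain ⟨φ, hφ, hs⟩ := h
  obtain ⟨j, hj⟩ := Function.ne_iff.1 hφ
  generalize hN : (φ j).natDegree = N
  induction N using Nat.strong_induction_on generalizing φ with
  | _ N ih =>
    have key : ∀ i, Polynomial.aeval t (φ i) = t * Polynomial.aeval t (φ i).divX + algebraMap k K ((φ i).coeff 0) := by
      intro i
      conv_lhs => rw [← divX_mul_X_add (φ i)]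
      simp only [map_add, map_mul, Polynomial.aeval_X, Polynomial.aeval_C, mul_comm]
    by_cases hc : (fun i => (φ i).coeff 0) = 0
    · have hc' : ∀ i, (φ i).coeff 0 = 0 := fun i => congrFun hc i
      have hj' : (φ j).divX ≠ 0 := by
        intro h0
        apply hj
        rw [← divX_mul_X_add (φ j), h0, hc' j]; simp
      refine ih _ ?_ (fun i => (φ i).divX) (fun h0 => hj' (congrFun h0 j)) ?_ hj' rfl
      · subst hN
        show (φ j).divX.natDegree < _
        rw [natDegree_divX_eq_natDegree_tsub_one]
        have : (φ j).natDegree ≠ 0 := by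
          intro h0
          apply hj
          rw [eq_C_of_natDegree_eq_zero h0, hc' j]; simp
        omega
      · have : t * ∑ i, Polynomial.aeval t (φ i).divX * a i = 0 := by
          rw [← hs, Finset.mul_sum]
          refine Finset.sum_congr rfl fun i _ => ?_
          rw [key i, hc' i]; simp [mul_assoc]
        exact (mul_eq_zero.1 this).resolve_left ht
    · refine ⟨_, hc, fun i => -(φ i).divX, ?_⟩
      rw [← sub_eq_zero, ← hs, Finset.mul_sum, ← Finset.sum_sub_distrib]
      refine Finset.sum_congr rfl fun i _ => ?_
      rw [key i]; simp; ring

variable (k) in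
/-- A nontrivial valuation ring of `K` containing the constants `k`. -/
structure IsPlace (O : ValuationSubring K) : Prop where
  ne_top : O ≠ ⊤
  algebraMap_mem : ∀ c : k, algebraMap k K c ∈ O

theorem aeval_mem_subring {A : Subring K} (hA : ∀ c : k, algebraMap k K c ∈ A) {t : K} (ht : t ∈ A)
    (p : k[X]) : Polynomial.aeval t p ∈ A := by
  rw [aeval_eq_sum_range]
  refine Subring.sum_mem _ fun i _ => ?_
  rw [Algebra.smul_def]
  exact mul_mem (hA _) (pow_mem ht _)

theorem exists_rel_mod [IsCurveField k K] {t : K} (ht : t ∉ (algebraMap k K).range) :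
    ∃ n : ℕ, ∀ A : Subring K, (∀ c : k, algebraMap k K c ∈ A) → t ∈ A →
      ∀ a : Fin (n + 1) → K, (∀ i, a i ∈ A) →
      ∃ c : Fin (n + 1) → k, c ≠ 0 ∧ ∃ y ∈ A, ∑ i, algebraMap k K (c i) * a i = t * y := by
  have ht0 : t ≠ 0 := fun h => ht (h ▸ zero_mem _)
  obtain ⟨n, hn⟩ := IsCurveField.exists_rel (k := k) t ht
  refine ⟨n, fun A hA htA a ha => ?_⟩
  obtain ⟨c, hc, ψ, h⟩ := exists_primitive_rel ht0 a (hn a)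
  exact ⟨c, hc, _, Subring.sum_mem _ fun i _ =>
    mul_mem (aeval_mem_subring hA htA _) (ha i), h⟩

theorem IsPlace.not_const {O : ValuationSubring K} (hO : IsPlace k O) {t : K}
    (ht : t⁻¹ ∉ O) : t ∉ (algebraMap k K).range := by
  rintro ⟨c, rfl⟩
  apply ht
  rw [← map_inv₀]
  exact hO.algebraMap_mem _

theorem IsPlace.exists_inv_notMem {O : ValuationSubring K} (hO : IsPlace k O) :
    ∃ t ∈ O, t⁻¹ ∉ O := by
  by_contra! h
  apply hO.ne_top
  rw [eq_top_iff]
  intro x _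
  rcases O.mem_or_inv_mem x with h1 | h1
  · exact h1
  · simpa using h _ h1

theorem IsPlace.isDVR [IsCurveField k K] {O : ValuationSubring K} (hO : IsPlace k O) :
    IsDiscreteValuationRing O := by
  let _ : Algebra k O := ((algebraMap k K).codRestrict O hO.algebraMap_mem).toAlgebra
  have hsm : ∀ (c : k) (x : O), ((c • x : O) : K) = algebraMap k K c * x := fun c x => by
    rw [Algebra.smul_def]; rfl
  have key : ∀ t : O, (t : K)⁻¹ ∉ O → IsNoetherian O (O ⧸ Ideal.span {t}) := by
    intro t ht
    obtain ⟨n, hn⟩ := exists_rel_mod (hO.not_const ht)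
    have : Module.Finite k (O ⧸ Ideal.span {t}) := by
      refine (finite_of_not_linearIndependent (n := n) fun a hli => ?_).1
      choose b hb using fun i => Ideal.Quotient.mk_surjective (a i)
      obtain ⟨c, hc, y, hy, h⟩ := hn O.toSubring hO.algebraMap_mem t.2 (fun i => b i)
        (fun i => (b i).2)
      apply hc
      rw [Fintype.linearIndependent_iff] at hli
      funext i
      refine hli c ?_ i
      have : ∑ i, c i • b i = t * ⟨y, hy⟩ := by
        apply Subtype.ext
        push_cast
        simp only [hsm]
        exact h
      have h2 := congrArg (Ideal.Quotient.mk (Ideal.span {t})) this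
      rw [map_mul, Ideal.Quotient.eq_zero_iff_mem.2 (Ideal.mem_span_singleton_self t), zero_mul,
        map_sum] at h2
      rw [← h2]
      refine Finset.sum_congr rfl fun i _ => ?_
      rw [← hb i]
      rfl
    have : IsNoetherian k (O ⧸ Ideal.span {t}) := inferInstance
    exact isNoetherian_of_tower k this
  have hN : IsNoetherianRing O := by
    refine ⟨fun I => ?_⟩
    by_cases hI : I = ⊥
    · subst hI; exact Submodule.fg_bot
    obtain ⟨t, htI, ht0⟩ := Submodule.exists_mem_ne_zero_of_ne_bot hI
    by_cases ht : (t : K)⁻¹ ∈ O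
    · have : I = ⊤ := by
        rw [Ideal.eq_top_iff_one]
        have h1 : (1 : O) = ⟨_, ht⟩ * t := by
          apply Subtype.ext
          have : (t : K) ≠ 0 := fun h => ht0 (Subtype.ext h)
          simp [this]
        rw [h1]
        exact Ideal.mul_mem_left I _ htI
      rw [this]
      exact Ideal.fg_top O
    · have := key t ht
      have hle : Ideal.span {t} ≤ I := by
        rw [Ideal.span_singleton_le_iff_mem]; exact htI
      refine Submodule.fg_of_fg_map_of_fg_inf_ker (Submodule.mkQ (Ideal.span {t}))
        (IsNoetherian.noetherian _) ?_
      rw [Submodule.ker_mkQ, inf_eq_right.2 hle]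
      exact ⟨{t}, by simp⟩
  have hnf : ¬ IsField O := by
    intro h
    obtain ⟨t, ht, ht'⟩ := hO.exists_inv_notMem
    have h0 : (⟨t, ht⟩ : O) ≠ 0 := by
      intro h0
      apply ht'
      have : t = 0 := congrArg Subtype.val h0
      simp [this]
    obtain ⟨s, hs⟩ := h.mul_inv_cancel h0
    apply ht'
    have : t * s = 1 := congrArg Subtype.val hs
    rw [← eq_inv_of_mul_eq_one_right this]
    exact s.2
  exact ((IsDiscreteValuationRing.TFAE O hnf).out 0 1).2 (inferInstance : ValuationRing O)

end CurveField

end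

section
open Polynomial WithZero

namespace CurveField

variable (k K : Type*) [Field k] [Field K] [Algebra k K]

/-- The places of `K` over `k`. -/
def Place : Type _ := {O : ValuationSubring K // IsPlace k O}

variable {k K}

namespace Place

section
variable [IsCurveField k K]

/-- The normalized valuation attached to a place. -/
noncomputable def v (P : Place k K) : Valuation K ℤᵐ⁰ :=
  haveI := P.2.isDVR
  (IsDiscreteValuationRing.maximalIdeal P.1).valuation K

theorem v_le_one (P : Place k K) {x : K} : P.v x ≤ 1 ↔ x ∈ P.1 := by
  have := P.2.isDVR
  constructor
  · intro h
    obtain ⟨a, rfl⟩ := IsDiscreteValuationRing.exists_lift_of_le_one h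
    exact a.2
  · intro h
    exact IsDedekindDomain.HeightOneSpectrum.valuation_le_one
      (IsDiscreteValuationRing.maximalIdeal P.1) ⟨x, h⟩

theorem exists_uniformizer (P : Place k K) : ∃ t, P.v t = exp (-1) :=
  haveI := P.2.isDVR
  IsDedekindDomain.HeightOneSpectrum.valuation_exists_uniformizer K _

theorem v_const_le (P : Place k K) (c : k) : P.v (algebraMap k K c) ≤ 1 :=
  P.v_le_one.2 (P.2.algebraMap_mem c)

theorem v_const (P : Place k K) {c : k} (hc : c ≠ 0) : P.v (algebraMap k K c) = 1 := by
  refine le_antisymm (P.v_const_le c) ?_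
  have h := P.v_const_le c⁻¹
  rw [map_inv₀, map_inv₀] at h
  have h0 : P.v (algebraMap k K c) ≠ 0 := by simpa using hc
  exact (inv_le_one₀ (zero_lt_iff.2 h0)).1 h

theorem v_smul_le (P : Place k K) (c : k) (x : K) : P.v (c • x) ≤ P.v x := by
  rw [Algebra.smul_def, map_mul]
  exact mul_le_of_le_one_left' (P.v_const_le c)

theorem v_smul (P : Place k K) {c : k} (hc : c ≠ 0) (x : K) : P.v (c • x) = P.v x := by
  rw [Algebra.smul_def, map_mul, P.v_const hc, one_mul]

theorem eq_of_le {P Q : Place k K} (h : P.1 ≤ Q.1) : P = Q := by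
  have hle : ∀ x, P.v x ≤ 1 → Q.v x ≤ 1 := fun x hx => Q.v_le_one.2 (h (P.v_le_one.1 hx))
  have key : ∀ x, Q.v x ≤ 1 → P.v x ≤ 1 := by
    intro x hx
    by_contra hP
    rw [not_le] at hP
    obtain ⟨t, ht, ht'⟩ := Q.2.exists_inv_notMem
    rw [← v_le_one, not_le] at ht'
    have hx0 : x ≠ 0 := by rintro rfl; simp at hP
    have ht0 : t⁻¹ ≠ 0 := by intro h0; simp [h0] at ht'
    -- some power of `x` dominates `t⁻¹` at `P`
    have : ∃ n : ℕ, P.v t⁻¹ ≤ P.v (x ^ n) := by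
      refine ⟨(log (P.v t⁻¹)).toNat, ?_⟩
      have h1 : P.v t⁻¹ ≠ 0 := by simpa using ht0
      have h2 : P.v x ≠ 0 := by simpa using hx0
      rw [map_pow, ← exp_log h1, ← exp_log h2, ← WithZero.exp_nsmul, exp_le_exp, log_exp]
      have h3 : 0 < log (P.v x) := by
        rw [← log_one (M := ℤ)]
        exact (log_lt_log one_ne_zero h2).2 hP
      have := Int.self_le_toNat (log (P.v t⁻¹))
      simp only [nsmul_eq_mul]
      nlinarith
    obtain ⟨n, hn⟩ := this
    have h1 : P.v (t⁻¹ * (x ^ n)⁻¹) ≤ 1 := by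
      rw [map_mul, map_inv₀ _ (x ^ n)]
      refine mul_inv_le_one_of_le₀ hn zero_le
    have h2 := hle _ h1
    rw [map_mul, map_inv₀ _ (x ^ n), map_pow] at h2
    have h3 : Q.v t⁻¹ ≤ Q.v x ^ n := by
      rwa [← div_eq_mul_inv, div_le_one₀ (by simp [zero_lt_iff, hx0])] at h2
    exact absurd (h3.trans (pow_le_one' hx n)) (not_le.2 ht')
  apply Subtype.ext
  apply le_antisymm h
  intro x hx
  exact P.v_le_one.1 (key x (Q.v_le_one.2 hx))

theorem exists_mem_notMem {P Q : Place k K} (h : P ≠ Q) : ∃ x, P.v x ≤ 1 ∧ 1 < Q.v x := by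
  by_contra! hc
  exact h (eq_of_le fun x hx => Q.v_le_one.1 (hc x (P.v_le_one.2 hx)))

theorem lt_exp_iff {x : ℤᵐ⁰} {n : ℤ} : x < exp n ↔ x ≤ exp (n - 1) := by
  rw [← lt_mul_exp_iff_le (by simp), ← exp_add]
  simp

theorem v_lt_one_iff (P : Place k K) {x : K} : P.v x < 1 ↔ P.v x ≤ exp (-1) := by
  rw [← exp_zero, lt_exp_iff]; simp

theorem exists_v_eq (P : Place k K) (n : ℤ) : ∃ t, P.v t = exp n := by
  obtain ⟨t, ht⟩ := P.exists_uniformizer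
  refine ⟨t ^ (-n), ?_⟩
  rw [map_zpow₀, ht, ← WithZero.exp_zsmul]
  simp

theorem exists_v_eq_exp (P : Place k K) {x : K} (hx : x ≠ 0) : ∃ n : ℤ, P.v x = exp n :=
  ⟨log (P.v x), (exp_log (by simpa using hx)).symm⟩

theorem const_of_v_sub [IsAlgClosed k] (P : Place k K) {x : K} {p : k[X]} (hp : p ≠ 0)
    (hx : P.v x ≤ 1) (h : P.v (Polynomial.aeval x p) < 1) : ∃ c : k, P.v (x - algebraMap k K c) < 1 := by
  by_contra! hc
  have hs := (IsAlgClosed.splits p).eq_prod_roots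
  rw [hs] at h
  have h1 : ∀ c : k, P.v (x - algebraMap k K c) = 1 := fun c =>
    le_antisymm ((P.v.map_sub _ _).trans (max_le hx (P.v_const_le c))) (hc c)
  rw [map_mul, map_mul, Polynomial.aeval_C, P.v_const (leadingCoeff_ne_zero.2 hp), map_multiset_prod,
    map_multiset_prod, Multiset.map_map, Multiset.map_map, Multiset.map_congr rfl
      (g := fun _ => (1 : ℤᵐ⁰))] at h
  · simp at h
  · intro a _
    simpa using h1 a

theorem exists_residue [IsAlgClosed k] (P : Place k K) {x : K} (hx : P.v x ≤ 1) :
    ∃ c : k, P.v (x - algebraMap k K c) < 1 := by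
  obtain ⟨t, ht, ht'⟩ := P.2.exists_inv_notMem
  obtain ⟨n, hn⟩ := exists_rel_mod (P.2.not_const ht')
  obtain ⟨c, hc, y, hy, h⟩ := hn P.1.toSubring P.2.algebraMap_mem ht (fun i => x ^ (i : ℕ))
    (fun i => pow_mem (P.v_le_one.1 hx) _)
  have hp : (∑ i : Fin (n + 1), monomial (i : ℕ) (c i)) ≠ 0 := by
    obtain ⟨j, hj⟩ := Function.ne_iff.1 hc
    intro h0
    apply hj
    have := congrArg (fun q => Polynomial.coeff q (j : ℕ)) h0
    simpa [finsetSum_coeff, Polynomial.coeff_monomial, Fin.val_inj] using this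
  refine P.const_of_v_sub hp hx ?_
  have h2 : Polynomial.aeval x (∑ i : Fin (n + 1), monomial (i : ℕ) (c i)) = t * y := by
    rw [← h, map_sum]
    simp [Polynomial.aeval_monomial]
  rw [h2, map_mul]
  have h3 : P.v t < 1 := by
    rw [← v_le_one, not_le, map_inv₀] at ht'
    have := P.v_le_one.2 ht
    by_contra! h4
    have h5 : P.v t = 1 := le_antisymm this h4
    simp [h5] at ht'
  exact mul_lt_one_of_lt_of_le h3 (P.v_le_one.2 hy)

theorem exists_sub_smul_lt [IsAlgClosed k] (P : Place k K) {x y : K} (hy : y ≠ 0)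
    (hx : P.v x ≤ P.v y) : ∃ c : k, P.v (x - c • y) < P.v y := by
  have h0 : 0 < P.v y := by simpa [zero_lt_iff] using hy
  obtain ⟨c, hc⟩ := P.exists_residue (x := x / y) (by rw [map_div₀]; exact (div_le_one₀ h0).2 hx)
  refine ⟨c, ?_⟩
  have : x - c • y = (x / y - algebraMap k K c) * y := by
    rw [Algebra.smul_def]; field_simp
  rw [this, map_mul]
  exact (mul_lt_iff_lt_one_left h0).2 hc

end

end Place

end CurveField

end

section
open Polynomial WithZero

namespace CurveField

theorem exists_pow_mul_le {a : ℤᵐ⁰} (ha : a < 1) (b : ℤᵐ⁰) (n : ℤ) :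
    ∃ M : ℕ, ∀ m ≥ M, a ^ m * b ≤ exp n := by
  by_cases hb : b = 0
  · exact ⟨0, fun m _ => by simp [hb]⟩
  by_cases ha0 : a = 0
  · exact ⟨1, fun m hm => by simp [ha0, show m ≠ 0 by omega]⟩
  have hla : log a < 0 := by
    rw [← log_one (M := ℤ)]
    exact (log_lt_log ha0 one_ne_zero).2 ha
  refine ⟨(log b - n).toNat, fun m hm => ?_⟩
  rw [← exp_log ha0, ← exp_log hb, ← WithZero.exp_nsmul, ← exp_add, exp_le_exp]
  have h1 := Int.self_le_toNat (log b - n)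
  have h2 : ((log b - n).toNat : ℤ) ≤ m := by exact_mod_cast hm
  simp only [nsmul_eq_mul]
  nlinarith

variable {k K : Type*} [Field k] [Field K] [Algebra k K]

theorem inv_mem_range_iff {x : K} :
    x⁻¹ ∈ (algebraMap k K).range ↔ x ∈ (algebraMap k K).range :=
  inv_mem_iff (S := Subfield K) (H := (algebraMap k K).fieldRange)

namespace Place

variable [IsCurveField k K]

theorem v_one_add_of_lt (P : Place k K) {u : K} (h : P.v u < 1) : P.v (1 + u) = 1 := by
  rw [Valuation.map_add_eq_of_lt_left] <;> simp [h]

theorem v_one_add_of_gt (P : Place k K) {u : K} (h : 1 < P.v u) : P.v (1 + u) = P.v u := by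
  rw [Valuation.map_add_eq_of_lt_right]; simpa using h

theorem exists_gt_forall_lt (Q : Place k K) (T : Finset (Place k K)) (hQ : Q ∉ T) :
    ∃ y, 1 < Q.v y ∧ ∀ P ∈ T, P.v y < 1 := by
  classical
  induction T using Finset.induction_on with
  | empty =>
    obtain ⟨y, hy⟩ := Q.exists_v_eq 1
    exact ⟨y, by rw [hy, ← exp_zero, exp_lt_exp]; norm_num, by simp⟩
  | insert P T hP ih =>
    rw [Finset.mem_insert, not_or] at hQ
    obtain ⟨y, hyQ, hyT⟩ := ih hQ.2
    obtain ⟨x1, hx1, hx1'⟩ := exists_mem_notMem (Ne.symm hQ.1)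
    obtain ⟨x2, hx2, hx2'⟩ := exists_mem_notMem hQ.1
    have hz : ∃ z, 1 < Q.v z ∧ P.v z < 1 := by
      refine ⟨x1 / x2, ?_, ?_⟩
      · rw [map_div₀, one_lt_div₀]
        · exact hx2.trans_lt hx1'
        · have : x2 ≠ 0 := by rintro rfl; simp at hx2'
          simpa [zero_lt_iff] using this
      · rw [map_div₀, div_lt_one₀ (zero_lt_one.trans hx2')]
        exact hx1.trans_lt hx2'
    obtain ⟨z, hzQ, hzP⟩ := hz
    have hM : ∃ M : ℕ, ∀ m ≥ M, ∀ R ∈ T, R.v y ^ m * R.v z < 1 := by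
      choose! M hM using fun R (hR : R ∈ T) => exists_pow_mul_le (hyT R hR) (R.v z) (-1)
      refine ⟨T.sup M, fun m hm R hR => ?_⟩
      rw [← exp_zero, lt_exp_iff]
      exact hM R hR m ((Finset.le_sup hR).trans hm)
    obtain ⟨M, hM⟩ := hM
    have h1 := hM (M + 1) (by omega)
    by_cases hyP : P.v y ≤ 1
    · refine ⟨y ^ (M + 1) * z, ?_, ?_⟩
      · rw [map_mul, map_pow]
        exact hzQ.trans_le (le_mul_of_one_le_left' (one_le_pow₀ hyQ.le))
      · intro R hR
        rw [map_mul, map_pow]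
        rcases Finset.mem_insert.1 hR with rfl | hR
        · rw [mul_comm]
          exact mul_lt_one_of_lt_of_le hzP (pow_le_one' hyP _)
        · exact h1 R hR
    · rw [not_le] at hyP
      have hbig : ∀ R : Place k K, 1 < R.v y → R.v (y ^ (M + 1) / (1 + y ^ (M + 1))) = 1 := by
        intro R hR
        have : 1 < R.v (y ^ (M + 1)) := by
          rw [map_pow]; exact one_lt_pow₀ hR (by omega)
        rw [map_div₀, R.v_one_add_of_gt this, div_self (zero_lt_one.trans this).ne']
      refine ⟨y ^ (M + 1) / (1 + y ^ (M + 1)) * z, ?_, ?_⟩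
      · rw [map_mul, hbig Q hyQ, one_mul]; exact hzQ
      · intro R hR
        rw [map_mul]
        rcases Finset.mem_insert.1 hR with rfl | hR
        · rw [hbig R hyP, one_mul]; exact hzP
        · have : R.v (y ^ (M + 1)) < 1 := by
            rw [map_pow]; exact pow_lt_one₀ zero_le (hyT R hR) (by omega)
          rw [map_div₀, R.v_one_add_of_lt this, div_one, map_pow]
          exact h1 R hR

theorem exists_approx_one (Q : Place k K) (T : Finset (Place k K)) (hQ : Q ∉ T) (y : K) (n : ℤ) :
    ∃ z, Q.v (z - y) ≤ exp n ∧ ∀ P ∈ T, P.v z ≤ exp n := by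
  obtain ⟨u, huQ, huT⟩ := exists_gt_forall_lt Q T hQ
  have hQ' : Q.v u⁻¹ < 1 := by rw [map_inv₀]; exact inv_lt_one_of_one_lt₀ huQ
  obtain ⟨M₀, hM₀⟩ := exists_pow_mul_le hQ' (Q.v y) n
  choose! M hM using fun R (hR : R ∈ T) => exists_pow_mul_le (huT R hR) (R.v y) n
  set m := max M₀ (T.sup M) + 1 with hm
  have hQm : 1 < Q.v (u ^ m) := by rw [map_pow]; exact one_lt_pow₀ huQ (by omega)
  refine ⟨u ^ m / (1 + u ^ m) * y, ?_, ?_⟩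
  · have h0 : 1 + u ^ m ≠ 0 := by
      intro h
      have := Q.v_one_add_of_gt hQm
      rw [h, map_zero] at this
      rw [← this] at hQm
      simp at hQm
    have : u ^ m / (1 + u ^ m) * y - y = - ((1 + u ^ m)⁻¹ * y) := by field_simp; ring
    rw [this, Valuation.map_neg, map_mul, map_inv₀, Q.v_one_add_of_gt hQm, map_pow, ← inv_pow,
      ← map_inv₀]
    exact hM₀ m (by omega)
  · intro P hP
    have : P.v (u ^ m) < 1 := by
      rw [map_pow]; exact pow_lt_one₀ zero_le (huT P hP) (by omega)
    rw [map_mul, map_div₀, P.v_one_add_of_lt this, div_one, map_pow]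
    refine hM P hP m ?_
    have := Finset.le_sup (f := M) hP
    omega

theorem weak_approx (T : Finset (Place k K)) (y : Place k K → K) (n : ℤ) :
    ∃ z, ∀ P ∈ T, P.v (z - y P) ≤ exp n := by
  classical
  choose z hz using fun Q : Place k K => exists_approx_one Q (T.erase Q) (by simp) (y Q) n
  refine ⟨∑ Q ∈ T, z Q, fun P hP => ?_⟩
  rw [← Finset.add_sum_erase _ _ hP, add_sub_right_comm]
  refine P.v.map_add_le (hz P).1 (P.v.map_sum_le fun Q hQ => (hz Q).2 P ?_)
  rw [Finset.mem_erase] at hQ ⊢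
  exact ⟨fun h => hQ.1 h.symm, hP⟩

theorem not_const_of_gt (P : Place k K) {x : K} (h : 1 < P.v x) :
    x ∉ (algebraMap k K).range := by
  rintro ⟨c, rfl⟩
  exact absurd (P.v_const_le c) (not_le.2 h)

theorem finite_poles (x : K) : {P : Place k K | 1 < P.v x}.Finite := by
  by_contra hinf
  let f := Set.Infinite.natEmbedding _ hinf
  have hx : x⁻¹ ∉ (algebraMap k K).range := fun h =>
    (f 0).1.not_const_of_gt (f 0).2 (inv_mem_range_iff.1 h)
  obtain ⟨n, hn⟩ := exists_rel_mod hx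
  classical
  let T : Finset (Place k K) := Finset.univ.image (fun i : Fin (n + 1) => (f i).1)
  have hinj : ∀ i j : Fin (n + 1), (f i).1 = (f j).1 → i = j := fun i j h =>
    Fin.ext (f.injective (Subtype.ext h))
  choose a ha using fun i : Fin (n + 1) =>
    weak_approx T (fun P => if P = (f i).1 then 1 else 0) (-1)
  have hone : ∀ i : Fin (n + 1), (f i).1.v (a i) = 1 := fun i => by
    have := ha i (f i).1 (by simp [T])
    simp only [if_true] at this
    rw [show a i = 1 + (a i - 1) by ring]
    exact v_one_add_of_lt _ ((v_lt_one_iff _).2 this)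
  have hlt : ∀ i j : Fin (n + 1), i ≠ j → (f j).1.v (a i) < 1 := fun i j hij => by
    have := ha i (f j).1 (by simp [T])
    rw [if_neg (fun h => hij (hinj _ _ h).symm), sub_zero] at this
    exact (v_lt_one_iff _).2 this
  let A : Subring K := ⨅ i : Fin (n + 1), (f i).1.1.toSubring
  have hA : ∀ x, x ∈ A ↔ ∀ i : Fin (n + 1), (f i).1.v x ≤ 1 := fun x => by
    simp [A, Subring.mem_iInf, v_le_one, ValuationSubring.mem_toSubring]
  have hxlt : ∀ i : Fin (n + 1), (f i).1.v x⁻¹ < 1 := fun i => by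
    rw [map_inv₀]; exact inv_lt_one_of_one_lt₀ (f i).2
  obtain ⟨c, hc, y, hy, h⟩ := hn A (fun c => (hA _).2 fun i => v_const_le _ _)
    ((hA _).2 fun i => (hxlt i).le) a (fun i => (hA _).2 fun j => by
      by_cases hij : i = j
      · subst hij; exact (hone i).le
      · exact (hlt i j hij).le)
  obtain ⟨j, hj⟩ := Function.ne_iff.1 hc
  have h1 : (f j).1.v (x⁻¹ * y) < 1 := by
    rw [map_mul]; exact mul_lt_one_of_lt_of_le (hxlt j) ((hA _).1 hy j)
  rw [← h, ← Finset.add_sum_erase _ _ (Finset.mem_univ j), Valuation.map_add_eq_of_lt_left] at h1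
  · rw [map_mul, v_const _ hj, hone] at h1
    simp at h1
  · rw [map_mul, v_const _ hj, hone, mul_one]
    refine Valuation.map_sum_lt _ one_ne_zero fun i hi => ?_
    rw [map_mul]
    rw [mul_comm]
    exact mul_lt_one_of_lt_of_le (hlt i j (Finset.ne_of_mem_erase hi)) (v_const_le _ _)

end Place

end CurveField

end

section
open Polynomial WithZero

namespace CurveField

variable {k K : Type*} [Field k] [Field K] [Algebra k K]

theorem aeval_ne_zero [IsAlgClosed k] {x : K} (hx : x ∉ (algebraMap k K).range) {p : k[X]}
    (hp : p ≠ 0) : Polynomial.aeval x p ≠ 0 := by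
  intro h
  rw [(IsAlgClosed.splits p).eq_prod_roots, map_mul, map_multiset_prod, mul_eq_zero,
    Multiset.prod_eq_zero_iff] at h
  rcases h with h | h
  · simp [hp] at h
  · simp only [Multiset.map_map, Multiset.mem_map, Function.comp] at h
    obtain ⟨c, -, hc⟩ := h
    apply hx
    refine ⟨c, ?_⟩
    simp only [map_sub, Polynomial.aeval_X, Polynomial.aeval_C] at hc
    exact (sub_eq_zero.1 hc).symm

namespace Place

variable [IsCurveField k K]

/-- The functions with pole order at most `n` at the place `P`. -/
def fil (P : Place k K) (n : ℤ) : Submodule k K where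
  carrier := {x | P.v x ≤ exp n}
  add_mem' := fun ha hb => P.v.map_add_le ha hb
  zero_mem' := by simp
  smul_mem' := fun c x hx => (P.v_smul_le c x).trans hx

theorem mem_fil {P : Place k K} {n : ℤ} {x : K} : x ∈ P.fil n ↔ P.v x ≤ exp n := Iff.rfl

theorem mem_fil_zero {P : Place k K} {x : K} : x ∈ P.fil 0 ↔ P.v x ≤ 1 := by
  rw [mem_fil, exp_zero]

/-- The functions without poles outside the place `P`. -/
def R (P : Place k K) : Subalgebra k K where
  carrier := {x | ∀ Q, Q ≠ P → Q.v x ≤ 1}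
  add_mem' := fun ha hb Q hQ => Q.v.map_add_le (ha Q hQ) (hb Q hQ)
  mul_mem' := fun ha hb Q hQ => by
    rw [map_mul]; exact mul_le_one' (ha Q hQ) (hb Q hQ)
  algebraMap_mem' := fun c Q _ => Q.v_const_le c

theorem exists_pole [IsAlgClosed k] {x : K} (hx : x ∉ (algebraMap k K).range) :
    ∃ P : Place k K, 1 < P.v x := by
  have hx0 : x ≠ 0 := fun h => hx (h ▸ zero_mem _)
  let A : Subring K := (Algebra.adjoin k {x⁻¹}).toSubring
  have hxA : x⁻¹ ∈ A := Algebra.subset_adjoin rfl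
  have hI : Ideal.span {(⟨x⁻¹, hxA⟩ : A)} ≠ ⊤ := by
    rw [Ne, Ideal.span_singleton_eq_top]
    intro hu
    obtain ⟨⟨b, hb⟩, hb'⟩ := isUnit_iff_exists_inv.1 hu
    have hb1 : x⁻¹ * b = 1 := congrArg Subtype.val hb'
    have hb2 : b ∈ Algebra.adjoin k {x⁻¹} := hb
    rw [Algebra.adjoin_singleton_eq_range_aeval] at hb2
    obtain ⟨p, rfl⟩ := hb2
    have hne : (Polynomial.X * p - 1 : k[X]) ≠ 0 := by
      intro h
      have := congrArg (Polynomial.eval 0) h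
      simp at this
    apply aeval_ne_zero (fun h => hx (inv_mem_range_iff.1 h)) hne
    simp only [map_sub, map_mul, Polynomial.aeval_X, map_one, sub_eq_zero]
    exact hb1
  obtain ⟨B, hAB, hB⟩ := Ideal.image_subset_nonunits_valuationSubring _ hI
  have h1 : x ∉ B := by
    have : x⁻¹ ∈ B.nonunits := hB ⟨_, Ideal.mem_span_singleton_self _, rfl⟩
    intro h
    rw [ValuationSubring.mem_nonunits_iff] at this
    have h2 := (B.valuation_le_one_iff x).2 h
    rw [map_inv₀] at this
    have h3 : B.valuation x ≠ 0 := by simpa using hx0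
    exact absurd this (not_lt.2 ((one_le_inv₀ (zero_lt_iff.2 h3)).2 h2))
  let P : Place k K := ⟨B, fun h => h1 (h ▸ trivial),
    fun c => hAB (Subalgebra.algebraMap_mem _ c)⟩
  refine ⟨P, ?_⟩
  rw [← not_le, v_le_one]
  exact h1

theorem const_of_forall [IsAlgClosed k] {x : K} (h : ∀ P : Place k K, P.v x ≤ 1) :
    x ∈ (algebraMap k K).range := by
  by_contra hx
  obtain ⟨P, hP⟩ := exists_pole hx
  exact absurd (h P) (not_le.2 hP)

omit [IsCurveField k K] in
theorem sub_const_notMem {x : K} (hx : x ∉ (algebraMap k K).range) (c : k) :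
    x - algebraMap k K c ∉ (algebraMap k K).range := fun h =>
  hx (by simpa using add_mem h ⟨c, rfl⟩)

variable (k K) in
theorem infinite [IsAlgClosed k] : Infinite (Place k K) := by
  obtain ⟨x, hx⟩ := IsCurveField.exists_nonconst (k := k) (K := K)
  choose P hP using fun c : k => exists_pole
    (fun h => sub_const_notMem hx c (inv_mem_range_iff.1 h))
  have hinf : Infinite k := IsAlgClosed.instInfinite
  refine Infinite.of_injective P fun a b hab => ?_
  by_contra hne
  have hlt : ∀ c, (P c).v (x - algebraMap k K c) < 1 := fun c => by
    have := hP c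
    rw [map_inv₀] at this
    exact (one_lt_inv_iff₀.1 this).2
  have h1 := hlt a
  have h2 := hlt b
  rw [← hab] at h2
  have h3 : (P a).v (algebraMap k K (b - a)) < 1 := by
    have : algebraMap k K (b - a) = (x - algebraMap k K a) - (x - algebraMap k K b) := by
      rw [map_sub]; ring
    rw [this]
    exact (Valuation.map_sub_lt _ h1 h2)
  rw [v_const _ (sub_ne_zero.2 (Ne.symm hne))] at h3
  exact lt_irrefl _ h3

theorem v_aeval_le (P : Place k K) {x : K} (hx : P.v x ≤ 1) (p : k[X]) : P.v (Polynomial.aeval x p) ≤ 1 :=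
  P.v_le_one.2 (aeval_mem_subring (A := P.1.toSubring) P.2.algebraMap_mem (P.v_le_one.1 hx) p)

theorem exists_denominator [IsAlgClosed k] (x y : K) (F : Finset (Place k K))
    (hF : ∀ Q ∈ F, Q.v x ≤ 1) :
    ∃ q : k[X], q ≠ 0 ∧ (∀ Q ∈ F, Q.v (Polynomial.aeval x q * y) ≤ 1) ∧
      ∀ c, q.eval c = 0 → ∃ Q ∈ F, Q.v (x - algebraMap k K c) < 1 := by
  classical
  induction F using Finset.induction_on with
  | empty => exact ⟨1, one_ne_zero, by simp, by simp⟩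
  | insert P F hP ih =>
    obtain ⟨q, hq, h1, h2⟩ := ih fun Q hQ => hF Q (Finset.mem_insert_of_mem hQ)
    have hPx := hF P (Finset.mem_insert_self _ _)
    obtain ⟨c, hc⟩ := P.exists_residue hPx
    obtain ⟨M, hM⟩ := exists_pow_mul_le hc (P.v y) 0
    have hm : ∀ Q ∈ insert P F, Q.v (Polynomial.aeval x ((Polynomial.X - Polynomial.C c) ^ M)) ≤ 1 := fun Q hQ =>
      Q.v_aeval_le (hF Q hQ) _
    refine ⟨q * (Polynomial.X - Polynomial.C c) ^ M, mul_ne_zero hq (pow_ne_zero _ (X_sub_C_ne_zero c)), ?_, ?_⟩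
    · intro Q hQ
      rw [map_mul (Polynomial.aeval x)]
      rcases Finset.mem_insert.1 hQ with rfl | hQ'
      · rw [mul_assoc, map_mul]
        refine mul_le_one' (Q.v_aeval_le hPx _) ?_
        have := hM M le_rfl
        rw [exp_zero] at this
        simpa using this
      · rw [mul_right_comm, map_mul]
        exact mul_le_one' (h1 Q hQ') (hm Q hQ)
    · intro d hd
      rw [Polynomial.eval_mul, mul_eq_zero] at hd
      rcases hd with hd | hd
      · obtain ⟨Q, hQ, h⟩ := h2 d hd
        exact ⟨Q, Finset.mem_insert_of_mem hQ, h⟩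
      · rw [Polynomial.eval_pow] at hd
        have := eq_zero_of_pow_eq_zero hd
        simp only [Polynomial.eval_sub, Polynomial.eval_X, Polynomial.eval_C, sub_eq_zero] at this
        subst this
        exact ⟨P, Finset.mem_insert_self _ _, hc⟩

theorem exists_denominator_poles [IsAlgClosed k] (x y : K) :
    ∃ q : k[X], q ≠ 0 ∧ ∀ Q : Place k K, Q.v x ≤ 1 → Q.v (Polynomial.aeval x q * y) ≤ 1 := by
  classical
  obtain ⟨q, hq, h, -⟩ := exists_denominator x y
    ((finite_poles (k := k) y).toFinset.filter fun Q => Q.v x ≤ 1) (by simp)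
  refine ⟨q, hq, fun Q hQ => ?_⟩
  by_cases hy : Q.v y ≤ 1
  · rw [map_mul]; exact mul_le_one' (Q.v_aeval_le hQ _) hy
  · exact h Q (by simpa using ⟨not_le.1 hy, hQ⟩)

theorem v_aeval_of_pole (P : Place k K) {x : K} (hx : 1 < P.v x) {p : k[X]} (hp : p ≠ 0) :
    P.v (Polynomial.aeval x p) = P.v x ^ p.natDegree := by
  have hl : p.coeff p.natDegree ≠ 0 := leadingCoeff_ne_zero.2 hp
  rw [aeval_eq_sum_range, Finset.sum_range_succ, Valuation.map_add_eq_of_lt_right]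
  · rw [P.v_smul hl, map_pow]
  · rw [P.v_smul hl, map_pow]
    refine Valuation.map_sum_lt _ (pow_ne_zero _ (zero_lt_one.trans hx).ne') fun i hi => ?_
    refine (P.v_smul_le _ _).trans_lt ?_
    rw [map_pow]
    exact pow_lt_pow_right₀ hx (Finset.mem_range.1 hi)

theorem v_aeval_div_le_one (P : Place k K) {x : K} (hx : 1 < P.v x) {p q : k[X]} (hq : q ≠ 0)
    (h : p.degree ≤ q.degree) : P.v (Polynomial.aeval x p / Polynomial.aeval x q) ≤ 1 := by
  by_cases hp : p = 0
  · simp [hp]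
  rw [map_div₀, P.v_aeval_of_pole hx hp, P.v_aeval_of_pole hx hq]
  refine (div_le_one₀ ?_).2 (pow_le_pow_right₀ hx.le (natDegree_le_natDegree h))
  exact pow_pos (zero_lt_one.trans hx) _

end Place

theorem finiteDimensional_adjoin [IsAlgClosed k] [IsCurveField k K] {x : K}
    (hx : x ∉ (algebraMap k K).range) :
    Module.Finite (IntermediateField.adjoin k {x}) K := by
  obtain ⟨n, hn⟩ := IsCurveField.exists_rel (k := k) x hx
  refine (finite_of_not_linearIndependent (n := n) fun a ha => ?_).1
  obtain ⟨φ, hφ, h⟩ := hn a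
  apply hφ
  rw [Fintype.linearIndependent_iff] at ha
  have hmem : ∀ p : k[X], Polynomial.aeval x p ∈ IntermediateField.adjoin k {x} := fun p =>
    IntermediateField.algebra_adjoin_le_adjoin k _
      (by rw [Algebra.adjoin_singleton_eq_range_aeval]; exact ⟨p, rfl⟩)
  have := ha (fun i => ⟨_, hmem (φ i)⟩) h
  funext i
  by_contra hi
  exact aeval_ne_zero hx hi (congrArg Subtype.val (this i))

end CurveField

end

section
open Polynomial WithZero

namespace CurveField

variable {k K : Type*} [Field k] [IsAlgClosed k] [Field K] [Algebra k K] [IsCurveField k K]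

namespace Place

omit [IsAlgClosed k] in
theorem exists_pos_poles (P : Place k K) : ∃ x : K, 1 < P.v x := by
  obtain ⟨x, hx⟩ := P.exists_v_eq 1
  exact ⟨x, by rw [hx, ← exp_zero, exp_lt_exp]; norm_num⟩

/-- Every element splits into a part regular outside the poles of `x` and a part whose
poles along the poles of `x` are bounded. -/
theorem exists_bounded_split {x : K} (hx : x ∉ (algebraMap k K).range) :
    ∃ c : ℕ, ∀ z : K, ∃ b w : K, z = b + w ∧ (∀ Q : Place k K, Q.v x ≤ 1 → Q.v b ≤ 1) ∧
      ∀ Q : Place k K, 1 < Q.v x → Q.v (x⁻¹ ^ c * w) ≤ 1 := by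
  classical
  have hfin := finiteDimensional_adjoin hx
  let F := IntermediateField.adjoin k {x}
  let bs := Module.finBasis F K
  choose q hq hq' using fun j => exists_denominator_poles (k := k) x (bs j)
  let y := fun j => Polynomial.aeval x (q j) * bs j
  let T := (finite_poles (k := k) x).toFinset
  have hT : ∀ Q, Q ∈ T ↔ 1 < Q.v x := by simp [T]
  have hc : ∃ c : ℕ, ∀ j, ∀ Q ∈ T, Q.v (x⁻¹ ^ c * y j) ≤ 1 := by
    choose! M hM using fun j Q (hQ : Q ∈ T) => exists_pow_mul_le
      (show Q.v x⁻¹ < 1 by rw [map_inv₀]; exact inv_lt_one_of_one_lt₀ ((hT Q).1 hQ)) (Q.v (y j)) 0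
    refine ⟨Finset.univ.sup fun j => T.sup fun Q => M j Q, fun j Q hQ => ?_⟩
    rw [map_mul, map_pow, ← exp_zero]
    refine hM j Q hQ _ ?_
    exact (Finset.le_sup (f := fun Q => M j Q) hQ).trans
      (Finset.le_sup (f := fun j => T.sup fun Q => M j Q) (Finset.mem_univ j))
  obtain ⟨c, hc⟩ := hc
  have hfrac : ∀ (z : K) j, ∃ g h : k[X], h ≠ 0 ∧
      ((bs.repr z j : F) : K) * bs j = Polynomial.aeval x g / Polynomial.aeval x h * y j := by
    intro z j
    obtain ⟨r, s, hrs⟩ := (IntermediateField.mem_adjoin_simple_iff k _).1 (bs.repr z j).2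
    have hqx := aeval_ne_zero hx (hq j)
    by_cases hs : s = 0
    · refine ⟨0, 1, one_ne_zero, ?_⟩
      rw [hrs, hs]; simp
    · refine ⟨r, s * q j, mul_ne_zero hs (hq j), ?_⟩
      have hsx := aeval_ne_zero hx hs
      rw [hrs]
      simp only [y, map_mul]
      field_simp
  choose g h hh hgh using hfrac
  refine ⟨c, fun z => ⟨∑ j, Polynomial.aeval x (g z j / h z j) * y j,
    ∑ j, Polynomial.aeval x (g z j % h z j) / Polynomial.aeval x (h z j) * y j, ?_, ?_, ?_⟩⟩
  · rw [← Finset.sum_add_distrib]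
    conv_lhs => rw [← bs.sum_repr z]
    refine Finset.sum_congr rfl fun j _ => ?_
    rw [Algebra.smul_def]
    show ((bs.repr z j : F) : K) * bs j = _
    rw [hgh z j]
    conv_lhs => rw [← EuclideanDomain.div_add_mod (g z j) (h z j)]
    have hhx := aeval_ne_zero hx (hh z j)
    rw [map_add, map_mul]
    field_simp
  · intro Q hQ
    refine Q.v.map_sum_le fun j _ => ?_
    rw [map_mul]
    exact mul_le_one' (Q.v_aeval_le hQ _) (hq' j Q hQ)
  · intro Q hQ
    rw [Finset.mul_sum]
    refine Q.v.map_sum_le fun j _ => ?_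
    rw [mul_left_comm, map_mul]
    exact mul_le_one' (Q.v_aeval_div_le_one hQ (hh z j)
      (EuclideanDomain.mod_lt _ (hh z j)).le) (hc j Q ((hT Q).2 hQ))

theorem finite_quotient_zero (P : Place k K) :
    Module.Finite k (K ⧸ (P.fil 0 ⊔ Subalgebra.toSubmodule P.R)) := by
  classical
  obtain ⟨x, hxP⟩ := P.exists_pos_poles
  have hx := P.not_const_of_gt hxP
  have hx0 : x ≠ 0 := fun h => hx (h ▸ zero_mem _)
  obtain ⟨c, hc⟩ := exists_bounded_split hx
  have hu : x⁻¹ ^ (c + 1) ∉ (algebraMap k K).range := by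
    refine fun h => P.not_const_of_gt (k := k) ?_ ((inv_mem_range_iff (x := x ^ (c + 1))).1
      (by simpa using h))
    rw [map_pow]
    exact one_lt_pow₀ hxP (by omega)
  obtain ⟨N, hN⟩ := exists_rel_mod hu
  let T := (finite_poles (k := k) x).toFinset
  have hT : ∀ Q, Q ∈ T ↔ 1 < Q.v x := by simp [T]
  let A : Subring K := ⨅ Q : T, Q.1.1.toSubring
  have hA : ∀ x, x ∈ A ↔ ∀ Q ∈ T, Q.v x ≤ 1 := fun x => by
    simp [A, Subring.mem_iInf, v_le_one, ValuationSubring.mem_toSubring]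
  have hxA : x⁻¹ ∈ A := (hA _).2 fun Q hQ => by
    rw [map_inv₀]; exact inv_le_one_of_one_le₀ ((hT Q).1 hQ).le
  refine (finite_of_not_linearIndependent (n := N) fun a' hli => ?_).1
  choose a ha using fun i => Submodule.mkQ_surjective _ (a' i)
  choose e he using fun i => weak_approx T (fun Q => if Q = P then a i else 0) 0
  choose b w hbw hb hw using fun i => hc (e i)
  obtain ⟨d, hd, y, hy, hs⟩ := hN A (fun c => (hA _).2 fun Q _ => Q.v_const_le c) (pow_mem hxA _)
    (fun i => x⁻¹ ^ (c + 1) * w i) (fun i => (hA _).2 fun Q hQ => by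
      rw [pow_succ', mul_assoc, map_mul]
      exact mul_le_one' ((hA _).1 hxA Q hQ) (hw i Q ((hT Q).1 hQ)))
  have hs' : ∑ i, d i • w i = y := by
    have h0 : x⁻¹ ^ (c + 1) ≠ 0 := by positivity
    apply mul_left_cancel₀ h0
    rw [← hs, Finset.mul_sum]
    refine Finset.sum_congr rfl fun i _ => ?_
    rw [Algebra.smul_def]; ring
  apply hd
  rw [Fintype.linearIndependent_iff] at hli
  funext i
  refine hli d ?_ i
  have hmem : ∑ i, d i • a i ∈ P.fil 0 ⊔ Subalgebra.toSubmodule P.R := by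
    have hsplit : ∑ i, d i • a i = (∑ i, d i • (a i - e i) + y) + ∑ i, d i • b i := by
      rw [← hs', ← Finset.sum_add_distrib, ← Finset.sum_add_distrib]
      refine Finset.sum_congr rfl fun i _ => ?_
      rw [← smul_add, ← smul_add]
      congr 1
      rw [hbw i]; ring
    have hPT : P ∈ T := (hT P).2 hxP
    rw [hsplit]
    refine Submodule.add_mem_sup (Submodule.add_mem _ (Submodule.sum_mem _ fun i _ =>
      Submodule.smul_mem _ _ ?_) (mem_fil_zero.2 ((hA y).1 hy P hPT))) ?_
    · have := he i P hPT
      rw [if_pos rfl] at this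
      rw [← neg_sub]
      exact Submodule.neg_mem _ this
    · intro Q hQ
      by_cases hQT : Q ∈ T
      · have hb' : ∑ i, d i • b i = ∑ i, d i • e i - y := by
          rw [← hs', ← Finset.sum_sub_distrib]
          refine Finset.sum_congr rfl fun i _ => ?_
          rw [← smul_sub, hbw i]; ring_nf
        rw [hb']
        refine Q.v.map_sub_le (Q.v.map_sum_le fun i _ => (Q.v_smul_le _ _).trans ?_)
          ((hA y).1 hy Q hQT)
        have := he i Q hQT
        rw [if_neg hQ, sub_zero, exp_zero] at this
        exact this
      · refine Q.v.map_sum_le fun i _ => (Q.v_smul_le _ _).trans (hb i Q ?_)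
        exact not_lt.1 fun h => hQT ((hT Q).2 h)
  rw [← Submodule.Quotient.mk_eq_zero] at hmem
  rw [← hmem]
  simp only [← ha, Submodule.mkQ_apply]
  rw [← Submodule.mkQ_apply, map_sum]
  simp

end Place
end CurveField

end

section
open Polynomial WithZero

namespace CurveField

variable {k K : Type*} [Field k] [Field K] [Algebra k K] [IsCurveField k K]

namespace Place

theorem exists_v_sum_eq {ι : Type*} (P : Place k K) (s : Finset ι) (n : ι → ℤ)
    (hn : Function.Injective n) (a : ι → K) (ha : ∀ i ∈ s, P.v (a i) = exp (n i)) (c : ι → k)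
    (hc : ∃ i ∈ s, c i ≠ 0) : ∃ i ∈ s, c i ≠ 0 ∧ P.v (∑ i ∈ s, c i • a i) = exp (n i) := by
  classical
  induction s using Finset.induction_on_max_value n with
  | empty => simp at hc
  | insert j s hj hmax ih =>
    rw [Finset.sum_insert hj]
    by_cases hcj : c j = 0
    · rw [hcj, zero_smul, zero_add]
      obtain ⟨i, hi, hci⟩ := hc
      have his : i ∈ s := (Finset.mem_insert.1 hi).resolve_left (by rintro rfl; exact hci hcj)
      obtain ⟨i, hi, h⟩ := ih (fun i hi => ha i (Finset.mem_insert_of_mem hi)) ⟨i, his, hci⟩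
      exact ⟨i, Finset.mem_insert_of_mem hi, h⟩
    · refine ⟨j, Finset.mem_insert_self _ _, hcj, ?_⟩
      have hj' : P.v (c j • a j) = exp (n j) := by
        rw [P.v_smul hcj, ha j (Finset.mem_insert_self _ _)]
      rw [Valuation.map_add_eq_of_lt_left, hj']
      rw [hj']
      refine Valuation.map_sum_lt _ exp_ne_zero fun i hi => (P.v_smul_le _ _).trans_lt ?_
      rw [ha i (Finset.mem_insert_of_mem hi), exp_lt_exp]
      refine lt_of_le_of_ne (hmax i hi) fun h => hj ?_
      rwa [← hn h]

/-- The pole orders at `P` of functions regular outside `P`. -/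
def H (P : Place k K) : Set ℤ := {n | ∃ r ∈ P.R, P.v r = exp n}

theorem zero_mem_H (P : Place k K) : (0 : ℤ) ∈ P.H := ⟨1, one_mem _, by simp⟩

variable [IsAlgClosed k]

theorem const_of_mem_R {P : Place k K} {x : K} (hx : x ∈ P.R) (hP : P.v x ≤ 1) :
    x ∈ (algebraMap k K).range := const_of_forall fun Q => by
  by_cases h : Q = P
  · exact h ▸ hP
  · exact hx Q h

theorem eq_zero_of_mem_R {P : Place k K} {x : K} (hx : x ∈ P.R) (hP : P.v x < 1) : x = 0 := by
  obtain ⟨c, rfl⟩ := const_of_mem_R hx hP.le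
  by_contra h
  rw [P.v_const (by rintro rfl; simp at h)] at hP
  exact lt_irrefl _ hP

theorem nonneg_of_mem_H {P : Place k K} {n : ℤ} (hn : n ∈ P.H) : 0 ≤ n := by
  obtain ⟨x, hx, hx'⟩ := hn
  by_contra! h
  have := eq_zero_of_mem_R hx (by rw [hx', ← exp_zero, exp_lt_exp]; exact h)
  simp [this, exp_ne_zero.symm] at hx'

omit [IsAlgClosed k] in
/-- Elements whose pole orders are distinct gaps are independent modulo regular functions. -/
theorem linearIndependent_gaps (P : Place k K) {ι : Type*} (n : ι → ℤ)
    (hn : Function.Injective n) (a : ι → K) (ha : ∀ i, P.v (a i) = exp (n i))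
    (hgap : ∀ i, n i ∉ P.H) (hpos : ∀ i, 0 < n i) :
    LinearIndependent k fun i =>
      (Submodule.Quotient.mk (a i) : K ⧸ (P.fil 0 ⊔ Subalgebra.toSubmodule P.R)) := by
  rw [linearIndependent_iff']
  intro s c h i hi
  by_contra hci
  obtain ⟨j, hj, hcj, hv⟩ := P.exists_v_sum_eq s n hn a (fun i _ => ha i) c ⟨i, hi, hci⟩
  have hmem : ∑ i ∈ s, c i • a i ∈ P.fil 0 ⊔ Subalgebra.toSubmodule P.R := by
    rw [← Submodule.Quotient.mk_eq_zero, ← h, ← Submodule.mkQ_apply, map_sum]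
    simp
  obtain ⟨o, ho, r, hr, hor⟩ := Submodule.mem_sup.1 hmem
  apply hgap j
  refine ⟨r, hr, ?_⟩
  rw [show r = ∑ i ∈ s, c i • a i - o by rw [← hor]; ring,
    Valuation.map_sub_eq_of_lt_left, hv]
  rw [hv]
  exact (mem_fil.1 ho).trans_lt (exp_lt_exp.2 (hpos j))

theorem finite_gaps (P : Place k K) : {n : ℤ | 0 < n ∧ n ∉ P.H}.Finite := by
  have := P.finite_quotient_zero
  choose a ha using P.exists_v_eq
  have hli := P.linearIndependent_gaps (fun i : {n : ℤ | 0 < n ∧ n ∉ P.H} => i.1)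
    Subtype.val_injective (fun i => a i.1) (fun i => ha i.1) (fun i => i.2.2) (fun i => i.2.1)
  have : Finite {n : ℤ | 0 < n ∧ n ∉ P.H} := hli.finite
  exact Set.toFinite _

theorem exists_bound_H (P : Place k K) : ∃ B : ℕ, ∀ n : ℤ, B ≤ n → n ∈ P.H := by
  obtain ⟨B, hC⟩ := P.finite_gaps.bddAbove
  refine ⟨(B + 1).toNat, fun n hn => ?_⟩
  by_contra h
  have h1 := Int.self_le_toNat (B + 1)
  have h2 : 0 < n := by
    by_contra h0
    have : n = 0 := by omega
    exact h (this ▸ P.zero_mem_H)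
  have := hC ⟨h2, h⟩
  omega

theorem exists_mem_R (P : Place k K) : ∃ f ∈ P.R, 1 < P.v f := by
  obtain ⟨B, hC⟩ := P.exists_bound_H
  obtain ⟨f, hf, hf'⟩ := hC (B + 1) (by omega)
  refine ⟨f, hf, ?_⟩
  rw [hf', ← exp_zero, exp_lt_exp]
  omega

theorem exists_mul_mem_R (P : Place k K) (y : K) : ∃ r ∈ P.R, r ≠ 0 ∧ r * y ∈ P.R := by
  obtain ⟨f, hf, hP⟩ := P.exists_mem_R
  have hfc := P.not_const_of_gt hP
  obtain ⟨q, hq, h⟩ := exists_denominator_poles (k := k) f y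
  exact ⟨Polynomial.aeval f q, aeval_mem_subring (A := P.R.toSubring) (P.R.algebraMap_mem) hf q,
    aeval_ne_zero hfc hq, fun Q hQ => h Q (hf Q hQ)⟩

omit [IsAlgClosed k] in
theorem v_aeval_lt (P : Place k K) {x : K} {c : k} (hc : P.v (x - algebraMap k K c) < 1)
    {q : k[X]} (hq : q.eval c = 0) : P.v (Polynomial.aeval x q) < 1 := by
  obtain ⟨p, rfl⟩ := dvd_iff_isRoot.2 hq
  have hx : P.v x ≤ 1 := by
    rw [show x = (x - algebraMap k K c) + algebraMap k K c by ring]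
    exact P.v.map_add_le hc.le (P.v_const_le c)
  rw [map_mul, map_mul]
  simp only [map_sub, Polynomial.aeval_X, Polynomial.aeval_C]
  exact mul_lt_one_of_lt_of_le hc (P.v_aeval_le hx p)

/-- Strong approximation: a prescribed principal part at one place, poles otherwise only at `P`. -/
theorem strong_approx {P Q : Place k K} (hPQ : Q ≠ P) (y : K) :
    ∃ x, Q.v (x - y) ≤ 1 ∧ ∀ Q', Q' ≠ P → Q' ≠ Q → Q'.v x ≤ 1 := by
  classical
  obtain ⟨f, hf, hP⟩ := P.exists_mem_R
  have hfc := P.not_const_of_gt hP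
  obtain ⟨c, hc⟩ := Q.exists_residue (hf Q hPQ)
  have hinv : ∀ Q' : Place k K, Q'.v (f - algebraMap k K c) < 1 ↔
      1 < Q'.v (f - algebraMap k K c)⁻¹ := fun Q' => by
    rw [map_inv₀, one_lt_inv_iff₀, and_iff_right]
    have := sub_const_notMem hfc c
    have h0 : f - algebraMap k K c ≠ 0 := fun h => this (h ▸ zero_mem _)
    rw [zero_lt_iff]
    simpa using h0
  let T := (finite_poles (k := k) (f - algebraMap k K c)⁻¹).toFinset
  have hT : ∀ Q', Q' ∈ T ↔ Q'.v (f - algebraMap k K c) < 1 := fun Q' => by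
    rw [hinv]; simp [T]
  have hTP : ∀ Q' ∈ T, Q' ≠ P := by
    rintro Q' hQ' rfl
    rw [hT] at hQ'
    have : Q'.v f ≤ 1 := by
      rw [show f = (f - algebraMap k K c) + algebraMap k K c by ring]
      exact Q'.v.map_add_le hQ'.le (Q'.v_const_le c)
    exact absurd this (not_le.2 hP)
  obtain ⟨w, hw⟩ := weak_approx T (fun Q' => if Q' = Q then y else 0) 0
  let F := (finite_poles (k := k) w).toFinset.filter fun Q' => Q' ∉ T ∧ Q' ≠ P
  obtain ⟨b, hb, hb1, hb2⟩ := exists_denominator f w F (fun Q' hQ' => hf Q' (by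
    simp only [F, Finset.mem_filter] at hQ'
    exact hQ'.2.2))
  have hbc : b.eval c ≠ 0 := by
    intro h
    obtain ⟨Q', hQ', h'⟩ := hb2 c h
    simp only [F, Finset.mem_filter] at hQ'
    exact hQ'.2.1 ((hT Q').2 h')
  have hb3 : ∀ Q', Q' ∉ T → Q' ≠ P → Q'.v (Polynomial.aeval f b * w) ≤ 1 := by
    intro Q' h1 h2
    by_cases hw' : Q'.v w ≤ 1
    · rw [map_mul]; exact mul_le_one' (Q'.v_aeval_le (hf Q' h2) b) hw'
    · refine hb1 Q' ?_
      simp only [F, Finset.mem_filter]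
      exact ⟨by simpa using hw', h1, h2⟩
  let e : k[X] := 1 - Polynomial.C (b.eval c)⁻¹ * b
  have he : e.eval c = 0 := by simp [e, hbc]
  have hM : ∃ M : ℕ, ∀ Q' ∈ T, Q'.v (Polynomial.aeval f e ^ M * w) ≤ 1 := by
    choose! M hM using fun Q' (hQ' : Q' ∈ T) =>
      exists_pow_mul_le (Q'.v_aeval_lt ((hT Q').1 hQ') he) (Q'.v w) 0
    refine ⟨T.sup M, fun Q' hQ' => ?_⟩
    rw [map_mul, map_pow, ← exp_zero]
    exact hM Q' hQ' _ (Finset.le_sup hQ')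
  obtain ⟨M, hM⟩ := hM
  have hdvd : b ∣ 1 - e ^ M := by
    have h1 : (1 : k[X]) - e ∣ 1 ^ M - e ^ M := sub_dvd_pow_sub_pow 1 e M
    rw [one_pow] at h1
    refine dvd_trans ?_ h1
    exact ⟨Polynomial.C (b.eval c)⁻¹, by simp only [e]; ring⟩
  obtain ⟨d, hd⟩ := hdvd
  have hkey : Polynomial.aeval f (1 - e ^ M) * w = w - Polynomial.aeval f e ^ M * w := by
    simp only [map_sub, map_one, map_pow]; ring
  have hQT : Q ∈ T := (hT Q).2 hc
  refine ⟨Polynomial.aeval f (1 - e ^ M) * w, ?_, fun Q' h1 h2 => ?_⟩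
  · rw [hkey, sub_right_comm]
    have := hw Q hQT
    rw [if_pos rfl, exp_zero] at this
    exact Q.v.map_sub_le this (hM Q hQT)
  · by_cases hQ' : Q' ∈ T
    · have := hw Q' hQ'
      rw [if_neg h2, exp_zero, sub_zero] at this
      rw [hkey]
      exact Q'.v.map_sub_le this (hM Q' hQ')
    · rw [hd, mul_comm b, map_mul (Polynomial.aeval f), mul_assoc, map_mul]
      exact mul_le_one' (Q'.v_aeval_le (hf Q' h1) d) (hb3 Q' hQ' h1)

end Place
end CurveField

end

section
open Polynomial WithZero

namespace CurveField

variable (k K : Type*) [Field k] [Field K] [Algebra k K]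

/-- Families of functionals satisfying the residue theorem. -/
def residueFree : Submodule k (Place k K → Module.Dual k K) where
  carrier := {η | ∀ z, ∃ T₀ : Finset (Place k K), ∀ T, T₀ ⊆ T → ∑ Q ∈ T, η Q z = 0}
  zero_mem' := fun z => ⟨∅, by simp⟩
  add_mem' := fun {a b} ha hb z => by
    classical
    obtain ⟨T₁, h₁⟩ := ha z
    obtain ⟨T₂, h₂⟩ := hb z
    refine ⟨T₁ ∪ T₂, fun T hT => ?_⟩
    have e1 := h₁ T (Finset.union_subset_left hT)
    have e2 := h₂ T (Finset.union_subset_right hT)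
    simp [Finset.sum_add_distrib, e1, e2]
  smul_mem' := fun c a ha z => by
    obtain ⟨T₁, h₁⟩ := ha z
    refine ⟨T₁, fun T hT => ?_⟩
    simp [← Finset.mul_sum, h₁ T hT]

variable {k K}

theorem sum_eq_zero_of_mem_residueFree {η : Place k K → Module.Dual k K}
    (hη : η ∈ residueFree k K) (z : K) (T : Finset (Place k K)) (hT : ∀ Q ∉ T, η Q z = 0) :
    ∑ Q ∈ T, η Q z = 0 := by
  classical
  obtain ⟨T₀, h⟩ := hη z
  rw [← h (T ∪ T₀) Finset.subset_union_right]
  exact Finset.sum_subset Finset.subset_union_left fun Q _ hQ => hT Q hQ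

/-- Multiplication of a family of functionals by a function. -/
def mulFun (x : K) : (Place k K → Module.Dual k K) →ₗ[k] (Place k K → Module.Dual k K) where
  toFun η Q := (η Q).comp (LinearMap.mulLeft k x)
  map_add' _ _ := rfl
  map_smul' _ _ := rfl

@[simp] theorem mulFun_apply (x : K) (η : Place k K → Module.Dual k K) (Q : Place k K) (z : K) :
    mulFun x η Q z = η Q (x * z) := rfl

theorem mulFun_mem {η : Place k K → Module.Dual k K} (hη : η ∈ residueFree k K) (x : K) :
    mulFun x η ∈ residueFree k K := fun z => hη (x * z)

variable [IsCurveField k K]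

variable (k K) in
/-- The space of differentials of the first kind, as families of local residue functionals. -/
noncomputable def Diff : Submodule k (Place k K → Module.Dual k K) :=
  { carrier := {ω | ∀ (Q : Place k K) x, Q.v x ≤ 1 → ω Q x = 0}
    zero_mem' := fun _ _ _ => rfl
    add_mem' := fun ha hb Q x hx => by simp [ha Q x hx, hb Q x hx]
    smul_mem' := fun c a ha Q x hx => by simp [ha Q x hx] } ⊓ residueFree k K

theorem mem_Diff {ω : Place k K → Module.Dual k K} : ω ∈ Diff k K ↔
    (∀ (Q : Place k K) x, Q.v x ≤ 1 → ω Q x = 0) ∧ ω ∈ residueFree k K := Iff.rfl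

variable [IsAlgClosed k]

theorem eq_zero_of_apply_eq_zero {η : Place k K → Module.Dual k K} (hη : η ∈ residueFree k K)
    (P : Place k K) (h : ∀ Q, Q ≠ P → ∀ x, Q.v x ≤ 1 → η Q x = 0) (hP : η P = 0) : η = 0 := by
  classical
  funext Q
  by_cases hQP : Q = P
  · rw [hQP, hP]; rfl
  ext y
  obtain ⟨x, hx, hx'⟩ := Place.strong_approx hQP y
  have hs := sum_eq_zero_of_mem_residueFree hη x {Q} (fun Q' hQ' => by
    by_cases hP' : Q' = P
    · rw [hP', hP]; rfl
    · exact h Q' hP' x (hx' Q' hP' (by simpa using hQ')))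
  rw [Finset.sum_singleton] at hs
  have := h Q hQP _ hx
  rw [map_sub, hs, zero_sub, neg_eq_zero] at this
  simpa using this

omit [IsAlgClosed k] in
theorem Diff.apply_mem {ω : Place k K → Module.Dual k K} (hω : ω ∈ Diff k K) (P : Place k K) :
    ω P ∈ (P.fil 0 ⊔ Subalgebra.toSubmodule P.R).dualAnnihilator := by
  rw [Submodule.mem_dualAnnihilator]
  intro w hw
  obtain ⟨o, ho, r, hr, rfl⟩ := Submodule.mem_sup.1 hw
  rw [map_add, hω.1 P o (Place.mem_fil_zero.1 ho), zero_add]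
  have := sum_eq_zero_of_mem_residueFree hω.2 r {P} (fun Q hQ => hω.1 Q r
    (hr Q (by simpa using hQ)))
  simpa using this

/-- Evaluation of differentials at a place. -/
noncomputable def Diff.eval (P : Place k K) :
    Diff k K →ₗ[k] (P.fil 0 ⊔ Subalgebra.toSubmodule P.R).dualAnnihilator where
  toFun ω := ⟨ω.1 P, Diff.apply_mem ω.2 P⟩
  map_add' _ _ := rfl
  map_smul' _ _ := rfl

theorem Diff.eval_injective (P : Place k K) : Function.Injective (Diff.eval P) := by
  rw [injective_iff_map_eq_zero]
  intro ω h
  exact Subtype.ext (eq_zero_of_apply_eq_zero ω.2.2 P (fun Q _ => ω.2.1 Q) (congrArg Subtype.val h))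

theorem Diff.exists_apply_eq (P : Place k K) {l : Module.Dual k K}
    (hl : l ∈ (P.fil 0 ⊔ Subalgebra.toSubmodule P.R).dualAnnihilator) :
    ∃ ω ∈ Diff k K, ω P = l := by
  classical
  rw [Submodule.mem_dualAnnihilator] at hl
  have hl0 : ∀ x, P.v x ≤ 1 → l x = 0 := fun x hx =>
    hl x (Submodule.mem_sup_left (Place.mem_fil_zero.2 hx))
  have hlR : ∀ x ∈ P.R, l x = 0 := fun x hx => hl x (Submodule.mem_sup_right hx)
  choose! z hz hz' using fun (Q : Place k K) (hQ : Q ≠ P) (y : K) => Place.strong_approx hQ y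
  have key : ∀ Q, Q ≠ P → ∀ w, (∀ Q', Q' ≠ P → Q'.v w ≤ 1) → l w = 0 := fun Q _ w hw => hlR w hw
  let ω : Place k K → Module.Dual k K := fun Q => if hQ : Q = P then l else
    { toFun := fun y => - l (z Q y)
      map_add' := fun y y' => by
        rw [← neg_add, neg_inj, ← map_add, ← sub_eq_zero, ← map_sub]
        refine hlR _ fun Q' hQ' => ?_
        by_cases h : Q' = Q
        · subst h
          rw [show z Q' (y + y') - (z Q' y + z Q' y') = (z Q' (y + y') - (y + y')) -
            ((z Q' y - y) + (z Q' y' - y')) by ring]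
          exact Q'.v.map_sub_le (hz Q' hQ _) (Q'.v.map_add_le (hz Q' hQ _) (hz Q' hQ _))
        · exact Q'.v.map_sub_le (hz' Q hQ _ Q' hQ' h)
            (Q'.v.map_add_le (hz' Q hQ _ Q' hQ' h) (hz' Q hQ _ Q' hQ' h))
      map_smul' := fun c y => by
        rw [RingHom.id_apply, smul_neg, neg_inj, ← map_smul, ← sub_eq_zero, ← map_sub]
        refine hlR _ fun Q' hQ' => ?_
        by_cases h : Q' = Q
        · subst h
          rw [show z Q' (c • y) - c • z Q' y = (z Q' (c • y) - c • y) - c • (z Q' y - y) by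
            rw [smul_sub]; ring]
          exact Q'.v.map_sub_le (hz Q' hQ _) ((Q'.v_smul_le _ _).trans (hz Q' hQ _))
        · exact Q'.v.map_sub_le (hz' Q hQ _ Q' hQ' h)
            ((Q'.v_smul_le _ _).trans (hz' Q hQ _ Q' hQ' h)) }
  have hωP : ω P = l := by simp [ω]
  have hωQ : ∀ Q, Q ≠ P → ∀ y, ω Q y = - l (z Q y) := fun Q hQ y => by simp [ω, hQ]
  refine ⟨ω, mem_Diff.2 ⟨fun Q x hx => ?_, fun x => ?_⟩, hωP⟩
  · by_cases hQ : Q = P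
    · subst hQ; rw [hωP]; exact hl0 x hx
    · rw [hωQ Q hQ, neg_eq_zero]
      refine hlR _ fun Q' hQ' => ?_
      by_cases h : Q' = Q
      · subst h
        rw [show z Q' x = (z Q' x - x) + x by ring]
        exact Q'.v.map_add_le (hz Q' hQ _) hx
      · exact hz' Q hQ _ Q' hQ' h
  · refine ⟨insert P (Place.finite_poles (k := k) x).toFinset, fun T hT => ?_⟩
    have hPT : P ∈ T := hT (Finset.mem_insert_self _ _)
    rw [← Finset.add_sum_erase _ _ hPT, hωP, Finset.sum_congr rfl (fun Q hQ =>
      hωQ Q (Finset.ne_of_mem_erase hQ) x), Finset.sum_neg_distrib, ← map_sum, ← sub_eq_add_neg,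
      ← map_sub]
    refine hlR _ fun Q hQ => ?_
    by_cases hQT : Q ∈ T
    · have hQe : Q ∈ T.erase P := Finset.mem_erase.2 ⟨hQ, hQT⟩
      rw [← Finset.add_sum_erase _ _ hQe, ← sub_sub]
      refine Q.v.map_sub_le ?_ (Q.v.map_sum_le fun Q' hQ' => ?_)
      · rw [Valuation.map_sub_swap]; exact hz Q hQ x
      · rw [Finset.mem_erase, Finset.mem_erase] at hQ'
        exact hz' Q' hQ'.2.1 x Q hQ hQ'.1.symm
    · refine Q.v.map_sub_le ?_ (Q.v.map_sum_le fun Q' hQ' => ?_)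
      · by_contra h
        exact hQT (hT (Finset.mem_insert_of_mem (by simpa using h)))
      · refine hz' Q' (Finset.ne_of_mem_erase hQ') x Q hQ ?_
        rintro rfl
        exact hQT (Finset.mem_of_mem_erase hQ')

variable (k K) in
theorem Diff.finite : Module.Finite k (Diff k K) := by
  have := Place.infinite k K
  obtain ⟨P⟩ : Nonempty (Place k K) := inferInstance
  have := P.finite_quotient_zero
  have : Module.Finite k (P.fil 0 ⊔ Subalgebra.toSubmodule P.R).dualAnnihilator :=
    Module.Finite.equiv (Submodule.dualQuotEquivDualAnnihilator _)
  have := isNoetherian_of_isNoetherianRing_of_finite k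
    (P.fil 0 ⊔ Subalgebra.toSubmodule P.R).dualAnnihilator
  exact Module.Finite.of_injective _ (Diff.eval_injective P)

theorem Diff.finrank_eq (P : Place k K) :
    Module.finrank k (Diff k K) =
      Module.finrank k (K ⧸ (P.fil 0 ⊔ Subalgebra.toSubmodule P.R)) := by
  have := P.finite_quotient_zero
  rw [← Subspace.dual_finrank_eq, (Submodule.dualQuotEquivDualAnnihilator _).finrank_eq]
  refine (LinearEquiv.ofBijective _ ⟨Diff.eval_injective P, fun l => ?_⟩).finrank_eq
  obtain ⟨ω, hω, h⟩ := Diff.exists_apply_eq P l.2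
  exact ⟨⟨ω, hω⟩, Subtype.ext h⟩

end CurveField

end

section
open Polynomial WithZero

namespace CurveField

theorem finrank_quotient_le_add_one {k V : Type*} [Field k] [AddCommGroup V] [Module k V]
    {S' S : Submodule k V} (h : S' ≤ S) {t : V} (hS : S ≤ S' ⊔ Submodule.span k {t})
    [Module.Finite k (V ⧸ S)] :
    Module.Finite k (V ⧸ S') ∧ Module.finrank k (V ⧸ S') ≤ Module.finrank k (V ⧸ S) + 1 := by
  let f : (V ⧸ S') →ₗ[k] (V ⧸ S) := Submodule.factor h
  have hf : LinearMap.ker f ≤ Submodule.span k {S'.mkQ t} := by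
    intro x hx
    obtain ⟨v, rfl⟩ := S'.mkQ_surjective x
    have hv : v ∈ S := (Submodule.Quotient.mk_eq_zero S).1 hx
    obtain ⟨s, hs, w, hw, rfl⟩ := Submodule.mem_sup.1 (hS hv)
    obtain ⟨c, rfl⟩ := Submodule.mem_span_singleton.1 hw
    have hs' : S'.mkQ s = 0 := (Submodule.Quotient.mk_eq_zero S').2 hs
    rw [map_add, map_smul, hs', zero_add]
    exact Submodule.smul_mem _ _ (Submodule.mem_span_singleton_self _)
  have h1 : Module.Finite k (LinearMap.ker f) := Submodule.finiteDimensional_of_le hf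
  have h2 : Module.Finite k ((V ⧸ S') ⧸ LinearMap.ker f) :=
    Module.Finite.of_injective f.quotKerEquivRange.toLinearMap f.quotKerEquivRange.injective
  have h3 : Module.Finite k (V ⧸ S') := Module.Finite.of_submodule_quotient (LinearMap.ker f)
  refine ⟨h3, ?_⟩
  rw [← LinearMap.finrank_range_add_finrank_ker f]
  have h4 := Submodule.finrank_le (LinearMap.range f)
  have h5 := (Submodule.finrank_mono hf).trans (finrank_span_le_card _)
  simp only [Set.toFinset_singleton, Finset.card_singleton] at h5
  omega

variable {k K : Type*} [Field k] [Field K] [Algebra k K] [IsCurveField k K] [IsAlgClosed k]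

namespace Place

theorem finrank_quotient_neg_le (P : Place k K) (m : ℕ) :
    Module.Finite k (K ⧸ (P.fil (-m) ⊔ Subalgebra.toSubmodule P.R)) ∧
      Module.finrank k (K ⧸ (P.fil (-m) ⊔ Subalgebra.toSubmodule P.R)) ≤
        Module.finrank k (K ⧸ (P.fil 0 ⊔ Subalgebra.toSubmodule P.R)) + m := by
  induction m with
  | zero =>
    have := P.finite_quotient_zero
    simpa using this
  | succ m ih =>
    obtain ⟨t, ht⟩ := P.exists_v_eq (-m)
    have := ih.1
    have := finrank_quotient_le_add_one (k := k)
      (S' := P.fil (-(m + 1 : ℕ)) ⊔ Subalgebra.toSubmodule P.R)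
      (S := P.fil (-m) ⊔ Subalgebra.toSubmodule P.R) (t := t)
      (sup_le_sup_right (fun x hx => (mem_fil.1 hx).trans (exp_le_exp.2 (by push_cast; omega))) _)
      (by
        refine sup_le ?_ (le_sup_right.trans le_sup_left)
        intro x hx
        have ht0 : t ≠ 0 := by rintro rfl; simp [exp_ne_zero.symm] at ht
        obtain ⟨c, hc⟩ := P.exists_sub_smul_lt (x := x) ht0 (by rw [ht]; exact hx)
        rw [ht, lt_exp_iff] at hc
        rw [← sub_add_cancel x (c • t)]
        refine Submodule.add_mem_sup (Submodule.mem_sup_left ?_)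
          (Submodule.smul_mem _ _ (Submodule.mem_span_singleton_self _))
        rw [mem_fil]
        convert hc using 2
        push_cast; ring)
    exact ⟨this.1, by omega⟩

end Place

/-- The zeros of a differential. -/
def zeros (ω : Place k K → Module.Dual k K) : Set (Place k K) :=
  {Q | ∀ x, Q.v x ≤ exp 1 → ω Q x = 0}

omit [IsAlgClosed k] [IsCurveField k K] in
theorem eq_zero_of_mulFun_eq_zero {ω : Place k K → Module.Dual k K} {x : K}
    (hx : x ≠ 0) (h : mulFun x ω = 0) : ω = 0 := by
  funext Q
  ext z
  have := LinearMap.congr_fun (congrFun h Q) (x⁻¹ * z)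
  simpa [mul_inv_cancel_left₀ hx] using this

/-- Two independent differentials of the first kind have zeros. -/
theorem zeros_nonempty {ω₁ ω₂ : Place k K → Module.Dual k K} (h₁ : ω₁ ∈ Diff k K)
    (h₂ : ω₂ ∈ Diff k K) (h0 : ω₂ ≠ 0) (hind : ∀ c : k, ω₁ ≠ c • ω₂) : (zeros ω₂).Nonempty := by
  classical
  have := Place.infinite k K
  obtain ⟨P⟩ : Nonempty (Place k K) := inferInstance
  obtain ⟨B, hC⟩ := P.exists_bound_H
  set g := Module.finrank k (K ⧸ (P.fil 0 ⊔ Subalgebra.toSubmodule P.R)) with hg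
  set m := g + 2 * B with hm
  obtain ⟨hfin, hle⟩ := P.finrank_quotient_neg_le m
  rw [← hg] at hle
  choose r hrR hrv using fun i : Fin (m + 1 - B) => hC (B + i) (by omega)
  have hinj : Function.Injective fun i : Fin (m + 1 - B) => ((B : ℤ) + i) := fun i j h => by
    simp only at h; ext; omega
  let Φ : (Fin (m + 1 - B) → k) →ₗ[k] K := Fintype.linearCombination k r
  have hX : ∀ c, Φ c = ∑ i, c i • r i := fun c => rfl
  have hXR : ∀ c, Φ c ∈ P.R := fun c => by
    rw [hX]; exact sum_mem fun i _ => P.R.smul_mem (hrR i) _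
  have hXm : ∀ c, P.v (Φ c) ≤ exp (m : ℤ) := fun c => by
    rw [hX]
    refine P.v.map_sum_le fun i _ => (P.v_smul_le _ _).trans ?_
    rw [hrv, exp_le_exp]; omega
  have hX0 : ∀ c, Φ c = 0 → c = 0 := fun c hc => by
    by_contra hne
    obtain ⟨i, hi⟩ := Function.ne_iff.1 hne
    obtain ⟨j, -, -, hv⟩ := P.exists_v_sum_eq Finset.univ _ hinj r (fun i _ => hrv i) c
      ⟨i, Finset.mem_univ _, hi⟩
    rw [← hX, hc, map_zero] at hv
    exact exp_ne_zero.symm hv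
  have hmem : ∀ ω ∈ Diff k K, ∀ c, (ω P).comp (LinearMap.mulLeft k (Φ c)) ∈
      (P.fil (-m) ⊔ Subalgebra.toSubmodule P.R).dualAnnihilator := by
    intro ω hω c
    rw [Submodule.mem_dualAnnihilator]
    intro w hw
    have h := (Submodule.mem_dualAnnihilator _).1 (Diff.apply_mem hω P)
    obtain ⟨o, ho, s, hs, rfl⟩ := Submodule.mem_sup.1 hw
    rw [LinearMap.comp_apply, LinearMap.mulLeft_apply, mul_add]
    refine h _ (Submodule.add_mem_sup ?_ (P.R.mul_mem (hXR c) hs))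
    rw [Place.mem_fil, map_mul]
    refine (mul_le_mul' (hXm c) (Place.mem_fil.1 ho)).trans ?_
    rw [← exp_add, add_neg_cancel]
  let F : (ω : Place k K → Module.Dual k K) → ω ∈ Diff k K → (Fin (m + 1 - B) → k) →ₗ[k]
      (P.fil (-m) ⊔ Subalgebra.toSubmodule P.R).dualAnnihilator := fun ω hω =>
    { toFun := fun c => ⟨_, hmem ω hω c⟩
      map_add' := fun c d => by ext z; simp [add_mul]
      map_smul' := fun a c => by ext z; simp }
  have hfr : Module.finrank k (Module.Dual k (K ⧸ (P.fil (-m) ⊔ Subalgebra.toSubmodule P.R))) ≤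
      g + m := by
    rwa [Subspace.dual_finrank_eq]
  let e := (Submodule.dualQuotEquivDualAnnihilator
    (P.fil (-m) ⊔ Subalgebra.toSubmodule P.R)).symm
  obtain ⟨⟨c, d'⟩, hcd, hne⟩ := Submodule.exists_mem_ne_zero_of_ne_bot
    (LinearMap.ker_ne_bot_of_finrank_lt
      (f := e.toLinearMap ∘ₗ (F ω₁ h₁).coprod (F ω₂ h₂)) (by
      rw [Module.finrank_prod, Module.finrank_fin_fun]
      omega))
  replace hcd : (F ω₁ h₁).coprod (F ω₂ h₂) (c, d') = 0 :=
    e.injective ((LinearMap.mem_ker.1 hcd).trans (map_zero e).symm)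
  obtain ⟨d, rfl⟩ : ∃ d, d' = -d := ⟨-d', (neg_neg _).symm⟩
  have hrel : ∀ z, ω₁ P (Φ c * z) = ω₂ P (Φ d * z) := fun z => by
    have := LinearMap.congr_fun (congrArg Subtype.val hcd) z
    change ω₁ P (Φ c * z) + ω₂ P (Φ (-d) * z) = 0 at this
    rw [map_neg, neg_mul, map_neg, ← sub_eq_add_neg] at this
    exact sub_eq_zero.1 this
  have hglob : mulFun (Φ c) ω₁ = mulFun (Φ d) ω₂ := by
    rw [← sub_eq_zero]
    refine eq_zero_of_apply_eq_zero (sub_mem (mulFun_mem h₁.2 _) (mulFun_mem h₂.2 _)) P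
      (fun Q hQ x hx => ?_) ?_
    · have e1 := h₁.1 Q (Φ c * x) (by rw [map_mul]; exact mul_le_one' (hXR c Q hQ) hx)
      have e2 := h₂.1 Q (Φ d * x) (by rw [map_mul]; exact mul_le_one' (hXR d Q hQ) hx)
      simp [e1, e2]
    · ext z
      simp [hrel z]
  have h10 : ω₁ ≠ 0 := fun h => hind 0 (by rw [h, zero_smul])
  have hc : Φ c ≠ 0 := fun hc => by
    have hd : Φ d ≠ 0 := fun hd => hne (by rw [hX0 c hc, hX0 d hd, neg_zero]; rfl)
    refine h0 (eq_zero_of_mulFun_eq_zero hd ?_)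
    rw [← hglob, hc]
    ext; simp
  have hd : Φ d ≠ 0 := fun hd => by
    refine h10 (eq_zero_of_mulFun_eq_zero hc ?_)
    rw [hglob, hd]
    ext; simp
  have hrel' : ∀ Q z, ω₁ Q z = ω₂ Q (Φ d / Φ c * z) := fun Q z => by
    have := LinearMap.congr_fun (congrFun hglob Q) ((Φ c)⁻¹ * z)
    simp only [mulFun_apply, mul_inv_cancel_left₀ hc] at this
    rw [this]; congr 1; ring
  obtain ⟨Q, hQ⟩ := Place.exists_pole (k := k) (x := Φ d / Φ c) (by
    rintro ⟨a, ha⟩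
    refine hind a ?_
    funext Q
    ext z
    rw [hrel', ← ha, ← Algebra.smul_def, map_smul]
    rfl)
  refine ⟨Q, fun x hx => ?_⟩
  have hne' : Φ d / Φ c ≠ 0 := div_ne_zero hd hc
  have := hrel' Q ((Φ d / Φ c)⁻¹ * x)
  rw [mul_inv_cancel_left₀ hne'] at this
  rw [← this]
  refine h₁.1 Q _ ?_
  rw [map_mul, map_inv₀]
  have hQ' : exp 1 ≤ Q.v (Φ d / Φ c) := by
    by_contra! h
    rw [Place.lt_exp_iff, sub_self, exp_zero] at h
    exact not_lt.2 h hQ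
  refine (inv_mul_le_one₀ (lt_trans zero_lt_one hQ)).2 (hx.trans hQ')

variable (k K) in
theorem exists_card_zeros_le : ∃ B : ℕ, ∀ ω ∈ Diff k K, ω ≠ 0 →
    (zeros ω).Finite ∧ (zeros ω).ncard ≤ B := by
  classical
  have := Place.infinite k K
  obtain ⟨P⟩ : Nonempty (Place k K) := inferInstance
  have := P.finite_quotient_zero
  have hDfin := Diff.finite k K
  have := isNoetherian_of_isNoetherianRing_of_finite k (Diff k K)
  set g := Module.finrank k (K ⧸ (P.fil 0 ⊔ Subalgebra.toSubmodule P.R)) with hg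
  suffices hmain : ∀ ω ∈ Diff k K, ω ≠ 0 → ∀ S : Finset (Place k K), ↑S ⊆ zeros ω → P ∉ S →
      S.card ≤ g + Module.finrank k (Diff k K) by
    refine ⟨g + Module.finrank k (Diff k K) + 1, fun ω hω h0 => ?_⟩
    have hle : ∀ S : Finset (Place k K), ↑S ⊆ zeros ω →
        S.card ≤ g + Module.finrank k (Diff k K) + 1 := fun S hS => by
      have h1 := hmain ω hω h0 (S.erase P) ((Finset.coe_subset.2 (Finset.erase_subset _ _)).trans hS)
        (Finset.notMem_erase _ _)
      have h2 := Finset.pred_card_le_card_erase (s := S) (a := P)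
      omega
    have hfin : (zeros ω).Finite := by
      by_contra hinf
      obtain ⟨S, hS, hc⟩ := Set.Infinite.exists_subset_card_eq hinf
        (g + Module.finrank k (Diff k K) + 2)
      have := hle S hS
      omega
    refine ⟨hfin, ?_⟩
    rw [Set.ncard_eq_toFinset_card _ hfin]
    exact hle _ (by simp)
  intro ω hω h0 S hS hPS
  choose! y hy using fun Q : Place k K => Q.exists_v_eq 1
  have hex : ∀ Q : Place k K, Q ∈ S → ∃ x, Q.v x = exp 1 ∧ ∀ Q', Q' ≠ P → Q' ≠ Q → Q'.v x ≤ 1 := by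
    intro Q hQ
    obtain ⟨x, hx, hx'⟩ := Place.strong_approx (P := P) (Q := Q) (by rintro rfl; exact hPS hQ) (y Q)
    refine ⟨x, ?_, hx'⟩
    rw [← sub_add_cancel x (y Q), Valuation.map_add_eq_of_lt_right, hy]
    rw [hy]
    exact hx.trans_lt (by rw [← exp_zero, exp_lt_exp]; exact zero_lt_one)
  choose! x hxQ hxQ' using hex
  let Ψ : (S → k) →ₗ[k] K := Fintype.linearCombination k (fun Q : S => x Q.1)
  have hΨ : ∀ c, Ψ c = ∑ Q : S, c Q • x Q.1 := fun c => rfl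
  have hΨ1 : ∀ c Q, Q ≠ P → Q ∉ S → Q.v (Ψ c) ≤ 1 := fun c Q hQ hQS => by
    rw [hΨ]
    exact Q.v.map_sum_le fun Q' _ => (Q.v_smul_le _ _).trans
      (hxQ' Q' Q'.2 Q hQ (by rintro rfl; exact hQS Q'.2))
  have hΨ2 : ∀ c, ∀ Q ∈ S, Q.v (Ψ c) ≤ exp 1 := fun c Q hQ => by
    rw [hΨ]
    refine Q.v.map_sum_le fun Q' _ => (Q.v_smul_le _ _).trans ?_
    by_cases h : Q = Q'
    · rw [h, hxQ _ Q'.2]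
    · exact (hxQ' Q' Q'.2 Q (by rintro rfl; exact hPS hQ) h).trans
        (by rw [← exp_zero, exp_le_exp]; exact zero_le_one)
  have hΨ3 : ∀ c, Ψ c ∈ P.R → c = 0 := fun c hc => by
    by_contra hne
    obtain ⟨Q, hQ⟩ := Function.ne_iff.1 hne
    have hQP : Q.1 ≠ P := by rintro h; exact hPS (h ▸ Q.2)
    have h1 := hc Q.1 hQP
    rw [hΨ, ← Finset.add_sum_erase _ _ (Finset.mem_univ Q)] at h1
    have h2 : Q.1.v (∑ Q' ∈ Finset.univ.erase Q, c Q' • x Q'.1) ≤ 1 :=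
      Q.1.v.map_sum_le fun Q' hQ' => (Q.1.v_smul_le _ _).trans
        (hxQ' Q' Q'.2 Q hQP fun h => Finset.ne_of_mem_erase hQ' (Subtype.ext h.symm))
    have h3 := Q.1.v.map_sub_le h1 h2
    rw [add_sub_cancel_right, Q.1.v_smul hQ, hxQ _ Q.2, ← exp_zero, exp_le_exp] at h3
    omega
  let Φ : K →ₗ[k] (Place k K → Module.Dual k K) :=
    { toFun := fun z => mulFun z ω
      map_add' := fun a b => by ext; simp [add_mul]
      map_smul' := fun a b => by ext; simp }
  have hΦ : Function.Injective Φ := by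
    rw [injective_iff_map_eq_zero]
    intro z hz
    by_contra hz0
    exact h0 (eq_zero_of_mulFun_eq_zero hz0 hz)
  let M : Submodule k K := (Diff k K).comap Φ
  let Φ' : M →ₗ[k] Diff k K := Φ.restrict (fun _ h => h)
  have hΦ' : Function.Injective Φ' := fun a b h => Subtype.ext (hΦ (congrArg Subtype.val h))
  have hMfin : Module.Finite k M := Module.Finite.of_injective Φ' hΦ'
  have hM : Module.finrank k M ≤ Module.finrank k (Diff k K) :=
    LinearMap.finrank_le_finrank_of_injective hΦ'
  let f := (P.fil 0 ⊔ Subalgebra.toSubmodule P.R).mkQ ∘ₗ Ψ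
  let q := (Subalgebra.toSubmodule P.R).mkQ
  have hker : ∀ c ∈ LinearMap.ker f, q (Ψ c) ∈ M.map q := by
    intro c hc
    rw [LinearMap.mem_ker, LinearMap.comp_apply, Submodule.mkQ_apply,
      Submodule.Quotient.mk_eq_zero] at hc
    obtain ⟨o, ho, r, hr, hor⟩ := Submodule.mem_sup.1 hc
    refine ⟨o, ?_, ?_⟩
    · change mulFun o ω ∈ Diff k K
      refine ⟨fun Q z hz => ?_, mulFun_mem hω.2 _⟩
      rw [mulFun_apply]
      by_cases hQP : Q = P
      · subst hQP
        refine hω.1 _ _ ?_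
        rw [map_mul]
        exact mul_le_one' (Place.mem_fil_zero.1 ho) hz
      · have ho' : o = Ψ c - r := by rw [← hor]; ring
        by_cases hQS : Q ∈ S
        · refine hS hQS _ ?_
          rw [map_mul, ← mul_one (exp (1 : ℤ))]
          refine mul_le_mul' ?_ hz
          rw [ho']
          exact Q.v.map_sub_le (hΨ2 c Q hQS) ((hr Q hQP).trans
            (by rw [← exp_zero, exp_le_exp]; exact zero_le_one))
        · refine hω.1 _ _ ?_
          rw [map_mul]
          refine mul_le_one' ?_ hz
          rw [ho']
          exact Q.v.map_sub_le (hΨ1 c Q hQP hQS) (hr Q hQP)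
    · rw [← hor, map_add]
      simp only [q, Submodule.mkQ_apply]
      rw [(Submodule.Quotient.mk_eq_zero (Subalgebra.toSubmodule P.R)).2 hr, add_zero]
  let G : LinearMap.ker f →ₗ[k] M.map q := (q ∘ₗ Ψ).restrict hker
  have hG : Function.Injective G := by
    rw [injective_iff_map_eq_zero]
    rintro ⟨c, hc⟩ h
    have h' : q (Ψ c) = 0 := congrArg Subtype.val h
    exact Subtype.ext (hΨ3 c ((Submodule.Quotient.mk_eq_zero _).1 h'))
  have e1 := LinearMap.finrank_le_finrank_of_injective hG
  have e2 : Module.finrank k (M.map q) ≤ Module.finrank k M := Submodule.finrank_map_le q M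
  have e3 := LinearMap.finrank_range_add_finrank_ker f
  have e4 := Submodule.finrank_le (LinearMap.range f)
  rw [Module.finrank_fintype_fun_eq_card, Fintype.card_coe] at e3
  omega

end CurveField

end

section
open Polynomial WithZero

namespace CurveField

variable {k K : Type*} [Field k] [Field K] [Algebra k K]

open scoped Pointwise in
noncomputable instance : MulAction (K ≃ₐ[k] K) (Place k K) where
  smul σ P := ⟨σ • P.1, by
    refine ⟨fun h => P.2.ne_top ?_, fun c => ?_⟩
    · have := congrArg (σ⁻¹ • ·) h
      simp only [inv_smul_smul] at this
      rw [this]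
      ext x
      rw [ValuationSubring.mem_inv_pointwise_smul_iff]
      simp
    · rw [ValuationSubring.mem_pointwise_smul_iff_inv_smul_mem]
      have : σ⁻¹ • algebraMap k K c = algebraMap k K c := σ⁻¹.commutes c
      rw [this]
      exact P.2.algebraMap_mem c⟩
  one_smul P := Subtype.ext (one_smul _ P.1)
  mul_smul σ τ P := Subtype.ext (mul_smul σ τ P.1)

namespace Place

open scoped Pointwise in
theorem mem_smul {σ : K ≃ₐ[k] K} {P : Place k K} {x : K} : x ∈ (σ • P).1 ↔ σ⁻¹ x ∈ P.1 :=
  ValuationSubring.mem_pointwise_smul_iff_inv_smul_mem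

variable [IsCurveField k K]

theorem v_unique (P : Place k K) {w : Valuation K ℤᵐ⁰} (h : ∀ x, w x ≤ 1 ↔ x ∈ P.1) {t : K}
    (ht : w t = exp (-1)) : P.v = w := by
  have he : P.v.IsEquiv w := by
    rw [Valuation.isEquiv_iff_val_le_one]
    intro x
    rw [h, v_le_one]
  obtain ⟨s, hs⟩ := P.exists_uniformizer
  have h1 : P.v t < 1 := by
    rw [he.lt_one_iff_lt_one, ht, ← exp_zero, exp_lt_exp]; omega
  have h2 : w s < 1 := by
    rw [← he.lt_one_iff_lt_one, hs, ← exp_zero, exp_lt_exp]; omega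
  have h3 : w s ≤ w t := by
    rw [ht]
    rwa [← exp_zero, lt_exp_iff, zero_sub] at h2
  have h4 : P.v t = exp (-1) :=
    le_antisymm (P.v_lt_one_iff.1 h1) (by rw [← hs]; exact (he s t).2 h3)
  ext x
  rcases eq_or_ne x 0 with rfl | hx
  · simp
  obtain ⟨n, hn⟩ := P.exists_v_eq_exp hx
  have h5 : P.v x = P.v (t ^ (-n)) := by
    rw [map_zpow₀, h4, ← WithZero.exp_zsmul, hn]; simp
  have h6 : w x = w (t ^ (-n)) := he.eq_iff.1 h5
  rw [h6, map_zpow₀, ht, ← WithZero.exp_zsmul, hn]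
  simp

theorem v_smul_place (σ : K ≃ₐ[k] K) (P : Place k K) (x : K) : (σ • P).v x = P.v (σ⁻¹ x) := by
  obtain ⟨t, ht⟩ := P.exists_uniformizer
  have := v_unique (σ • P) (w := P.v.comap (σ⁻¹ : K ≃ₐ[k] K).toRingEquiv.toRingHom)
    (fun x => by rw [mem_smul]; exact P.v_le_one) (t := σ t) (by
      change P.v (σ⁻¹ (σ t)) = _
      rw [← ht]; congr 1; exact σ.symm_apply_apply t)
  rw [this]; rfl

theorem v_smul_apply (σ : K ≃ₐ[k] K) (P : Place k K) (x : K) : (σ • P).v (σ x) = P.v x := by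
  rw [v_smul_place]; congr 1; exact σ.symm_apply_apply x

theorem v_of_smul_eq {σ : K ≃ₐ[k] K} {P : Place k K} (h : σ • P = P) (x : K) :
    P.v (σ x) = P.v x := by
  conv_lhs => rw [← h]
  rw [v_smul_apply]

theorem map_mem_R {σ : K ≃ₐ[k] K} {P : Place k K} {x : K} (hx : x ∈ P.R) : σ x ∈ (σ • P).R := by
  intro Q hQ
  have := hx (σ⁻¹ • Q) (fun h => hQ (by rw [← h, smul_inv_smul]))
  rwa [v_smul_place, inv_inv] at this

theorem H_smul (σ : K ≃ₐ[k] K) (P : Place k K) : (σ • P).H = P.H := by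
  have key : ∀ (σ : K ≃ₐ[k] K) (P : Place k K), P.H ⊆ (σ • P).H := by
    rintro σ P n ⟨r, hr, h⟩
    exact ⟨σ r, map_mem_R hr, by rw [v_smul_apply, h]⟩
  refine (key σ P).antisymm' ?_
  have := key σ⁻¹ (σ • P)
  rwa [inv_smul_smul] at this

end Place

/-- The action of automorphisms on families of functionals. -/
noncomputable def act (σ : K ≃ₐ[k] K) :
    (Place k K → Module.Dual k K) →ₗ[k] (Place k K → Module.Dual k K) where
  toFun η Q := (η (σ⁻¹ • Q)).comp (σ⁻¹ : K ≃ₐ[k] K).toLinearMap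
  map_add' _ _ := rfl
  map_smul' _ _ := rfl

@[simp] theorem act_apply (σ : K ≃ₐ[k] K) (η : Place k K → Module.Dual k K) (Q : Place k K)
    (x : K) : act σ η Q x = η (σ⁻¹ • Q) (σ⁻¹ x) := rfl

theorem act_one : act (1 : K ≃ₐ[k] K) = LinearMap.id := by
  ext η Q x
  simp

theorem act_mul (σ τ : K ≃ₐ[k] K) : act (σ * τ) = act σ ∘ₗ act τ := by
  ext η Q x
  simp [mul_smul]

theorem act_mem_Diff [IsCurveField k K] (σ : K ≃ₐ[k] K) {ω : Place k K → Module.Dual k K}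
    (hω : ω ∈ Diff k K) : act σ ω ∈ Diff k K := by
  classical
  refine ⟨fun Q x hx => ?_, fun z => ?_⟩
  · refine hω.1 _ _ ?_
    rwa [AlgEquiv.toLinearMap_apply, Place.v_smul_apply]
  · obtain ⟨T₀, hT₀⟩ := hω.2 (σ⁻¹ z)
    refine ⟨T₀.image (σ • ·), fun T hT => ?_⟩
    have := hT₀ (T.image (σ⁻¹ • ·)) (fun Q hQ => Finset.mem_image.2
      ⟨σ • Q, hT (Finset.mem_image_of_mem _ hQ), inv_smul_smul _ _⟩)
    rwa [Finset.sum_image (MulAction.injective _).injOn] at this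

theorem zeros_act [IsCurveField k K] (σ : K ≃ₐ[k] K) {ω : Place k K → Module.Dual k K}
    {Q : Place k K} (hQ : Q ∈ zeros ω) : σ • Q ∈ zeros (act σ ω) := by
  intro x hx
  rw [act_apply, inv_smul_smul]
  refine hQ _ ?_
  rwa [← Place.v_smul_place]

variable (k K) in
/-- The representation of the automorphism group on the differentials of the first kind. -/
noncomputable def rep [IsCurveField k K] : (K ≃ₐ[k] K) →* Module.End k (Diff k K) where
  toFun σ := (act σ).restrict fun _ h => act_mem_Diff σ h
  map_one' := by
    ext ω : 2
    change act 1 ω.1 = ω.1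
    rw [act_one]; rfl
  map_mul' σ τ := by
    ext ω : 2
    change act (σ * τ) ω.1 = act σ (act τ ω.1)
    rw [act_mul]; rfl

end CurveField

end

section
open Polynomial WithZero

namespace CurveField

variable {k K : Type*} [Field k] [Field K] [Algebra k K] [IsCurveField k K]

/-- The automorphism `σ` multiplies leading coefficients of functions with pole order `n` at
`P` by `a ^ n`. -/
def IsLead (P : Place k K) (σ : K ≃ₐ[k] K) (a : k) : Prop :=
  a ≠ 0 ∧ ∀ (n : ℤ) (x : K), P.v x = exp n → P.v (σ x - a ^ n • x) < exp n

theorem IsLead.v_apply {P : Place k K} {σ : K ≃ₐ[k] K} {a : k} (h : IsLead P σ a) (x : K) :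
    P.v (σ x) = P.v x := by
  rcases eq_or_ne x 0 with rfl | hx
  · simp
  obtain ⟨n, hn⟩ := P.exists_v_eq_exp hx
  have h1 : P.v (a ^ n • x) = exp n := by rw [P.v_smul (zpow_ne_zero _ h.1), hn]
  rw [← sub_add_cancel (σ x) (a ^ n • x), Valuation.map_add_eq_of_lt_right, h1, hn]
  rw [h1]
  exact h.2 n x hn

theorem IsLead.one (P : Place k K) : IsLead P 1 1 :=
  ⟨one_ne_zero, fun n x _ => by simp [exp_pos]⟩

theorem IsLead.mul {P : Place k K} {σ τ : K ≃ₐ[k] K} {a b : k} (hσ : IsLead P σ a)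
    (hτ : IsLead P τ b) : IsLead P (σ * τ) (a * b) := by
  refine ⟨mul_ne_zero hσ.1 hτ.1, fun n x hx => ?_⟩
  have h1 : P.v (σ (τ x - b ^ n • x)) < exp n := by rw [hσ.v_apply]; exact hτ.2 n x hx
  have h2 : P.v (b ^ n • (σ x - a ^ n • x)) < exp n :=
    (P.v_smul_le _ _).trans_lt (hσ.2 n x hx)
  have := P.v.map_add_lt h1 h2
  rwa [map_sub, map_smul, smul_sub, sub_add_sub_cancel, smul_smul, mul_comm (b ^ n),
    ← mul_zpow] at this

theorem IsLead.pow {P : Place k K} {σ : K ≃ₐ[k] K} {a : k} (h : IsLead P σ a) (j : ℕ) :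
    IsLead P (σ ^ j) (a ^ j) := by
  induction j with
  | zero => simpa using IsLead.one P
  | succ j ih => rw [pow_succ, pow_succ]; exact ih.mul h

variable [IsAlgClosed k]

theorem exists_isLead {P : Place k K} {σ : K ≃ₐ[k] K} (hσ : σ • P = P) : ∃ a, IsLead P σ a := by
  obtain ⟨t, ht⟩ := P.exists_v_eq 1
  have ht0 : t ≠ 0 := by rintro rfl; simp [exp_ne_zero.symm] at ht
  have hv := Place.v_of_smul_eq hσ
  obtain ⟨a, ha⟩ := P.exists_sub_smul_lt (x := σ t) ht0 (hv t).le
  have ha0 : a ≠ 0 := by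
    rintro rfl
    rw [zero_smul, sub_zero, hv] at ha
    exact lt_irrefl _ ha
  -- the relation on a single element
  let L : K → k → Prop := fun x c => x ≠ 0 ∧ c ≠ 0 ∧ P.v (σ x - c • x) < P.v x
  have hmul : ∀ x y c d, L x c → L y d → L (x * y) (c * d) := by
    rintro x y c d ⟨hx, hc, h1⟩ ⟨hy, hd, h2⟩
    refine ⟨mul_ne_zero hx hy, mul_ne_zero hc hd, ?_⟩
    have e : σ (x * y) - (c * d) • (x * y) =
        (σ x - c • x) * σ y + c • x * (σ y - d • y) := by
      rw [map_mul, mul_smul, mul_sub, sub_mul, sub_add_sub_cancel, smul_mul_assoc c,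
        ← mul_smul_comm]
    rw [e]
    refine P.v.map_add_lt ?_ ?_
    · rw [map_mul, map_mul, hv]
      exact mul_lt_mul_of_pos_right h1 ((Valuation.pos_iff _).2 hy)
    · rw [map_mul, map_mul, P.v_smul hc]
      exact mul_lt_mul_of_pos_left h2 ((Valuation.pos_iff _).2 hx)
  have hunit : ∀ u, P.v u = 1 → L u 1 := by
    intro u hu
    refine ⟨by rintro rfl; simp at hu, one_ne_zero, ?_⟩
    obtain ⟨c, hc⟩ := P.exists_residue hu.le
    have : σ u - (1 : k) • u = σ (u - algebraMap k K c) - (u - algebraMap k K c) := by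
      rw [map_sub, AlgEquiv.commutes, one_smul]; ring
    rw [this, hu]
    exact P.v.map_sub_lt (by rwa [hv]) hc
  have hinv : ∀ x c, L x c → L x⁻¹ c⁻¹ := by
    rintro x c ⟨hx, hc, h1⟩
    refine ⟨inv_ne_zero hx, inv_ne_zero hc, ?_⟩
    have hσx : σ x ≠ 0 := by simpa using hx
    have e : σ x⁻¹ - c⁻¹ • x⁻¹ = -(c⁻¹ • ((σ x - c • x) * (σ x)⁻¹ * x⁻¹)) := by
      have hc' : algebraMap k K c ≠ 0 := by simpa using hc
      rw [map_inv₀, Algebra.smul_def, Algebra.smul_def, Algebra.smul_def, map_inv₀]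
      field_simp
      ring
    rw [e, Valuation.map_neg, P.v_smul (inv_ne_zero hc), map_mul, map_mul, map_inv₀, map_inv₀, hv]
    refine mul_lt_of_lt_one_left ?_ ?_
    · rw [← map_inv₀]; exact (Valuation.pos_iff _).2 (inv_ne_zero hx)
    · rw [← div_eq_mul_inv]
      exact (div_lt_one₀ ((Valuation.pos_iff _).2 hx)).2 h1
  have hpow : ∀ n : ℕ, L (t ^ n) (a ^ n) := by
    intro n
    induction n with
    | zero => simpa using hunit 1 (by simp)
    | succ n ih => rw [pow_succ, pow_succ]; exact hmul _ _ _ _ ih ⟨ht0, ha0, ha⟩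
  have hzpow : ∀ n : ℤ, L (t ^ n) (a ^ n) := by
    intro n
    cases n with
    | ofNat n => simpa using hpow n
    | negSucc n => rw [zpow_negSucc, zpow_negSucc]; exact hinv _ _ (hpow _)
  refine ⟨a, ha0, fun n x hx => ?_⟩
  have hu : P.v (x * (t ^ n)⁻¹) = 1 := by
    rw [map_mul, map_inv₀, map_zpow₀, ht, hx, ← WithZero.exp_zsmul]
    simp [exp_ne_zero]
  have := (hmul _ _ _ _ (hunit _ hu) (hzpow n)).2.2
  rwa [inv_mul_cancel_right₀ (zpow_ne_zero _ ht0), one_mul, hx] at this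

theorem IsLead.exists_eigenvector {P : Place k K} {σ : K ≃ₐ[k] K} {a : k} (h : IsLead P σ a)
    {M : ℕ} (haM : ∀ j : ℕ, 0 < j → j ≤ M → a ^ j ≠ 1) (hσ : ∀ x ∈ P.R, σ x ∈ P.R) {N : ℕ}
    (hN : N ≤ M) (hNH : (N : ℤ) ∈ P.H) : ∃ e ∈ P.R, P.v e = exp (N : ℤ) ∧ σ e = a ^ N • e := by
  have haN : ∀ m < N, a ^ m - a ^ N ≠ 0 := fun m hm he => by
    refine haM (N - m) (by omega) (by omega) ?_
    rw [sub_eq_zero] at he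
    have h2 : a ^ (N - m) * a ^ m = a ^ m := by rw [← pow_add, Nat.sub_add_cancel hm.le, he]
    exact mul_right_cancel₀ (pow_ne_zero m h.1) (h2.trans (one_mul _).symm)
  have hsolve : ∀ m ≤ N, ∀ s ∈ P.R, P.v s < exp (m : ℤ) →
      ∃ u ∈ P.R, P.v u < exp (m : ℤ) ∧ σ u - a ^ N • u = s := by
    intro m
    induction m with
    | zero =>
      intro _ s hs hv
      rw [Nat.cast_zero, exp_zero] at hv
      rw [Place.eq_zero_of_mem_R hs hv]
      exact ⟨0, zero_mem _, by simp, by simp⟩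
    | succ m ih =>
      intro hm s hs hv
      rw [Place.lt_exp_iff] at hv
      push_cast at hv
      rw [add_sub_cancel_right] at hv
      have hle : exp (m : ℤ) < exp ((m + 1 : ℕ) : ℤ) := by rw [exp_lt_exp]; omega
      rcases hv.lt_or_eq with hv | hv
      · obtain ⟨u, hu, hu', e⟩ := ih (by omega) s hs hv
        exact ⟨u, hu, hu'.trans hle, e⟩
      · have hd := haN m (by omega)
        set d := a ^ m - a ^ N with hdd
        have hlead : P.v (σ s - a ^ m • s) < exp (m : ℤ) := by simpa using h.2 m s hv
        obtain ⟨u, hu, hu', e⟩ := ih (by omega) (d⁻¹ • (σ s - a ^ m • s))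
          (P.R.smul_mem (sub_mem (hσ s hs) (P.R.smul_mem hs _)) _)
          ((P.v_smul_le _ _).trans_lt hlead)
        refine ⟨d⁻¹ • s - u, sub_mem (P.R.smul_mem hs _) hu,
          P.v.map_sub_lt (((P.v_smul_le _ _).trans hv.le).trans_lt hle) (hu'.trans hle), ?_⟩
        have e2 : σ (d⁻¹ • s - u) - a ^ N • (d⁻¹ • s - u) =
            d⁻¹ • (σ s - a ^ m • s) + d⁻¹ • d • s - (σ u - a ^ N • u) := by
          rw [map_sub, map_smul, hdd]
          module
        rw [e2, e, add_sub_cancel_left, inv_smul_smul₀ hd]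
  obtain ⟨r, hr, hv⟩ := hNH
  have hl : P.v (σ r - a ^ N • r) < exp (N : ℤ) := by simpa using h.2 N r hv
  obtain ⟨u, hu, hu', e⟩ := hsolve N le_rfl _ (sub_mem (hσ r hr) (P.R.smul_mem hr _)) hl
  refine ⟨r - u, sub_mem hr hu, ?_, ?_⟩
  · rw [Valuation.map_sub_eq_of_lt_left, hv]
    rwa [hv]
  · rw [map_sub, smul_sub, sub_eq_sub_iff_sub_eq_sub, ← e]

theorem IsLead.pow_eq_one {P : Place k K} {σ : K ≃ₐ[k] K} {a : k} (h : IsLead P σ a)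
    (hσ : ∀ x ∈ P.R, σ x ∈ P.R) {n : ℕ} (hn : (n : ℤ) ∈ P.H) (hn' : (n + 1 : ℤ) ∈ P.H)
    (h1 : (1 : ℤ) ∉ P.H) : ∃ j, 0 < j ∧ j ≤ n * (n + 1) ∧ a ^ j = 1 := by
  by_contra! haM
  have hn0 : n ≠ 0 := by rintro rfl; exact h1 (by simpa using hn')
  set M := n * (n + 1) with hM
  obtain ⟨e, heR, hev, he⟩ := h.exists_eigenvector haM hσ (N := n) (by nlinarith) hn
  obtain ⟨f, hfR, hfv, hf⟩ := h.exists_eigenvector haM hσ (N := n + 1)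
    (by have : 1 ≤ n := by omega
        nlinarith) (by exact_mod_cast hn')
  have e0 : e ≠ 0 := by rintro rfl; simp [exp_ne_zero.symm] at hev
  have f0 : f ≠ 0 := by rintro rfl; simp at hfv
  have hpv : P.v (e ^ (n + 1)) = exp (M : ℤ) := by
    rw [map_pow, hev, ← WithZero.exp_nsmul, hM]; congr 1; push_cast; simp [mul_comm]
  have hqv : P.v (f ^ n) = exp (M : ℤ) := by
    rw [map_pow, hfv, ← WithZero.exp_nsmul, hM]; congr 1
  obtain ⟨c, hc⟩ := P.exists_sub_smul_lt (pow_ne_zero n f0) (hpv.trans hqv.symm).le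
  have hd0 : e ^ (n + 1) - c • f ^ n = 0 := by
    by_contra hd0
    set d := e ^ (n + 1) - c • f ^ n with hd
    have hdR : d ∈ P.R := sub_mem (P.R.pow_mem heR _) (P.R.smul_mem (P.R.pow_mem hfR _) _)
    have hσd : σ d = a ^ M • d := by
      rw [hd, map_sub, map_smul, map_pow, map_pow, he, hf, _root_.smul_pow, _root_.smul_pow, ← pow_mul,
        ← pow_mul, mul_comm (n + 1) n, ← hM, smul_sub, smul_comm c]
    obtain ⟨m, hm⟩ := P.exists_v_eq_exp hd0
    have hm0 : 0 ≤ m := Place.nonneg_of_mem_H ⟨d, hdR, hm⟩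
    lift m to ℕ using hm0
    rw [hm, hqv, exp_lt_exp] at hc
    have hl : P.v (σ d - a ^ m • d) < exp (m : ℤ) := by simpa using h.2 m d hm
    rw [hσd, ← sub_smul] at hl
    have hne : a ^ M - a ^ m ≠ 0 := fun he => by
      refine haM (M - m) (by omega) (by omega) ?_
      rw [sub_eq_zero] at he
      have h2 : a ^ (M - m) * a ^ m = a ^ m := by rw [← pow_add, Nat.sub_add_cancel (by omega), he]
      exact mul_right_cancel₀ (pow_ne_zero m h.1) (h2.trans (one_mul _).symm)
    rw [P.v_smul hne, hm] at hl
    exact lt_irrefl _ hl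
  have hc0 : c ≠ 0 := by
    rintro rfl
    rw [zero_smul, sub_zero] at hd0
    exact pow_ne_zero _ e0 hd0
  have hz : (f / e) ^ n = c⁻¹ • e := by
    rw [div_pow, div_eq_iff (pow_ne_zero _ e0), smul_mul_assoc, ← pow_succ',
      sub_eq_zero.1 hd0, inv_smul_smul₀ hc0]
  refine h1 ⟨f / e, fun Q hQ => ?_, ?_⟩
  · have := P.R.smul_mem heR c⁻¹ Q hQ
    rw [← hz, map_pow] at this
    exact (pow_le_one_iff hn0).1 this
  · rw [map_div₀, hfv, hev, ← exp_sub]; congr 1; push_cast; ring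

/-- Uniform exponent after which stabilizers of places act unipotently. -/
theorem exists_isLead_one (h1 : ∀ P : Place k K, (1 : ℤ) ∉ P.H)
    (htr : ∀ P Q : Place k K, ∃ σ : K ≃ₐ[k] K, σ • P = Q) : ∃ E : ℕ, 0 < E ∧
      ∀ (P : Place k K) (σ : K ≃ₐ[k] K), σ • P = P → IsLead P (σ ^ E) 1 := by
  have := Place.infinite k K
  obtain ⟨P₀⟩ : Nonempty (Place k K) := inferInstance
  obtain ⟨B, hC⟩ := P₀.exists_bound_H
  refine ⟨(B * (B + 1)).factorial, Nat.factorial_pos _, fun P σ hσ => ?_⟩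
  obtain ⟨τ, rfl⟩ := htr P₀ P
  obtain ⟨a, ha⟩ := exists_isLead hσ
  have hR : ∀ x ∈ (τ • P₀).R, σ x ∈ (τ • P₀).R := fun x hx => by
    have := Place.map_mem_R (σ := σ) hx
    rwa [hσ] at this
  obtain ⟨j, hj, hj', h⟩ := ha.pow_eq_one hR (n := B)
    (by rw [Place.H_smul]; exact hC _ le_rfl) (by rw [Place.H_smul]; exact hC _ (by omega)) (h1 _)
  have := ha.pow (B * (B + 1)).factorial
  obtain ⟨d, hd⟩ := Nat.dvd_factorial hj hj'
  rwa [hd, pow_mul a, h, one_pow, ← hd] at this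

theorem Diff.apply_ne_zero {ω : Place k K → Module.Dual k K} (hω : ω ∈ Diff k K) (h0 : ω ≠ 0)
    (P : Place k K) : ω P ≠ 0 := fun h =>
  h0 (eq_zero_of_apply_eq_zero hω.2 P (fun Q _ => hω.1 Q) h)

theorem eigenvalue_pow_eq_one {B E : ℕ}
    (hB : ∀ ω ∈ Diff k K, ω ≠ 0 → (zeros ω).Finite ∧ (zeros ω).ncard ≤ B)
    (hne : ∀ ω ∈ Diff k K, ω ≠ 0 → (zeros ω).Nonempty)
    (hE : ∀ (P : Place k K) (σ : K ≃ₐ[k] K), σ • P = P → IsLead P (σ ^ E) 1)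
    {σ : K ≃ₐ[k] K} {ω : Place k K → Module.Dual k K} (hω : ω ∈ Diff k K) (h0 : ω ≠ 0) {c : k}
    (hc : act σ ω = c • ω) : c ^ (B.factorial * E) = 1 := by
  have hpow : ∀ j : ℕ, act (σ ^ j) ω = c ^ j • ω := by
    intro j
    induction j with
    | zero => rw [pow_zero, act_one, pow_zero, one_smul]; rfl
    | succ j ih =>
      rw [pow_succ', act_mul, LinearMap.comp_apply, ih, map_smul, hc, smul_smul, pow_succ]
  have hc0 : c ≠ 0 := by
    rintro rfl
    refine h0 ?_
    have : act (σ⁻¹ * σ) ω = ω := by rw [inv_mul_cancel, act_one]; rfl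
    rw [← this, act_mul, LinearMap.comp_apply, hc, zero_smul, map_zero]
  obtain ⟨hfin, hcard⟩ := hB ω hω h0
  obtain ⟨Q, hQ⟩ := hne ω hω h0
  have hmem : ∀ j : ℕ, σ ^ j • Q ∈ zeros ω := by
    intro j x hx
    have := zeros_act (σ ^ j) hQ x hx
    rw [hpow] at this
    exact (smul_eq_zero.1 this).resolve_left (pow_ne_zero _ hc0)
  obtain ⟨i, hi, j, hj, hij, heq⟩ : ∃ i ∈ Finset.range (B + 1), ∃ j ∈ Finset.range (B + 1),
      i ≠ j ∧ σ ^ i • Q = σ ^ j • Q :=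
    Finset.exists_ne_map_eq_of_card_lt_of_maps_to (t := hfin.toFinset)
      (by rw [← Set.ncard_eq_toFinset_card _ hfin, Finset.card_range]; omega)
      (fun j _ => by simpa using hmem j)
  have key : ∀ i j : ℕ, i < j → j < B + 1 → σ ^ i • Q = σ ^ j • Q →
      σ ^ B.factorial • Q = Q := by
    intro i j hij hj heq
    have h2 : σ ^ (j - i) • Q = Q := by
      have h3 : σ ^ j = σ ^ i * σ ^ (j - i) := by rw [← pow_add, Nat.add_sub_of_le hij.le]
      rw [h3, mul_smul] at heq
      exact (MulAction.injective _ heq).symm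
    obtain ⟨d, hd⟩ := Nat.dvd_factorial (m := j - i) (n := B) (by omega) (by omega)
    rw [hd, pow_mul]
    clear hd
    induction d with
    | zero => simp
    | succ d ih => rw [pow_succ, mul_smul, h2, ih]
  have hstab : σ ^ B.factorial • Q = Q := by
    rw [Finset.mem_range] at hi hj
    rcases lt_or_gt_of_ne hij with h | h
    · exact key i j h hj heq
    · exact key j i h hi heq.symm
  have hlead := hE Q _ hstab
  rw [← pow_mul] at hlead
  have hact := hpow (B.factorial * E)
  set τ := σ ^ (B.factorial * E) with hτ
  have hτQ : τ • Q = Q := by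
    rw [hτ, pow_mul]
    generalize E = d
    induction d with
    | zero => simp
    | succ d ih => rw [pow_succ, mul_smul, hstab, ih]
  have hrel : ∀ x, ω Q x = c ^ (B.factorial * E) * ω Q (τ x) := fun x => by
    have h2 := LinearMap.congr_fun (congrFun hact Q) (τ x)
    rw [act_apply, show τ⁻¹ • Q = Q by rw [inv_smul_eq_iff, hτQ]] at h2
    rw [show τ⁻¹ (τ x) = x from τ.symm_apply_apply x] at h2
    exact h2
  have hex : ∃ n : ℕ, ∃ x, Q.v x = exp (n : ℤ) ∧ ω Q x ≠ 0 := by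
    have h2 := Diff.apply_ne_zero hω h0 Q
    obtain ⟨x, hx⟩ : ∃ x, ω Q x ≠ 0 := by
      by_contra! h3
      exact h2 (LinearMap.ext h3)
    have hx1 : ¬ Q.v x ≤ 1 := fun h => hx (hω.1 Q x h)
    obtain ⟨n, hn⟩ := Q.exists_v_eq_exp (x := x) (by rintro rfl; simp at hx)
    rw [hn, ← exp_zero, exp_le_exp, not_le] at hx1
    lift n to ℕ using hx1.le
    exact ⟨n, x, hn, hx⟩
  classical
  obtain ⟨x, hx, hx'⟩ := Nat.find_spec hex
  have hmin := fun {m : ℕ} (hm : m < Nat.find hex) => Nat.find_min hex hm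
  have hlt := hlead.2 _ x hx
  rw [_root_.one_zpow, one_smul] at hlt
  have hz : ω Q (τ x - x) = 0 := by
    by_contra h2
    have hx1 : ¬ Q.v (τ x - x) ≤ 1 := fun h => h2 (hω.1 Q _ h)
    obtain ⟨n, hn⟩ := Q.exists_v_eq_exp (x := τ x - x) (by intro h; rw [h] at h2; simp at h2)
    rw [hn, ← exp_zero, exp_le_exp, not_le] at hx1
    lift n to ℕ using hx1.le
    rw [hn, exp_lt_exp] at hlt
    exact hmin (by exact_mod_cast hlt) ⟨_, hn, h2⟩
  rw [map_sub, sub_eq_zero] at hz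
  have := hrel x
  rw [hz] at this
  exact (mul_right_cancel₀ hx' ((one_mul _).trans this)).symm

end CurveField

end

section
open TensorProduct

namespace CurveField

section Burnside

variable {k V : Type*} [Field k] [AddCommGroup V] [Module k V]

theorem eq_zero_of_forall_trace_mul_eq_zero [FiniteDimensional k V] {h : Module.End k V}
    (hh : ∀ f : Module.End k V, LinearMap.trace k V (f * h) = 0) : h = 0 := by
  refine LinearMap.ext fun v => ?_
  by_contra hv
  obtain ⟨φ, hφ⟩ := Module.Projective.exists_dual_ne_zero k hv
  refine hφ ?_
  have h1 := hh (dualTensorHom k V V (φ ⊗ₜ v))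
  have h2 : dualTensorHom k V V (φ ⊗ₜ v) * h = dualTensorHom k V V ((φ ∘ₗ h) ⊗ₜ v) := by
    ext x; simp
  rwa [h2, LinearMap.trace_eq_contract_apply, contractLeft_apply] at h1

theorem finite_traces [FiniteDimensional k V] [IsAlgClosed k] {U : Set k} (hU : U.Finite) :
    {t : k | ∃ f : Module.End k V, (∀ c, f.HasEigenvalue c → c ∈ U) ∧
      LinearMap.trace k V f = t}.Finite := by
  classical
  refine ((Set.finite_Iic (Module.finrank k V • hU.toFinset.val)).image Multiset.sum).subset ?_
  rintro _ ⟨f, hf, rfl⟩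
  refine ⟨f.charpoly.roots, ?_, ?_⟩
  · rw [Set.mem_Iic, Multiset.le_iff_count]
    intro c
    by_cases hc : c ∈ f.charpoly.roots
    · have h1 : c ∈ U := hf c ((Module.End.hasEigenvalue_iff_isRoot_charpoly f c).2
        (Polynomial.isRoot_of_mem_roots hc))
      rw [Multiset.count_nsmul]
      have h2 : (hU.toFinset.val).count c = 1 :=
        Multiset.count_eq_one_of_mem hU.toFinset.nodup (by simpa using h1)
      rw [h2, mul_one]
      exact (Multiset.count_le_card _ _).trans ((Polynomial.card_roots' _).trans
        (LinearMap.charpoly_natDegree f).le)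
    · rw [Multiset.count_eq_zero_of_notMem hc]; exact Nat.zero_le _
  · exact (Module.End.trace_eq_sum_roots_charpoly_of_splits (IsAlgClosed.splits _)).symm

theorem finite_of_span_eq_top [FiniteDimensional k V] [IsAlgClosed k] {U : Set k} (hU : U.Finite)
    {M : Set (Module.End k V)} (hspan : Submodule.span k M = ⊤)
    (hmul : ∀ g ∈ M, ∀ h ∈ M, g * h ∈ M) (hM : ∀ g ∈ M, ∀ c, g.HasEigenvalue c → c ∈ U) :
    M.Finite := by
  obtain ⟨b, hb, -, hbs, -⟩ := Submodule.exists_finset_span_eq_linearIndepOn k M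
  rw [hspan] at hbs
  let T : Module.End k V → (b → k) := fun h i => LinearMap.trace k V ((i : Module.End k V) * h)
  have hT : Function.Injective T := by
    intro x y hxy
    rw [← sub_eq_zero]
    refine eq_zero_of_forall_trace_mul_eq_zero fun f => ?_
    have hf : f ∈ Submodule.span k (b : Set (Module.End k V)) := hbs ▸ Submodule.mem_top
    induction hf using Submodule.span_induction with
    | mem z hz =>
      have := congrFun hxy ⟨z, hz⟩
      rw [mul_sub, map_sub, sub_eq_zero]
      exact this
    | zero => simp
    | add z w _ _ h1 h2 => rw [add_mul, map_add, h1, h2, add_zero]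
    | smul c z _ h1 => rw [smul_mul_assoc, map_smul, h1, smul_zero]
  refine Set.Finite.of_finite_image (f := T) ?_ hT.injOn
  refine (Set.Finite.pi' fun _ : b => finite_traces (V := V) hU).subset ?_
  rintro _ ⟨g, hg, rfl⟩ ⟨i, hi⟩
  exact ⟨i * g, hM _ (hmul _ (hb hi) _ hg), rfl⟩

theorem exists_finite_orbit [FiniteDimensional k V] [IsAlgClosed k] [Nontrivial V]
    {G : Type*} [Monoid G] (ρ : G →* Module.End k V) {U : Set k} (hU : U.Finite)
    (hM : ∀ g c, (ρ g).HasEigenvalue c → c ∈ U) :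
    ∃ v : V, v ≠ 0 ∧ (Set.range fun g => ρ g v).Finite := by
  classical
  let M := MonoidHom.mrange ρ
  replace hM : ∀ g ∈ M, ∀ c, g.HasEigenvalue c → c ∈ U := by
    rintro _ ⟨g, rfl⟩
    exact hM g
  let A := Algebra.adjoin k (M : Set (Module.End k V))
  have : IsArtinian A V := isArtinian_of_tower k inferInstance
  obtain ⟨S, hS, -⟩ := (IsAtomic.eq_bot_or_exists_atom_le (⊤ : Submodule A V)).resolve_left
    top_ne_bot
  have hSs : IsSimpleModule A S := isSimpleModule_iff_isAtom.2 hS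
  have hfS : FiniteDimensional k S := inferInstanceAs (FiniteDimensional k (S.restrictScalars k))
  let π : A →ₐ[k] Module.End k S := Algebra.lsmul k k S
  have hbij := IsSimpleModule.algebraMap_end_bijective_of_isAlgClosed (A := A) (V := S) k
  have hsurj : Function.Surjective π := by
    intro f
    let F : Module.End (Module.End A S) S :=
      { toFun := f
        map_add' := map_add f
        map_smul' := fun e x => by
          obtain ⟨c, rfl⟩ := hbij.2 e
          simp }
    obtain ⟨s, hs⟩ := Module.Finite.fg_top (R := k) (M := S)
    obtain ⟨r, hr⟩ := jacobson_density (R := A) F s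
    refine ⟨r, LinearMap.ext_on hs fun m hm => (hr m hm).symm⟩
  let gS : M → Module.End k S := fun g => π ⟨g, Algebra.subset_adjoin g.2⟩
  have hmul : ∀ g h : M, gS (g * h) = gS g * gS h := fun g h => by
    rw [← map_mul]; rfl
  have hspan : Submodule.span k (Set.range gS) = ⊤ := by
    rw [eq_top_iff]
    rintro f -
    obtain ⟨⟨a, ha⟩, rfl⟩ := hsurj f
    have ha' : a ∈ Submodule.span k (M : Set (Module.End k V)) := by
      have := ha
      change a ∈ Subalgebra.toSubmodule A at this
      rwa [Algebra.adjoin_eq_span, Submonoid.closure_eq] at this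
    induction ha' using Submodule.span_induction with
    | mem x hx => exact Submodule.subset_span ⟨⟨x, hx⟩, rfl⟩
    | zero => exact (map_zero π).symm ▸ Submodule.zero_mem _
    | add x y hx hy h1 h2 =>
      have hx' : x ∈ A := Algebra.span_le_adjoin k _ hx
      have hy' : y ∈ A := Algebra.span_le_adjoin k _ hy
      exact (map_add π ⟨x, hx'⟩ ⟨y, hy'⟩) ▸ add_mem (h1 hx') (h2 hy')
    | smul c x hx h1 =>
      have hx' : x ∈ A := Algebra.span_le_adjoin k _ hx
      exact (map_smul π c ⟨x, hx'⟩) ▸ Submodule.smul_mem _ _ (h1 hx')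
  have heig : ∀ g : M, ∀ c, Module.End.HasEigenvalue (R := k) (M := S) (gS g) c → c ∈ U := by
    intro g c hc
    obtain ⟨v, hv⟩ := hc.exists_hasEigenvector
    refine hM g g.2 c (Module.End.hasEigenvalue_of_hasEigenvector (x := (v : V))
      ⟨Module.End.mem_eigenspace_iff.2 ?_, ?_⟩)
    · exact congrArg Subtype.val hv.apply_eq_smul
    · simpa using hv.2
  have hfin : (Set.range gS).Finite := finite_of_span_eq_top (V := S) hU hspan
    (by rintro _ ⟨g, rfl⟩ _ ⟨h, rfl⟩; exact ⟨g * h, hmul g h⟩)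
    (by rintro _ ⟨g, rfl⟩ c hc; exact heig g c hc)
  obtain ⟨v, hvS, hv⟩ := Submodule.exists_mem_ne_zero_of_ne_bot hS.1
  refine ⟨v, hv, (hfin.image fun f => ((f ⟨v, hvS⟩ : S) : V)).subset ?_⟩
  rintro _ ⟨g, rfl⟩
  exact ⟨_, ⟨⟨ρ g, g, rfl⟩, rfl⟩, rfl⟩

end Burnside

end CurveField

end

section
open Polynomial WithZero

namespace CurveField

variable {k K : Type*} [Field k] [Field K] [Algebra k K] [IsCurveField k K] [IsAlgClosed k]

theorem finrank_Diff_le_one (h1 : ∀ P : Place k K, (1 : ℤ) ∉ P.H)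
    (htr : ∀ P Q : Place k K, ∃ σ : K ≃ₐ[k] K, σ • P = Q) :
    Module.finrank k (Diff k K) ≤ 1 := by
  have hDfin := Diff.finite k K
  have := Place.infinite k K
  by_contra hlt
  rw [not_le] at hlt
  have hne : ∀ ω ∈ Diff k K, ω ≠ 0 → (zeros ω).Nonempty := by
    intro ω hω h0
    by_contra hz
    refine hlt.not_ge (finrank_le_one (⟨ω, hω⟩ : Diff k K) fun ω₁ => ?_)
    by_contra! h
    exact hz (zeros_nonempty ω₁.2 hω h0 fun c hc => h c (Subtype.ext hc.symm))
  obtain ⟨B, hB⟩ := exists_card_zeros_le k K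
  obtain ⟨E, hE0, hE⟩ := exists_isLead_one h1 htr
  set N := B.factorial * E with hN
  have hN0 : 0 < N := Nat.mul_pos (Nat.factorial_pos _) hE0
  have hU : {c : k | c ^ N = 1}.Finite := by
    refine (Polynomial.nthRootsFinset N (1 : k)).finite_toSet.subset fun c hc => ?_
    simpa [Polynomial.mem_nthRootsFinset hN0] using hc
  have : Nontrivial (Diff k K) := Module.nontrivial_of_finrank_pos (R := k) (by omega)
  obtain ⟨ω, h0, hfin⟩ := exists_finite_orbit (V := Diff k K)
    (rep k K) hU (by
    intro σ c hc
    obtain ⟨ω, hω⟩ := hc.exists_hasEigenvector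
    exact eigenvalue_pow_eq_one hB hne hE ω.2 (by simpa using hω.2)
      (congrArg Subtype.val hω.apply_eq_smul))
  have h0' : (ω : Place k K → Module.Dual k K) ≠ 0 := by simpa using h0
  obtain ⟨Q, hQ⟩ := hne ω.1 ω.2 h0'
  refine Set.infinite_univ (α := Place k K) ((hfin.biUnion
    (t := fun ω' : Diff k K => {P | P ∈ zeros ω'.1 ∧ ω' ≠ 0}) fun ω' _ => ?_).subset
    (fun P _ => ?_))
  · by_cases h : ω' = 0
    · simp [h]
    · exact (hB ω'.1 ω'.2 (by simpa using h)).1.subset fun P hP => hP.1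
  · obtain ⟨σ, rfl⟩ := htr Q P
    simp only [Set.mem_iUnion]
    refine ⟨rep k K σ ω, ⟨σ, rfl⟩, zeros_act σ hQ, fun h => h0 ?_⟩
    have h2 : rep k K (σ⁻¹ * σ) ω = 0 := by
      rw [map_mul, Module.End.mul_apply, h, map_zero]
    rwa [inv_mul_cancel, map_one] at h2

theorem mem_H_of_two_le (h1 : ∀ P : Place k K, (1 : ℤ) ∉ P.H)
    (htr : ∀ P Q : Place k K, ∃ σ : K ≃ₐ[k] K, σ • P = Q) (P : Place k K) {n : ℤ} (hn : 2 ≤ n) :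
    n ∈ P.H := by
  by_contra hnH
  have hle := finrank_Diff_le_one h1 htr
  rw [Diff.finrank_eq P] at hle
  have := P.finite_quotient_zero
  choose a ha using P.exists_v_eq
  have hli := P.linearIndependent_gaps (ι := Bool) (fun b => if b then 1 else n)
    (by intro b c; cases b <;> cases c <;> simp <;> omega) _ (fun i => ha _)
    (by intro b; cases b <;> simp [hnH, h1]) (by intro b; cases b <;> simp; omega)
  have := hli.fintype_card_le_finrank
  simp only [Fintype.card_bool] at this
  omega

end CurveField

end

section
open Polynomial WithZero

namespace CurveField

variable {k K : Type*} [Field k] [Field K] [Algebra k K] [IsCurveField k K] [IsAlgClosed k]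

/-- Functions `x`, `y` regular away from `P` with poles of order two and three at `P`. -/
structure IsCoords (P : Place k K) (x y : K) : Prop where
  x_mem : x ∈ P.R
  y_mem : y ∈ P.R
  v_x : P.v x = exp 2
  v_y : P.v y = exp 3
  one_notMem : (1 : ℤ) ∉ P.H

theorem exists_eq_algebraMap_of_lt {P : Place k K} (h1 : (1 : ℤ) ∉ P.H) {w : K} (hw : w ∈ P.R)
    (hv : P.v w < exp 2) : ∃ c : k, w = algebraMap k K c := by
  by_cases h0 : w = 0
  · exact ⟨0, by simp [h0]⟩
  obtain ⟨n, hn⟩ := P.exists_v_eq_exp h0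
  have hnH : n ∈ P.H := ⟨w, hw, hn⟩
  rw [hn, exp_lt_exp] at hv
  have h2 := Place.nonneg_of_mem_H hnH
  have h3 : n ≠ 1 := by rintro rfl; exact h1 hnH
  have h4 : n = 0 := by omega
  obtain ⟨c, hc⟩ := Place.const_of_mem_R hw (by rw [hn, h4, exp_zero])
  exact ⟨c, hc.symm⟩

theorem exists_reduce {P : Place k K} {w b : K} (hw : w ∈ P.R) (hb : b ∈ P.R) {m n : ℤ}
    (hmn : m = n + 1) (hbv : P.v b = exp n) (hwv : P.v w < exp m) :
    ∃ c : k, w - c • b ∈ P.R ∧ P.v (w - c • b) < exp n := by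
  obtain ⟨c, hc⟩ := P.exists_sub_smul_lt (x := w) (y := b)
    (by rintro rfl; simp [exp_ne_zero.symm] at hbv)
    (by rw [hbv]; rw [Place.lt_exp_iff, hmn] at hwv; simpa using hwv)
  exact ⟨c, sub_mem hw (P.R.smul_mem hb _), hbv ▸ hc⟩

namespace IsCoords

variable {P : Place k K} {x y : K}

omit [IsAlgClosed k] in
theorem one_lt (h : IsCoords P x y) : 1 < P.v x := by
  rw [h.v_x, ← exp_zero, exp_lt_exp]; norm_num

omit [IsAlgClosed k] in
theorem v_aeval (h : IsCoords P x y) {p : k[X]} (hp : p ≠ 0) :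
    P.v (Polynomial.aeval x p) = exp (2 * p.natDegree : ℤ) := by
  rw [P.v_aeval_of_pole h.one_lt hp, h.v_x, ← WithZero.exp_nsmul]
  congr 1; simp [mul_comm]

theorem eq_zero_of_aeval (h : IsCoords P x y) {p q : k[X]}
    (hpq : Polynomial.aeval x p + Polynomial.aeval x q * y = 0) : p = 0 ∧ q = 0 := by
  have hc := P.not_const_of_gt h.one_lt
  have hy0 : y ≠ 0 := by rintro rfl; simpa [exp_ne_zero.symm] using h.v_y
  by_cases hq : q = 0
  · subst hq
    refine ⟨?_, rfl⟩
    by_contra hp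
    exact aeval_ne_zero hc hp (by simpa using hpq)
  · exfalso
    by_cases hp : p = 0
    · subst hp
      exact mul_ne_zero (aeval_ne_zero hc hq) hy0 (by simpa using hpq)
    · have h2 : P.v (Polynomial.aeval x p) = P.v (Polynomial.aeval x q * y) := by
        rw [eq_neg_of_add_eq_zero_left hpq, Valuation.map_neg]
      rw [map_mul, h.v_aeval hp, h.v_aeval hq, h.v_y, ← exp_add] at h2
      have := exp_injective h2
      omega

theorem coeffs_eq_zero (h : IsCoords P x y) {c₀ c₁ c₂ c₃ d₀ d₁ : k}
    (e : algebraMap k K c₀ + algebraMap k K c₁ * x + algebraMap k K c₂ * x ^ 2 +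
      algebraMap k K c₃ * x ^ 3 + (algebraMap k K d₀ + algebraMap k K d₁ * x) * y = 0) :
    c₀ = 0 ∧ c₁ = 0 ∧ c₂ = 0 ∧ c₃ = 0 ∧ d₀ = 0 ∧ d₁ = 0 := by
  obtain ⟨hp, hq⟩ := h.eq_zero_of_aeval
    (p := Polynomial.C c₀ + Polynomial.C c₁ * Polynomial.X + Polynomial.C c₂ * Polynomial.X ^ 2 +
      Polynomial.C c₃ * Polynomial.X ^ 3)
    (q := Polynomial.C d₀ + Polynomial.C d₁ * Polynomial.X) (by simpa using e)
  have P (n : ℕ) := congrArg (fun p : k[X] => p.coeff n) hp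
  have Q (n : ℕ) := congrArg (fun p : k[X] => p.coeff n) hq
  refine ⟨?_, ?_, ?_, ?_, ?_, ?_⟩
  · simpa [Polynomial.coeff_X_pow, Polynomial.coeff_C, Polynomial.coeff_X] using P 0
  · simpa [Polynomial.coeff_X_pow, Polynomial.coeff_C, Polynomial.coeff_X] using P 1
  · simpa [Polynomial.coeff_X_pow, Polynomial.coeff_C, Polynomial.coeff_X] using P 2
  · simpa [Polynomial.coeff_X_pow, Polynomial.coeff_C, Polynomial.coeff_X] using P 3
  · simpa [Polynomial.coeff_X_pow, Polynomial.coeff_C, Polynomial.coeff_X] using Q 0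
  · simpa [Polynomial.coeff_X_pow, Polynomial.coeff_C, Polynomial.coeff_X] using Q 1

omit [IsAlgClosed k] in
theorem v_sq_ne (h : IsCoords P x y) {w : K} (hw : w ^ 2 ∈ P.R) : P.v (w ^ 2) ≠ exp 2 := by
  intro hv
  have hwR : w ∈ P.R := fun Q hQ => by
    have := hw Q hQ
    rw [map_pow] at this
    exact (pow_le_one_iff_of_nonneg zero_le two_ne_zero).1 this
  obtain ⟨n, hn⟩ := P.exists_v_eq_exp (x := w) (by rintro rfl; simp [exp_ne_zero.symm] at hv)
  rw [map_pow, hn, ← WithZero.exp_nsmul] at hv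
  have := exp_injective hv
  have h2 : n = 1 := by simpa using this
  exact h.one_notMem ⟨w, hwR, h2 ▸ hn⟩

omit [IsAlgClosed k] in
theorem x_add_const (h : IsCoords P x y) (c : k) :
    x + algebraMap k K c ∈ P.R ∧ P.v (x + algebraMap k K c) = exp 2 := by
  refine ⟨add_mem h.x_mem (P.R.algebraMap_mem c), ?_⟩
  rw [Valuation.map_add_eq_of_lt_left, h.v_x]
  exact (P.v_const_le c).trans_lt h.one_lt

theorem exists_relation (h : IsCoords P x y) : ∃ c d e f g l : k, c ≠ 0 ∧
    y ^ 2 = c • x ^ 3 + d • (x * y) + e • x ^ 2 + f • y + g • x + algebraMap k K l := by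
  obtain ⟨c, hcR, hc⟩ := exists_reduce (P := P) (w := y ^ 2) (b := x ^ 3) (m := 7) (n := 6)
    (P.R.pow_mem h.y_mem _) (P.R.pow_mem h.x_mem _) rfl
    (by rw [map_pow, h.v_x, ← WithZero.exp_nsmul]; congr 1)
    (by rw [map_pow, h.v_y, ← WithZero.exp_nsmul, exp_lt_exp]; norm_num)
  obtain ⟨d, hdR, hd⟩ := exists_reduce (P := P) (b := x * y) (m := 6) (n := 5)
    hcR (P.R.mul_mem h.x_mem h.y_mem) rfl
    (by rw [map_mul, h.v_x, h.v_y, ← exp_add]; congr 1) hc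
  obtain ⟨e, heR, he⟩ := exists_reduce (P := P) (b := x ^ 2) (m := 5) (n := 4)
    hdR (P.R.pow_mem h.x_mem _) rfl (by rw [map_pow, h.v_x, ← WithZero.exp_nsmul]; congr 1) hd
  obtain ⟨f, hfR, hf⟩ := exists_reduce (P := P) (b := y) (m := 4) (n := 3)
    heR h.y_mem rfl h.v_y he
  obtain ⟨g, hgR, hg⟩ := exists_reduce (P := P) (b := x) (m := 3) (n := 2)
    hfR h.x_mem rfl h.v_x hf
  obtain ⟨l, hl⟩ := exists_eq_algebraMap_of_lt h.one_notMem hgR hg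
  refine ⟨c, d, e, f, g, l, ?_, by rw [← hl]; abel⟩
  rintro rfl
  rw [zero_smul, sub_zero, map_pow, h.v_y, ← WithZero.exp_nsmul, exp_lt_exp] at hc
  norm_num at hc

theorem exists_normalized (h : IsCoords P x y) : ∃ x' y' : K, IsCoords P x' y' ∧ ∃ d e f g l : k,
    y' ^ 2 = x' ^ 3 + algebraMap k K d * x' * y' + algebraMap k K e * x' ^ 2 +
      algebraMap k K f * y' + algebraMap k K g * x' + algebraMap k K l := by
  obtain ⟨c, d, e, f, g, l, hc, hr⟩ := h.exists_relation
  refine ⟨c • x, c • y, ⟨P.R.smul_mem h.x_mem _, P.R.smul_mem h.y_mem _, (P.v_smul hc _).trans h.v_x,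
    (P.v_smul hc _).trans h.v_y, h.one_notMem⟩, d, e, f * c, g * c, l * c ^ 2, ?_⟩
  simp only [Algebra.smul_def, map_mul, map_pow] at hr ⊢
  linear_combination (algebraMap k K c) ^ 2 * hr

theorem exists_factored (h : IsCoords P x y) (h2 : (2 : k) ≠ 0) : ∃ x' y' : K, IsCoords P x' y' ∧
    ∃ a b c : k, y' ^ 2 = (x' - algebraMap k K a) * (x' - algebraMap k K b) *
      (x' - algebraMap k K c) := by
  obtain ⟨x, y, h, d, e, f, g, l, hr⟩ := h.exists_normalized
  have hlow : P.v (algebraMap k K (d / 2) * x + algebraMap k K (f / 2)) < P.v y := by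
    refine Valuation.map_add_lt _ ?_ ?_
    · rw [← Algebra.smul_def]
      refine (P.v_smul_le _ _).trans_lt ?_
      rw [h.v_x, h.v_y, exp_lt_exp]; norm_num
    · refine (P.v_const_le _).trans_lt ?_
      rw [h.v_y, ← exp_zero, exp_lt_exp]; norm_num
  obtain ⟨y', hy'⟩ : ∃ y', y' = y - (algebraMap k K (d / 2) * x + algebraMap k K (f / 2)) := ⟨_, rfl⟩
  have h' : IsCoords P x y' := ⟨h.x_mem, by
    rw [hy']
    exact sub_mem h.y_mem (add_mem (P.R.mul_mem (P.R.algebraMap_mem _) h.x_mem)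
      (P.R.algebraMap_mem _)), h.v_x, by
    rw [hy', Valuation.map_sub_eq_of_lt_left _ hlow, h.v_y], h.one_notMem⟩
  obtain ⟨p, hp⟩ : ∃ p : k[X], p = Polynomial.X ^ 3 + Polynomial.C (e + d ^ 2 / 4) * Polynomial.X ^ 2
    + Polynomial.C (g + d * f / 2) * Polynomial.X + Polynomial.C (l + f ^ 2 / 4) := ⟨_, rfl⟩
  have hm : p.Monic := by rw [hp]; monicity!
  have hd : p.natDegree = 3 := by rw [hp]; compute_degree!
  have hs := IsAlgClosed.splits p
  have hcard : p.roots.card = 3 := by rw [← hd]; exact hs.natDegree_eq_card_roots.symm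
  obtain ⟨a, b, c, habc⟩ := Multiset.card_eq_three.1 hcard
  refine ⟨x, y', h', a, b, c, ?_⟩
  have h3 : Polynomial.aeval x p = (x - algebraMap k K a) * (x - algebraMap k K b) *
      (x - algebraMap k K c) := by
    conv_lhs => rw [hs.eq_prod_roots_of_monic hm, habc]
    simp [mul_assoc]
  have h4 : y' ^ 2 = Polynomial.aeval x p := by
    rw [hp, hy']
    have h5 : (4 : k) = 2 * 2 := by norm_num
    have e1 : (algebraMap k K) 2 ≠ 0 := by simpa using h2
    simp only [map_add, map_mul, map_pow, Polynomial.aeval_X, Polynomial.aeval_C, map_div₀, h5]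
    field_simp
    rw [map_ofNat]
    linear_combination 4 * hr
  rw [h4, h3]

/-- The images of the coordinates under an automorphism fixing the place. -/
theorem exists_image (h : IsCoords P x y) {σ : K ≃ₐ[k] K} (hσ : σ • P = P) : ∃ a r s t : k, a ≠ 0 ∧
    σ x = algebraMap k K (a ^ 2) * x + algebraMap k K r ∧
    σ y = algebraMap k K (a ^ 3) * y + algebraMap k K s * x + algebraMap k K t := by
  have hR : ∀ z ∈ P.R, σ z ∈ P.R := fun z hz => by
    have := Place.map_mem_R (σ := σ) hz
    rwa [hσ] at this
  obtain ⟨a, ha0, ha⟩ := exists_isLead hσ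
  have h2 := ha 2 x h.v_x
  have h3 := ha 3 y h.v_y
  obtain ⟨r, hr⟩ := exists_eq_algebraMap_of_lt h.one_notMem
    (sub_mem (hR x h.x_mem) (P.R.smul_mem h.x_mem _)) h2
  obtain ⟨s, hsR, hs⟩ := exists_reduce (sub_mem (hR y h.y_mem) (P.R.smul_mem h.y_mem _)) h.x_mem
    rfl h.v_x h3
  obtain ⟨t, ht⟩ := exists_eq_algebraMap_of_lt h.one_notMem hsR hs
  refine ⟨a, r, s, t, ha0, ?_, ?_⟩
  · rw [← hr, ← Algebra.smul_def]; simp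
  · rw [← ht]; simp only [← Algebra.smul_def]; simp

theorem eq_of_image_eq (h : IsCoords P x y) {σ τ : K ≃ₐ[k] K} (hx : σ x = τ x) (hy : σ y = τ y) :
    σ = τ := by
  have key : ∀ n : ℕ, ∀ z ∈ P.R, P.v z < exp (n : ℤ) → σ z = τ z := by
    intro n
    induction n using Nat.strong_induction_on with
    | _ n ih =>
      intro z hz hv
      by_cases hn : n ≤ 2
      · obtain ⟨c, rfl⟩ := exists_eq_algebraMap_of_lt h.one_notMem hz
          (hv.trans_le (by rw [exp_le_exp]; exact_mod_cast hn))
        simp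
      · obtain ⟨i, j, hij⟩ : ∃ i j : ℕ, n = 2 * i + 3 * j + 1 := by
          rcases Nat.even_or_odd' n with ⟨m, hm | hm⟩
          · exact ⟨m - 2, 1, by omega⟩
          · exact ⟨m, 0, by omega⟩
        obtain ⟨c, hcR, hc⟩ := exists_reduce (b := x ^ i * y ^ j) (n := ((n - 1 : ℕ) : ℤ)) hz
          (P.R.mul_mem (P.R.pow_mem h.x_mem _) (P.R.pow_mem h.y_mem _)) (by omega) (by
            rw [map_mul, map_pow, map_pow, h.v_x, h.v_y, ← WithZero.exp_nsmul, ← WithZero.exp_nsmul, ← exp_add]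
            congr 1; simp; omega) hv
        have h1 := ih _ (by omega) _ hcR hc
        rw [map_sub, map_sub, map_smul, map_smul, map_mul, map_mul, map_pow, map_pow, map_pow,
          map_pow, hx, hy] at h1
        exact sub_left_injective h1
  have key' : ∀ z ∈ P.R, σ z = τ z := by
    intro z hz
    by_cases h0 : z = 0
    · simp [h0]
    obtain ⟨n, hn⟩ := P.exists_v_eq_exp h0
    refine key (n + 1).toNat z hz ?_
    rw [hn, exp_lt_exp]
    have := Int.self_le_toNat (n + 1)
    omega
  ext z
  obtain ⟨r, hr, hr0, hrz⟩ := P.exists_mul_mem_R z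
  have h1 := key' _ hrz
  rw [map_mul, map_mul, key' r hr] at h1
  exact mul_left_cancel₀ (by simpa using hr0) h1

end IsCoords

end CurveField

end

section
open Polynomial WithZero

namespace CurveField

variable {k K : Type*} [Field k] [Field K] [Algebra k K] [IsCurveField k K] [IsAlgClosed k]

namespace IsCoords

variable {P : Place k K} {x y : K}

omit [IsAlgClosed k] in
theorem roots_ne (h : IsCoords P x y) {a c : k}
    (e : y ^ 2 = (x - algebraMap k K a) ^ 2 * (x - algebraMap k K c)) : False := by
  have h0 : x - algebraMap k K a ≠ 0 := fun h0 =>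
    P.not_const_of_gt h.one_lt ⟨a, (sub_eq_zero.1 h0).symm⟩
  have hw : (y / (x - algebraMap k K a)) ^ 2 = x + algebraMap k K (-c) := by
    rw [div_pow, e, mul_div_cancel_left₀ _ (pow_ne_zero 2 h0), map_neg, sub_eq_add_neg]
  obtain ⟨h1, h2⟩ := h.x_add_const (-c)
  exact h.v_sq_ne (hw ▸ h1) (hw ▸ h2)

theorem exists_finset_of_two_ne_zero (h : IsCoords P x y) (h2 : (2 : k) ≠ 0) {e : Fin 3 → k}
    (hr : y ^ 2 = (x - algebraMap k K (e 0)) * (x - algebraMap k K (e 1)) *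
      (x - algebraMap k K (e 2))) :
    ∃ S : Finset (K × K), S.card ≤ 24 ∧ ∀ σ : K ≃ₐ[k] K, σ • P = P → (σ x, σ y) ∈ S := by
  classical
  have he01 : e 0 ≠ e 1 := fun h' => h.roots_ne (by rw [hr, h', sq])
  have h01 : e 0 - e 1 ≠ 0 := sub_ne_zero.2 he01
  let F : Finset k := Finset.univ.image e
  have hF : F.card ≤ 3 := Finset.card_image_le.trans (by simp)
  let α : k × k → k := fun p => (p.1 - p.2) / (e 0 - e 1)
  refine ⟨F.offDiag.biUnion fun p => (nthRoots 2 (α p ^ 3)).toFinset.image fun β =>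
    (algebraMap k K (α p) * x + algebraMap k K (p.1 - α p * e 0), algebraMap k K β * y), ?_, ?_⟩
  · refine (Finset.card_biUnion_le_card_mul _ _ 2 fun p _ => ?_).trans (b := F.offDiag.card * 2) ?_
    · exact Finset.card_image_le.trans ((Multiset.toFinset_card_le _).trans (card_nthRoots 2 _))
    · rw [Finset.offDiag_card]
      have : F.card * F.card ≤ 3 * F.card := Nat.mul_le_mul_right _ hF
      omega
  · intro σ hσ
    obtain ⟨a, r, s, t, ha, hx, hy⟩ := h.exists_image hσ
    have e1 := congrArg σ hr
    simp only [map_mul, map_sub, map_pow, AlgEquiv.commutes, hx, hy] at e1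
    obtain ⟨c0, c1, c2, c3, d0, d1⟩ := h.coeffs_eq_zero
      (c₀ := t ^ 2 - a ^ 6 * e 0 * e 1 * e 2 - (r - e 0) * (r - e 1) * (r - e 2))
      (c₁ := 2 * s * t + a ^ 6 * (e 0 * e 1 + e 0 * e 2 + e 1 * e 2) - a ^ 2 *
        ((r - e 0) * (r - e 1) + (r - e 0) * (r - e 2) + (r - e 1) * (r - e 2)))
      (c₂ := s ^ 2 - a ^ 6 * (e 0 + e 1 + e 2) - a ^ 4 * (3 * r - e 0 - e 1 - e 2))
      (c₃ := 0) (d₀ := 2 * a ^ 3 * t) (d₁ := 2 * a ^ 3 * s) (by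
        simp only [map_mul, map_sub, map_add, map_pow, map_ofNat, map_zero]
        linear_combination e1 - (algebraMap k K a) ^ 6 * hr)
    have ht : t = 0 := by simpa [h2, ha] using d0
    have hs : s = 0 := by simpa [h2, ha] using d1
    subst ht hs
    have hroot : ∀ i, a ^ 2 * e i + r ∈ F := by
      intro i
      have hp : (a ^ 2 * e i + r - e 0) * (a ^ 2 * e i + r - e 1) * (a ^ 2 * e i + r - e 2) = 0 := by
        have h3 : (e i - e 0) * (e i - e 1) * (e i - e 2) = 0 := by
          fin_cases i <;> simp
        linear_combination -c0 - e i * c1 - e i ^ 2 * c2 + a ^ 6 * h3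
      have hm : ∀ j, e j ∈ F := fun j => Finset.mem_image_of_mem _ (Finset.mem_univ _)
      rcases mul_eq_zero.1 hp with hp | hp
      · rcases mul_eq_zero.1 hp with hp | hp
        · rw [sub_eq_zero.1 hp]; exact hm _
        · rw [sub_eq_zero.1 hp]; exact hm _
      · rw [sub_eq_zero.1 hp]; exact hm _
    have hα : α (a ^ 2 * e 0 + r, a ^ 2 * e 1 + r) = a ^ 2 := by
      rw [div_eq_iff h01]; ring
    rw [Finset.mem_biUnion]
    refine ⟨(a ^ 2 * e 0 + r, a ^ 2 * e 1 + r), ?_, ?_⟩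
    · rw [Finset.mem_offDiag]
      refine ⟨hroot 0, hroot 1, fun h' => he01 ?_⟩
      simpa [ha] using h'
    · rw [Finset.mem_image]
      refine ⟨a ^ 3, ?_, ?_⟩
      · rw [Multiset.mem_toFinset, mem_nthRoots two_pos, hα]; ring
      · rw [hα, hx, hy]; simp

theorem exists_finset_of_two_eq_zero (h : IsCoords P x y) (h2 : (2 : k) = 0) {d e f g l : k}
    (hr : y ^ 2 = x ^ 3 + algebraMap k K d * x * y + algebraMap k K e * x ^ 2 +
      algebraMap k K f * y + algebraMap k K g * x + algebraMap k K l) :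
    ∃ S : Finset (K × K), S.card ≤ 24 ∧ ∀ σ : K ≃ₐ[k] K, σ • P = P → (σ x, σ y) ∈ S := by
  classical
  have h2K : (2 : K) = 0 := by rw [← map_ofNat (algebraMap k K), h2, map_zero]
  have key : ∀ σ : K ≃ₐ[k] K, σ • P = P → ∃ a r s t : k, a ≠ 0 ∧
      σ x = algebraMap k K (a ^ 2) * x + algebraMap k K r ∧
      σ y = algebraMap k K (a ^ 3) * y + algebraMap k K s * x + algebraMap k K t ∧
      a ^ 6 * d - d * a ^ 5 = 0 ∧ a ^ 6 * f - d * a ^ 3 * r - f * a ^ 3 = 0 ∧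
      a ^ 6 * e + s ^ 2 - a ^ 4 * r - d * a ^ 2 * s - e * a ^ 4 = 0 ∧
      a ^ 6 * g - a ^ 2 * r ^ 2 - d * (a ^ 2 * t + r * s) - f * s - g * a ^ 2 = 0 ∧
      a ^ 6 * l + t ^ 2 - r ^ 3 - d * r * t - e * r ^ 2 - f * t - g * r - l = 0 := by
    intro σ hσ
    obtain ⟨a, r, s, t, ha, hx, hy⟩ := h.exists_image hσ
    have e1 := congrArg σ hr
    simp only [map_mul, map_add, map_pow, AlgEquiv.commutes, hx, hy] at e1
    obtain ⟨c0, c1, c2, c3, d0, d1⟩ := h.coeffs_eq_zero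
      (c₀ := a ^ 6 * l + t ^ 2 - r ^ 3 - d * r * t - e * r ^ 2 - f * t - g * r - l)
      (c₁ := a ^ 6 * g - 3 * a ^ 2 * r ^ 2 - d * (a ^ 2 * t + r * s) - f * s - g * a ^ 2 +
        2 * s * t - 2 * e * a ^ 2 * r)
      (c₂ := a ^ 6 * e + s ^ 2 - 3 * a ^ 4 * r - d * a ^ 2 * s - e * a ^ 4)
      (c₃ := 0) (d₀ := a ^ 6 * f - d * a ^ 3 * r - f * a ^ 3 + 2 * a ^ 3 * t)
      (d₁ := a ^ 6 * d - d * a ^ 5 + 2 * a ^ 3 * s) (by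
        simp only [map_mul, map_sub, map_add, map_pow, map_ofNat, map_zero]
        linear_combination e1 - (algebraMap k K a) ^ 6 * hr)
    refine ⟨a, r, s, t, ha, by rw [hx], by rw [hy], ?_, ?_, ?_, ?_, c0⟩
    · linear_combination d1 - a ^ 3 * s * h2
    · linear_combination d0 - a ^ 3 * t * h2
    · linear_combination c2 + a ^ 4 * r * h2
    · linear_combination c1 + (a ^ 2 * r ^ 2 - s * t + e * a ^ 2 * r) * h2
  by_cases hd : d = 0
  · subst hd
    have hf : f ≠ 0 := by
      rintro rfl
      obtain ⟨x₀, hx₀⟩ := IsAlgClosed.exists_pow_nat_eq (-g) (n := 2) two_pos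
      obtain ⟨y₀, hy₀⟩ := IsAlgClosed.exists_pow_nat_eq (x₀ ^ 3 + e * x₀ ^ 2 + g * x₀ + l)
        (n := 2) two_pos
      have hx₀' := congrArg (algebraMap k K) hx₀
      have hy₀' := congrArg (algebraMap k K) hy₀
      simp only [map_pow, map_add, map_mul, map_neg, map_zero, zero_mul, add_zero] at hx₀' hy₀' hr
      have h0 : x - algebraMap k K x₀ ≠ 0 := fun h0 =>
        P.not_const_of_gt h.one_lt ⟨x₀, (sub_eq_zero.1 h0).symm⟩
      have hw : ((y - algebraMap k K y₀) / (x - algebraMap k K x₀)) ^ 2 =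
          x + algebraMap k K e := by
        rw [div_pow, div_eq_iff (pow_ne_zero 2 h0)]
        generalize algebraMap k K x₀ = X0 at *
        generalize algebraMap k K y₀ = Y0 at *
        generalize algebraMap k K e = E at *
        generalize algebraMap k K g = G at *
        generalize algebraMap k K l = L at *
        linear_combination hr + hy₀' + (x + X0) * hx₀' +
          (L - y * Y0 + x ^ 2 * X0 - x * X0 ^ 2 + E * x * X0) * h2K
      obtain ⟨h1, h2⟩ := h.x_add_const e
      exact h.v_sq_ne (hw ▸ h1) (hw ▸ h2)
    let r : k → k → k := fun a s => a ^ 2 * (e + s ^ 2 - e * a)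
    let q : k → k[X] := fun a => (Polynomial.X ^ 2 + Polynomial.C (e - e * a)) ^ 2 +
      Polynomial.C f * Polynomial.X + Polynomial.C (g * a ^ 2 - g)
    have hq : ∀ a, (q a).natDegree = 4 := fun a => by
      simp only [q]; compute_degree!
    let T : k → k → Finset k := fun a s => (Polynomial.X ^ 2 - Polynomial.C f * Polynomial.X +
      Polynomial.C (l - r a s ^ 3 - e * r a s ^ 2 - g * r a s - l) : k[X]).roots.toFinset
    have hT : ∀ a s, (T a s).card ≤ 2 := fun a s =>
      (Multiset.toFinset_card_le _).trans ((card_roots' _).trans (by compute_degree))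
    refine ⟨(nthRoots 3 (1 : k)).toFinset.biUnion fun a => (q a).roots.toFinset.biUnion fun s =>
      (T a s).image fun t => (algebraMap k K (a ^ 2) * x + algebraMap k K (r a s),
        algebraMap k K (a ^ 3) * y + algebraMap k K s * x + algebraMap k K t), ?_, ?_⟩
    · refine (Finset.card_biUnion_le_card_mul _ _ (4 * 2) fun a _ => ?_).trans
        (Nat.mul_le_mul_right (4 * 2) (m := 3)
          ((Multiset.toFinset_card_le _).trans (card_nthRoots 3 _)))
      refine (Finset.card_biUnion_le_card_mul _ _ 2 fun s _ => ?_).trans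
        (Nat.mul_le_mul_right 2 ((Multiset.toFinset_card_le _).trans ((card_roots' _).trans
          (hq a).le)))
      exact Finset.card_image_le.trans (hT a s)
    · intro σ hσ
      obtain ⟨a, r', s, t, ha, hx, hy, d1, d0, c2, c1, c0⟩ := key σ hσ
      have ha3 : a ^ 3 = 1 := by
        have : (a ^ 3 * f) * (a ^ 3 - 1) = 0 := by linear_combination d0
        rcases mul_eq_zero.1 this with h' | h'
        · exact absurd h' (mul_ne_zero (pow_ne_zero _ ha) hf)
        · exact sub_eq_zero.1 h'
      have hr' : r' = r a s := by
        simp only [r]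
        linear_combination -a ^ 2 * c2 +
          (-(a ^ 3 + 1) * r' + e * a ^ 2 * (a ^ 3 + 1) - e * a ^ 3) * ha3
      simp only [Finset.mem_biUnion, Finset.mem_image, Multiset.mem_toFinset]
      refine ⟨a, (mem_nthRoots (by norm_num)).2 ha3, s, ?_, t, ?_, ?_⟩
      · rw [mem_roots (by intro h'; have := hq a; simp [h'] at this)]
        simp only [q, IsRoot, Polynomial.eval_add, Polynomial.eval_mul, Polynomial.eval_pow, Polynomial.eval_X, Polynomial.eval_C]
        rw [hr'] at c1
        linear_combination -c1 + (a ^ 3 + 1) * (g - (e + s ^ 2 - e * a) ^ 2) * ha3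
      · simp only [T, Multiset.mem_toFinset]
        rw [mem_roots (Polynomial.Monic.ne_zero (by monicity!))]
        simp only [IsRoot, Polynomial.eval_add, Polynomial.eval_mul, Polynomial.eval_sub, Polynomial.eval_pow, Polynomial.eval_X, Polynomial.eval_C]
        rw [← hr']
        linear_combination c0 - (a ^ 3 + 1) * l * ha3
      · rw [hx, hy, hr']
  · refine ⟨{(x, y), (x, y + algebraMap k K d * x - algebraMap k K f)},
      Finset.card_le_two.trans (by norm_num), fun σ hσ => ?_⟩
    obtain ⟨a, r, s, t, ha, hx, hy, d1, d0, c2, c1, c0⟩ := key σ hσ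
    have ha1 : a = 1 := by
      have : (a ^ 5 * d) * (a - 1) = 0 := by linear_combination d1
      rcases mul_eq_zero.1 this with h' | h'
      · exact absurd h' (mul_ne_zero (pow_ne_zero _ ha) hd)
      · exact sub_eq_zero.1 h'
    subst ha1
    have hr0 : r = 0 := by
      have : d * r = 0 := by linear_combination -d0
      exact (mul_eq_zero.1 this).resolve_left hd
    subst hr0
    have hs : s * (s - d) = 0 := by linear_combination c2
    have ht : d * t = - (f * s) := by linear_combination -c1
    rw [Finset.mem_insert, Finset.mem_singleton]
    rcases mul_eq_zero.1 hs with hs | hs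
    · left
      subst hs
      have : t = 0 := by simpa [hd] using ht
      subst this
      rw [hx, hy]; simp
    · right
      obtain rfl := (sub_eq_zero.1 hs)
      have : t = -f := mul_left_cancel₀ hd (by rw [ht]; ring)
      subst this
      rw [hx, hy]; simp [sub_eq_add_neg]

end IsCoords

theorem card_stabilizer_le {P : Place k K} (h1 : (1 : ℤ) ∉ P.H) (h2 : (2 : ℤ) ∈ P.H)
    (h3 : (3 : ℤ) ∈ P.H) : {σ : K ≃ₐ[k] K | σ • P = P}.Finite ∧
      {σ : K ≃ₐ[k] K | σ • P = P}.ncard ≤ 24 := by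
  obtain ⟨x, hx, hvx⟩ := h2
  obtain ⟨y, hy, hvy⟩ := h3
  have h : IsCoords P x y := ⟨hx, hy, hvx, hvy, h1⟩
  obtain ⟨x', y', h', S, hS, hmem⟩ : ∃ x' y' : K, IsCoords P x' y' ∧ ∃ S : Finset (K × K),
      S.card ≤ 24 ∧ ∀ σ : K ≃ₐ[k] K, σ • P = P → (σ x', σ y') ∈ S := by
    by_cases h2 : (2 : k) = 0
    · obtain ⟨x', y', h', d, e, f, g, l, hr⟩ := h.exists_normalized
      exact ⟨x', y', h', h'.exists_finset_of_two_eq_zero h2 hr⟩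
    · obtain ⟨x', y', h', a, b, c, hr⟩ := h.exists_factored h2
      exact ⟨x', y', h', h'.exists_finset_of_two_ne_zero h2 (e := ![a, b, c]) hr⟩
  have hinj : Set.InjOn (fun σ : K ≃ₐ[k] K => (σ x', σ y')) {σ | σ • P = P} := by
    intro σ _ τ _ hστ
    rw [Prod.mk.injEq] at hστ
    exact h'.eq_of_image_eq hστ.1 hστ.2
  have hmaps : Set.MapsTo (fun σ : K ≃ₐ[k] K => (σ x', σ y')) {σ | σ • P = P} S :=
    fun σ hσ => hmem σ hσ
  refine ⟨Set.Finite.of_injOn hmaps hinj S.finite_toSet, ?_⟩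
  refine (Set.ncard_le_ncard_of_injOn _ hmaps hinj S.finite_toSet).trans ?_
  rwa [Set.ncard_coe_finset]

end CurveField

end

section
open Polynomial WithZero

namespace CurveField

variable {k K : Type*} [Field k] [Field K] [Algebra k K] [IsCurveField k K] [IsAlgClosed k]

theorem exists_generator {P : Place k K} (h1 : (1 : ℤ) ∈ P.H) :
    ∃ z ∉ (algebraMap k K).range, ∀ y : K, ∃ p q : k[X], q ≠ 0 ∧ Polynomial.aeval z q * y = Polynomial.aeval z p := by
  obtain ⟨z, hz, hvz⟩ := h1
  have h1z : 1 < P.v z := by rw [hvz, ← exp_zero, exp_lt_exp]; norm_num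
  have hzc := P.not_const_of_gt h1z
  have key : ∀ n : ℕ, ∀ w ∈ P.R, P.v w < exp (n : ℤ) → ∃ p : k[X], w = Polynomial.aeval z p := by
    intro n
    induction n with
    | zero =>
      intro w hw hv
      exact ⟨0, by rw [map_zero, Place.eq_zero_of_mem_R hw (by simpa using hv)]⟩
    | succ n ih =>
      intro w hw hv
      obtain ⟨c, hcR, hc⟩ := exists_reduce (b := z ^ n) hw (P.R.pow_mem hz _)
        (m := ((n + 1 : ℕ) : ℤ)) (n := n) (by simp) (by rw [map_pow, hvz, ← WithZero.exp_nsmul]; simp) hv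
      obtain ⟨p, hp⟩ := ih _ hcR hc
      exact ⟨p + c • Polynomial.X ^ n, by simp [← hp]⟩
  have key' : ∀ w ∈ P.R, ∃ p : k[X], w = Polynomial.aeval z p := by
    intro w hw
    by_cases h0 : w = 0
    · exact ⟨0, by simp [h0]⟩
    obtain ⟨n, hn⟩ := P.exists_v_eq_exp h0
    refine key (n + 1).toNat w hw ?_
    rw [hn, exp_lt_exp]
    have := Int.self_le_toNat (n + 1)
    omega
  refine ⟨z, hzc, fun y => ?_⟩
  obtain ⟨r, hr, hr0, hry⟩ := P.exists_mul_mem_R y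
  obtain ⟨q, rfl⟩ := key' r hr
  obtain ⟨p, hp⟩ := key' _ hry
  exact ⟨p, q, by rintro rfl; simp at hr0, hp⟩

theorem card_stabilizer_le_of_transitive
    (hnr : ¬ ∃ z ∉ (algebraMap k K).range, ∀ y : K, ∃ p q : k[X],
      q ≠ 0 ∧ Polynomial.aeval z q * y = Polynomial.aeval z p)
    (htr : ∀ P Q : Place k K, ∃ σ : K ≃ₐ[k] K, σ • P = Q) (P : Place k K) :
    {σ : K ≃ₐ[k] K | σ • P = P}.Finite ∧ {σ : K ≃ₐ[k] K | σ • P = P}.ncard ≤ 24 := by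
  have h1 : ∀ P : Place k K, (1 : ℤ) ∉ P.H := fun P h => hnr (exists_generator h)
  exact card_stabilizer_le (h1 P) (mem_H_of_two_le h1 htr P le_rfl)
    (mem_H_of_two_le h1 htr P (by norm_num))

end CurveField

end

section
open Polynomial Algebra
namespace CurveField

variable {L A K : Type} [Field L] [CommRing A] [IsDomain A] [Algebra L A] [Field K] [Algebra A K]
  [IsFractionRing A K] [Algebra L K] [IsScalarTower L A K]

theorem krullDimLE_one_of_isIntegral {R S : Type} [CommRing R] [IsDomain R] [CommRing S]
    [IsDomain S] [Algebra R S] [Algebra.IsIntegral R S] [FaithfulSMul R S]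
    [Ring.KrullDimLE 1 S] : Ring.KrullDimLE 1 R := by
  refine Ring.KrullDimLE.mk₁' fun I hI hIp => ?_
  obtain ⟨Q, hQ, hQI⟩ := Ideal.exists_ideal_over_prime_of_isIntegral_of_isDomain (S := S) I
    (by rw [(RingHom.injective_iff_ker_eq_bot _).1 (FaithfulSMul.algebraMap_injective R S)]
        exact bot_le)
  have hQ0 : Q ≠ ⊥ := by
    rintro rfl
    exact hI (hQI.symm.trans ((RingHom.injective_iff_ker_eq_bot _).1
      (FaithfulSMul.algebraMap_injective R S)))
  have := hQ.isMaximal_of_ne_bot hQ0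
  rw [← hQI]
  exact Ideal.isMaximal_comap_of_isIntegral_of_isMaximal Q

include A in
variable (L A K) in
theorem trdeg_fractionRing_le_one [Algebra.FiniteType L A] [Ring.KrullDimLE 1 A] :
    Algebra.trdeg L K ≤ 1 := by
  obtain ⟨s, g, hg, hgi⟩ := exists_integral_inj_algHom_of_fg L A
  algebraize [g.toRingHom]
  have : IsScalarTower L (MvPolynomial (Fin s) L) A := .of_algebraMap_eq fun x => (g.commutes x).symm
  have : FaithfulSMul (MvPolynomial (Fin s) L) A := (faithfulSMul_iff_algebraMap_injective _ _).2 hg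
  have hdim := krullDimLE_one_of_isIntegral (R := MvPolynomial (Fin s) L) (S := A)
  rw [Ring.krullDimLE_iff, MvPolynomial.ringKrullDim_of_isNoetherianRing,
    ringKrullDim_eq_zero_of_field] at hdim
  have hs : s ≤ 1 := by simpa using hdim
  have h1 := trdeg_add_eq L (MvPolynomial (Fin s) L) (A := A)
  have : FaithfulSMul L A := inferInstance
  have : FaithfulSMul A K := (faithfulSMul_iff_algebraMap_injective _ _).2
    (IsFractionRing.injective A K)
  have h2 := trdeg_add_eq L A (A := K)
  have : Algebra.IsAlgebraic A K := IsLocalization.isAlgebraic _ (nonZeroDivisors A)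
  rw [trdeg_eq_zero (R := MvPolynomial (Fin s) L), add_zero, MvPolynomial.trdeg_of_isDomain] at h1
  rw [trdeg_eq_zero (R := A), add_zero, ← h1] at h2
  rw [← h2]
  simpa using hs

include A in
variable (A) in
theorem finite_adjoin_of_krullDimLE_one [IsAlgClosed L] [Algebra.FiniteType L A]
    [Ring.KrullDimLE 1 A] {t : K} (ht : t ∉ (algebraMap L K).range) :
    Module.Finite (IntermediateField.adjoin L {t}) K := by
  have htr : Transcendental L t := fun h =>
    ht (minpoly.mem_range_of_degree_eq_one L t (IsAlgClosed.degree_eq_one_of_irreducible L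
      (minpoly.irreducible h.isIntegral)))
  have hx : AlgebraicIndependent L (fun _ : Unit => t) := by
    rwa [algebraicIndependent_unique_type_iff]
  have hb : IsTranscendenceBasis L (fun _ : Unit => t) :=
    hx.isTranscendenceBasis_of_trdeg_le_of_finite (by simpa using trdeg_fractionRing_le_one L A K)
  have h1 := hb.isAlgebraic_field
  rw [Set.range_const] at h1
  have : Algebra.EssFiniteType A K := .of_isLocalization _ (nonZeroDivisors A)
  have : Algebra.EssFiniteType L K := .comp L A K
  have : Algebra.EssFiniteType (IntermediateField.adjoin L {t}) K := .of_comp L _ K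
  exact Algebra.finite_of_essFiniteType_of_isAlgebraic

include A in
variable (A) in
open scoped IntermediateField.algebraAdjoinAdjoin in
theorem exists_rel_of_krullDimLE_one [IsAlgClosed L] [Algebra.FiniteType L A]
    [Ring.KrullDimLE 1 A] {t : K} (ht : t ∉ (algebraMap L K).range) :
    ∃ n : ℕ, ∀ a : Fin (n + 1) → K,
      ∃ φ : Fin (n + 1) → L[X], φ ≠ 0 ∧ ∑ i, aeval t (φ i) * a i = 0 := by
  have := finite_adjoin_of_krullDimLE_one A ht
  refine ⟨Module.finrank (IntermediateField.adjoin L {t}) K, fun a => ?_⟩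
  have h1 : ¬ LinearIndependent (IntermediateField.adjoin L {t}) a := fun h => by
    simpa using h.fintype_card_le_finrank
  rw [← LinearIndependent.iff_fractionRing (Algebra.adjoin L {t}), Fintype.linearIndependent_iff] at h1
  push Not at h1
  obtain ⟨g, hg, i, hi⟩ := h1
  have h2 : ∀ i, ∃ p : L[X], aeval t p = (g i : K) := fun i => by
    exact (Algebra.adjoin_singleton_eq_range_aeval L t).le (g i).2
  choose φ hφ using h2
  refine ⟨φ, fun h0 => hi ?_, ?_⟩
  · have := hφ i
    rw [h0] at this
    exact Subtype.ext (by simpa using this.symm)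
  · rw [← hg]
    exact Finset.sum_congr rfl fun i _ => by rw [hφ]; rfl

include A in
variable (L A K) in
theorem isCurveField_of_krullDimLE_one [IsAlgClosed L] [Algebra.FiniteType L A]
    [Ring.KrullDimLE 1 A] (hA : ¬ IsField A) : IsCurveField L K where
  exists_rel t ht := exists_rel_of_krullDimLE_one A ht
  exists_nonconst := by
    by_contra! h
    apply hA
    refine MulEquiv.isField (Field.toIsField L) (RingEquiv.ofBijective (algebraMap L A)
      ⟨(algebraMap L A).injective, fun a => ?_⟩).symm.toMulEquiv
    obtain ⟨c, hc⟩ := h (algebraMap A K a)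
    refine ⟨c, IsFractionRing.injective A K ?_⟩
    rw [← hc, ← IsScalarTower.algebraMap_apply]

end CurveField

end

section
namespace CurveField

variable {L : Type} [Field L] {X : Scheme.{0}} [AlgebraicGeometry.IsIntegral X] (str : X ⟶ Spec (CommRingCat.of L))

/-- The function field of an integral scheme over a field `L`, as a type carrying its
`L`-algebra structure. -/
def FunField (_str : X ⟶ Spec (CommRingCat.of L)) : Type := X.functionField

noncomputable instance : Field (FunField str) := inferInstanceAs (Field X.functionField)

/-- The inclusion of the generic point. -/
noncomputable def gen : Spec (CommRingCat.of (FunField str)) ⟶ X :=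
  X.fromSpecStalk (genericPoint X)

noncomputable instance : Algebra L (FunField str) :=
  (Spec.preimage (gen str ≫ str)).hom.toAlgebra

theorem gen_str : gen str ≫ str =
    Spec.map (CommRingCat.ofHom (algebraMap L (FunField str))) :=
  (Spec.map_preimage (gen str ≫ str)).symm

instance : Mono (gen str) := inferInstanceAs (Mono (X.fromSpecStalk _))

theorem range_gen : Set.range (gen str) = {genericPoint X} := by
  ext y
  constructor
  · rintro ⟨z, rfl⟩
    have : z = IsLocalRing.closedPoint X.functionField :=
      Subsingleton.elim (α := PrimeSpectrum (FunField str)) _ _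
    rw [this]
    exact Scheme.fromSpecStalk_closedPoint
  · rintro rfl
    exact ⟨_, Scheme.fromSpecStalk_closedPoint⟩

instance : IsDominant (gen str) := ⟨by
  rw [DenseRange, range_gen, dense_iff_closure_eq]
  exact genericPoint_closure X⟩

theorem exists_ne_genericPoint (hdim : topologicalKrullDim X = 1) : ∃ x : X, x ≠ genericPoint X := by
  by_contra! h
  have : Subsingleton X := ⟨fun a b => (h a).trans (h b).symm⟩
  have h0 := topologicalKrullDim_zero_of_discreteTopology X
  rw [hdim] at h0
  exact absurd h0 (by norm_num)

/-- The coordinate ring of an affine open, as a type carrying its `L`-algebra structure. -/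
def CoordRing (_str : X ⟶ Spec (CommRingCat.of L)) (U : X.Opens) (_hU : IsAffineOpen U) : Type :=
  Γ(X, U)

variable {U : X.Opens} (hU : IsAffineOpen U)

noncomputable instance : CommRing (CoordRing str U hU) := inferInstanceAs (CommRing Γ(X, U))

/-- The inclusion of an affine open. -/
noncomputable def chart : Spec (CommRingCat.of (CoordRing str U hU)) ⟶ X := hU.fromSpec

instance : IsOpenImmersion (chart str hU) := inferInstanceAs (IsOpenImmersion hU.fromSpec)

theorem range_chart : Set.range (chart str hU) = U := hU.range_fromSpec

noncomputable instance : Algebra L (CoordRing str U hU) :=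
  (Spec.preimage (chart str hU ≫ str)).hom.toAlgebra

theorem chart_str : chart str hU ≫ str =
    Spec.map (CommRingCat.ofHom (algebraMap L (CoordRing str U hU))) :=
  (Spec.map_preimage (chart str hU ≫ str)).symm

instance [LocallyOfFiniteType str] : Algebra.FiniteType L (CoordRing str U hU) := by
  have h : LocallyOfFiniteType (chart str hU ≫ str) := inferInstance
  rw [chart_str] at h
  exact (HasRingHomProperty.Spec_iff (P := @LocallyOfFiniteType)).1 h

variable [Nonempty U]

instance : IsDomain (CoordRing str U hU) := inferInstanceAs (IsDomain Γ(X, U))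

noncomputable instance : Algebra (CoordRing str U hU) (FunField str) :=
  inferInstanceAs (Algebra Γ(X, U) X.functionField)

instance : IsFractionRing (CoordRing str U hU) (FunField str) :=
  functionField_isFractionRing_of_isAffineOpen X U hU

theorem genericPoint_mem (U : X.Opens) [Nonempty U] : genericPoint X ∈ U :=
  ((genericPoint_spec X).mem_open_set_iff U.isOpen).mpr (by simpa using ‹Nonempty U›)

theorem map_algebraMap_chart :
    Spec.map (CommRingCat.ofHom (algebraMap (CoordRing str U hU) (FunField str))) ≫ chart str hU =
      gen str :=
  hU.fromSpecStalk_eq_fromSpecStalk (genericPoint_mem U)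

instance : IsScalarTower L (CoordRing str U hU) (FunField str) := by
  refine .of_algebraMap_eq' ?_
  have h := gen_str str
  rw [← map_algebraMap_chart str hU, Category.assoc, chart_str, ← Spec.map_comp] at h
  exact congrArg CommRingCat.Hom.hom (Spec.map_injective h).symm

theorem krullDimLE_coordRing (hdim : topologicalKrullDim X = 1) :
    Ring.KrullDimLE 1 (CoordRing str U hU) := by
  rw [Ring.krullDimLE_iff, ← PrimeSpectrum.topologicalKrullDim_eq_ringKrullDim]
  exact ((chart str hU).isOpenEmbedding.isInducing.topologicalKrullDim_le).trans hdim.le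

theorem not_isField_coordRing {x : X} (hx : x ≠ genericPoint X) (hxU : x ∈ U) :
    ¬ IsField (CoordRing str U hU) := by
  intro h
  have h1 : ∀ y ∈ U, ∃ p, chart str hU p = y := fun y hy => by
    rw [← SetLike.mem_coe, ← range_chart str hU] at hy; exact hy
  obtain ⟨p, rfl⟩ := h1 x hxU
  obtain ⟨q, hq⟩ := h1 _ (genericPoint_mem U)
  rw [← hq] at hx
  have : Subsingleton (PrimeSpectrum (CoordRing str U hU)) := by
    have := @PrimeSpectrum.instUnique (CoordRing str U hU) h.toField
    exact inferInstance
  exact hx (congrArg _ (Subsingleton.elim (α := PrimeSpectrum (CoordRing str U hU)) p q))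

theorem isCurveField [IsAlgClosed L] [LocallyOfFiniteType str] (hdim : topologicalKrullDim X = 1) :
    IsCurveField L (FunField str) := by
  obtain ⟨x, hx⟩ := exists_ne_genericPoint hdim
  obtain ⟨_, ⟨U : X.Opens, hU, rfl⟩, hxU, -⟩ := X.isBasis_affineOpens.exists_subset_of_mem_open
    (Set.mem_univ x) isOpen_univ
  have hU : IsAffineOpen U := hU
  have : Nonempty U := ⟨x, hxU⟩
  have := krullDimLE_coordRing str hU hdim
  exact isCurveField_of_krullDimLE_one L (CoordRing str U hU) _ (not_isField_coordRing str hU hx hxU)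

end CurveField

end

section
namespace CurveField

theorem isPrincipalIdealRing_mvPolynomial (R : Type) [Field R] {n : ℕ} (hn : n ≤ 1) :
    IsPrincipalIdealRing (MvPolynomial (Fin n) R) := by
  interval_cases n
  · exact .of_surjective (MvPolynomial.isEmptyAlgEquiv R (Fin 0)).symm.toRingHom
      (MvPolynomial.isEmptyAlgEquiv R (Fin 0)).symm.surjective
  · exact .of_surjective (MvPolynomial.uniqueAlgEquiv R (Fin 1)).symm.toRingHom
      (MvPolynomial.uniqueAlgEquiv R (Fin 1)).symm.surjective

/-- An unramified extension of a principal ideal ring has principal maximal ideals locally. -/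
theorem isPrincipal_maximalIdeal_of_etale {P A S : Type} [CommRing P] [CommRing A] [CommRing S]
    [IsPrincipalIdealRing P] [Algebra P A] [Algebra.Etale P A] [Algebra A S] (p : Ideal A)
    [p.IsPrime] [IsLocalization.AtPrime S p] [IsLocalRing S] :
    (IsLocalRing.maximalIdeal S).IsPrincipal := by
  let := ((algebraMap A S).comp (algebraMap P A)).toAlgebra
  have : IsScalarTower P A S := .of_algebraMap_eq' rfl
  let q := p.comap (algebraMap P A)
  have hu : ∀ y : q.primeCompl, IsUnit (algebraMap P S y) := fun y =>
    IsLocalization.map_units S (⟨algebraMap P A y, y.2⟩ : p.primeCompl)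
  let f : Localization.AtPrime q →+* S := IsLocalization.lift hu
  algebraize [f]
  have : IsScalarTower P (Localization.AtPrime q) S :=
    .of_algebraMap_eq fun x => (IsLocalization.lift_eq hu x).symm
  have : IsLocalHom (algebraMap (Localization.AtPrime q) S) := by
    refine ⟨fun a ha => ?_⟩
    obtain ⟨x, s, rfl⟩ := IsLocalization.exists_mk'_eq q.primeCompl a
    rw [IsLocalization.AtPrime.isUnit_mk'_iff _ q]
    intro hx
    have h1 : algebraMap P S x = algebraMap (Localization.AtPrime q) S
        (IsLocalization.mk' _ x s) * algebraMap P S s := by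
      rw [IsScalarTower.algebraMap_apply P (Localization.AtPrime q) S,
        IsScalarTower.algebraMap_apply P (Localization.AtPrime q) S, ← map_mul,
        IsLocalization.mk'_spec]
    have h2 : IsUnit (algebraMap A S (algebraMap P A x)) := by
      have := ha.mul (hu s)
      rwa [← h1] at this
    rw [IsLocalization.AtPrime.isUnit_to_map_iff S p] at h2
    exact h2 hx
  have : Algebra.FormallyUnramified A S := .of_isLocalization p.primeCompl
  have : Algebra.FormallyUnramified P S := .comp P A S
  have : Algebra.FormallyUnramified (Localization.AtPrime q) S := .of_restrictScalars P _ _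
  have : Algebra.EssFiniteType A S := .of_isLocalization _ p.primeCompl
  have : Algebra.EssFiniteType P S := .comp P A S
  have : Algebra.EssFiniteType (Localization.AtPrime q) S := .of_comp P _ S
  rw [← Algebra.FormallyUnramified.map_maximalIdeal (R := Localization.AtPrime q),
    ← Localization.AtPrime.map_eq_maximalIdeal, Ideal.map_map]
  obtain ⟨π, hπ⟩ := IsPrincipalIdealRing.principal q
  exact ⟨_, ((congrArg (Ideal.map _) hπ).trans (Ideal.map_span _ _)).trans
    (congrArg Ideal.span Set.image_singleton)⟩

theorem valuationRing_of_isStandardSmooth {R A K S : Type} [Field R] [CommRing A] [IsDomain A]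
    [Field K] [Algebra A K] [IsFractionRing A K] [CommRing S] [IsDomain S] [Algebra A S]
    (f : R →+* A) (hf : f.IsStandardSmooth)
    [Ring.KrullDimLE 1 A] (p : Ideal A)
    [p.IsPrime] [IsLocalization.AtPrime S p] [IsLocalRing S] : ValuationRing S := by
  obtain ⟨n, g, hg, hge⟩ := hf.exists_etale_mvPolynomial
  algebraize [f, g, (algebraMap A K).comp f]
  have : IsScalarTower R A K := .of_algebraMap_eq' rfl
  have : IsScalarTower R (MvPolynomial (Fin n) R) A := .of_algebraMap_eq' hg.symm
  have hinj : Function.Injective (algebraMap (MvPolynomial (Fin n) R) A) := by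
    have : Module.Flat (MvPolynomial (Fin n) R) A := inferInstance
    exact FaithfulSMul.algebraMap_injective _ _
  have hn : n ≤ 1 := by
    have h := trdeg_fractionRing_le_one R A K
    have h2 := trdeg_le_of_injective
      ((IsScalarTower.toAlgHom R A K).comp (IsScalarTower.toAlgHom R (MvPolynomial (Fin n) R) A))
      ((IsFractionRing.injective A K).comp hinj)
    rw [MvPolynomial.trdeg_of_isDomain] at h2
    simpa using h2.trans h
  have := isPrincipalIdealRing_mvPolynomial R hn
  have := isPrincipal_maximalIdeal_of_etale (P := MvPolynomial (Fin n) R) (S := S) p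
  have : IsNoetherianRing A := Algebra.FiniteType.isNoetherianRing R A
  have : IsNoetherianRing S := IsLocalization.isNoetherianRing p.primeCompl S inferInstance
  exact ((tfae_of_isNoetherianRing_of_isLocalRing_of_isDomain S).out 1 4).2 ‹_›

end CurveField

end

section
namespace CurveField

theorem exists_map_fromSpecStalk_eq {X : Scheme.{0}} {R : Type} [CommRing R] [IsLocalRing R]
    (f : Spec (CommRingCat.of R) ⟶ X) {x : X} (hx : f (IsLocalRing.closedPoint R) = x) :
    ∃ φ : X.presheaf.stalk x →+* R, IsLocalHom φ ∧
      Spec.map (CommRingCat.ofHom φ) ≫ X.fromSpecStalk x = f := by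
  subst hx
  exact ⟨(Scheme.stalkClosedPointTo f).hom, inferInstance,
    Scheme.Spec_stalkClosedPointTo_fromSpecStalk f⟩

variable {L : Type} [Field L] {X : Scheme.{0}} [AlgebraicGeometry.IsIntegral X]
  (str : X ⟶ Spec (CommRingCat.of L))

/-- The inclusion of a local ring into the function field. -/
noncomputable def stalkInc (x : X) : X.presheaf.stalk x →+* FunField str :=
  (X.presheaf.stalkSpecializes (genericPoint_specializes x)).hom

theorem map_stalkInc (x : X) :
    Spec.map (CommRingCat.ofHom (stalkInc str x)) ≫ X.fromSpecStalk x = gen str :=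
  Scheme.SpecMap_stalkSpecializes_fromSpecStalk (genericPoint_specializes x)

omit [AlgebraicGeometry.IsIntegral X] in
theorem ringHom_ext_of_fromSpecStalk {x : X} {R : Type} [CommRing R]
    {φ ψ : X.presheaf.stalk x →+* R}
    (h : Spec.map (CommRingCat.ofHom φ) ≫ X.fromSpecStalk x =
      Spec.map (CommRingCat.ofHom ψ) ≫ X.fromSpecStalk x) : φ = ψ := by
  have := Spec.map_injective ((cancel_mono _).1 h)
  exact congrArg CommRingCat.Hom.hom this

theorem exists_algebraMap_eq_stalkInc (x : X) (c : L) :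
    ∃ s, stalkInc str x s = algebraMap L (FunField str) c := by
  have h := gen_str str
  rw [← map_stalkInc str x, Category.assoc, ← Spec.map_preimage (X.fromSpecStalk x ≫ str),
    ← Spec.map_comp] at h
  have h2 := congrArg CommRingCat.Hom.hom (Spec.map_injective h)
  exact ⟨_, DFunLike.congr_fun h2 c⟩

/-- Local rings are determined as subrings of the function field by their center. -/
theorem exists_comp_eq_stalkInc {R : Type} [CommRing R] [IsLocalRing R] (ι : R →+* FunField str)
    (f : Spec (CommRingCat.of R) ⟶ X) (hf : Spec.map (CommRingCat.ofHom ι) ≫ f = gen str)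
    {x : X} (hx : f (IsLocalRing.closedPoint R) = x) :
    ∃ φ : X.presheaf.stalk x →+* R, ι.comp φ = stalkInc str x := by
  obtain ⟨φ, -, hφ⟩ := exists_map_fromSpecStalk_eq f hx
  refine ⟨φ, ringHom_ext_of_fromSpecStalk ?_⟩
  rw [CommRingCat.ofHom_comp, Spec.map_comp, Category.assoc, hφ, hf, map_stalkInc]

theorem map_genericPoint (g : X ⟶ X) [IsIso g] : g (genericPoint X) = genericPoint X :=
  genericPoint_eq_of_isOpenImmersion g

theorem exists_algHom_of_isIso (g : X ⟶ X) [IsIso g] (hg : g ≫ str = str) :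
    ∃ φ : FunField str →ₐ[L] FunField str,
      Spec.map (CommRingCat.ofHom φ.toRingHom) ≫ gen str = gen str ≫ g := by
  obtain ⟨φ, -, hφ⟩ := exists_map_fromSpecStalk_eq (R := FunField str) (gen str ≫ g)
    (x := genericPoint X) (by
      have : gen str (IsLocalRing.closedPoint (FunField str)) = genericPoint X :=
        Scheme.fromSpecStalk_closedPoint
      exact (congrArg g this).trans (map_genericPoint g))
  have hφ' : Spec.map (CommRingCat.ofHom (show FunField str →+* FunField str from φ)) ≫ gen str =
    gen str ≫ g := hφ
  refine ⟨⟨φ, fun c => ?_⟩, hφ'⟩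
  have h := congrArg (· ≫ str) hφ'
  simp only [Category.assoc, hg, gen_str, ← Spec.map_comp] at h
  exact DFunLike.congr_fun (congrArg CommRingCat.Hom.hom (Spec.map_injective h)) c

theorem algHom_ext_of_gen {φ ψ : FunField str →ₐ[L] FunField str}
    (h : Spec.map (CommRingCat.ofHom φ.toRingHom) ≫ gen str =
      Spec.map (CommRingCat.ofHom ψ.toRingHom) ≫ gen str) : φ = ψ := by
  have := congrArg CommRingCat.Hom.hom (Spec.map_injective ((cancel_mono _).1 h))
  ext x
  exact DFunLike.congr_fun this x

omit [AlgebraicGeometry.IsIntegral X] in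
theorem hom_left_inv_left (g : Aut (Over.mk str)) : g.hom.left ≫ g.inv.left = 𝟙 X :=
  congrArg CommaMorphism.left g.hom_inv_id

omit [AlgebraicGeometry.IsIntegral X] in
theorem inv_left_hom_left (g : Aut (Over.mk str)) : g.inv.left ≫ g.hom.left = 𝟙 X :=
  congrArg CommaMorphism.left g.inv_hom_id

instance (g : Aut (Over.mk str)) : IsIso (C := Scheme) (X := X) (Y := X) g.hom.left :=
  ⟨g.inv.left, hom_left_inv_left str g, inv_left_hom_left str g⟩

instance (g : Aut (Over.mk str)) : IsIso (C := Scheme) (X := X) (Y := X) g.inv.left :=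
  ⟨g.hom.left, inv_left_hom_left str g, hom_left_inv_left str g⟩

theorem exists_algEquiv (g : Aut (Over.mk str)) :
    ∃ φ : FunField str ≃ₐ[L] FunField str,
      Spec.map (CommRingCat.ofHom (φ : FunField str →+* FunField str)) ≫ gen str =
        gen str ≫ g.hom.left := by
  obtain ⟨φ, hφ⟩ := exists_algHom_of_isIso str g.hom.left (Over.w g.hom)
  obtain ⟨ψ, hψ⟩ := exists_algHom_of_isIso str g.inv.left (Over.w g.inv)
  have key : ∀ (α β : FunField str →ₐ[L] FunField str) (a b : X ⟶ X),
      Spec.map (CommRingCat.ofHom α.toRingHom) ≫ gen str = gen str ≫ a →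
      Spec.map (CommRingCat.ofHom β.toRingHom) ≫ gen str = gen str ≫ b →
      a ≫ b = 𝟙 X → α.comp β = AlgHom.id L _ := by
    intro α β a b ha hb hab
    refine algHom_ext_of_gen str ?_
    have h1 : CommRingCat.ofHom (α.comp β).toRingHom =
      CommRingCat.ofHom β.toRingHom ≫ CommRingCat.ofHom α.toRingHom := rfl
    have h2 : CommRingCat.ofHom (AlgHom.id L (FunField str)).toRingHom = 𝟙 _ := rfl
    rw [h1, h2, Spec.map_comp, Category.assoc, hb, reassoc_of% ha, hab, Spec.map_id]
    simp
  exact ⟨AlgEquiv.ofAlgHom φ ψ (key _ _ _ _ hφ hψ (hom_left_inv_left str g))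
    (key _ _ _ _ hψ hφ (inv_left_hom_left str g)), hφ⟩

/-- The automorphism of the function field induced by an automorphism of the scheme. -/
noncomputable def funAut (g : Aut (Over.mk str)) : FunField str ≃ₐ[L] FunField str :=
  (exists_algEquiv str g).choose

theorem map_funAut (g : Aut (Over.mk str)) :
    Spec.map (CommRingCat.ofHom (funAut str g : FunField str →+* FunField str)) ≫ gen str =
      gen str ≫ g.hom.left :=
  (exists_algEquiv str g).choose_spec

theorem funAut_injective [IsSeparated str] : Function.Injective (funAut str) := by
  intro g h hgh
  have h1 := map_funAut str g
  rw [hgh, map_funAut] at h1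
  ext1
  refine Over.OverMorphism.ext ?_
  exact ext_of_isDominant_of_isSeparated (X := X) (Y := X) str
    ((Over.w g.hom).trans (Over.w h.hom).symm) (gen str) h1.symm

theorem funAut_stalkInc (g : Aut (Over.mk str)) {x y : X} (hxy : g.hom.left x = y) :
    ∃ θ : X.presheaf.stalk y →+* X.presheaf.stalk x,
      ∀ s, funAut str g (stalkInc str y s) = stalkInc str x (θ s) := by
  have hloc : IsLocalRing (X.presheaf.stalk x) := inferInstance
  obtain ⟨θ, -, hθ⟩ := @exists_map_fromSpecStalk_eq X (X.presheaf.stalk x) _ hloc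
    (X.fromSpecStalk x ≫ g.hom.left) y
    ((congrArg g.hom.left Scheme.fromSpecStalk_closedPoint).trans hxy)
  refine ⟨θ, fun s => ?_⟩
  have : (funAut str g : FunField str →+* FunField str).comp (stalkInc str y) =
      (stalkInc str x).comp θ := by
    refine ringHom_ext_of_fromSpecStalk ?_
    rw [CommRingCat.ofHom_comp, CommRingCat.ofHom_comp, Spec.map_comp, Spec.map_comp,
      Category.assoc, Category.assoc, map_stalkInc, map_funAut]
    refine ((congrArg (Spec.map (CommRingCat.ofHom (stalkInc str x)) ≫ ·) hθ).trans ?_).symm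
    rw [← Category.assoc]
    exact congrArg (· ≫ g.hom.left) (map_stalkInc str x)
  exact DFunLike.congr_fun this s

end CurveField

end

section
namespace CurveField

section

variable {X : Scheme.{0}} [AlgebraicGeometry.IsIntegral X]

/-- In an integral scheme of dimension one, a non-generic point is closed. -/
theorem isClosedPoint_of_ne_genericPoint (hdim : topologicalKrullDim X = 1) {x : X}
    (hx : x ≠ genericPoint X) : Scheme.IsClosedPoint x := by
  by_contra hcl
  have hne : ∃ y ∈ closure {x}, y ≠ x := by
    by_contra! h
    refine hcl ?_
    have : closure {x} = ({x} : Set X) := Set.Subset.antisymm (fun y hy => h y hy) subset_closure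
    rw [Scheme.IsClosedPoint, ← this]
    exact isClosed_closure
  obtain ⟨y, hy, hyx⟩ := hne
  have hlt : ∀ {a b : X}, a ∈ closure {b} → a ≠ b →
      (⟨closure {a}, isIrreducible_singleton.closure, isClosed_closure⟩ : IrreducibleCloseds X) <
        ⟨closure {b}, isIrreducible_singleton.closure, isClosed_closure⟩ := by
    intro a b hab hne
    refine lt_of_le_not_ge (closure_minimal (by simpa using hab) isClosed_closure) fun h => hne ?_
    exact ((Specializes.antisymm (specializes_iff_mem_closure.2 hab)
      (specializes_iff_mem_closure.2 (h (subset_closure rfl)))).symm).eq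
  have h1 := hlt hy hyx
  have h2 := hlt (a := x) (b := genericPoint X) (by simp) hx
  let s : LTSeries (IrreducibleCloseds X) := (RelSeries.singleton _ _).snoc _ h1
  have h := Order.LTSeries.length_le_krullDim (s.snoc _ ((RelSeries.last_snoc _ _ _).trans_lt h2))
  change _ ≤ topologicalKrullDim X at h
  rw [hdim] at h
  have h3 : (((2 : ℕ) : WithBot ℕ∞)) ≤ ((1 : ℕ) : WithBot ℕ∞) := h
  exact absurd (Nat.cast_le.1 h3) (by norm_num)

theorem IsClosedPoint.ne_genericPoint (hdim : topologicalKrullDim X = 1) {x : X}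
    (hx : Scheme.IsClosedPoint x) : x ≠ genericPoint X := by
  rintro rfl
  obtain ⟨y, hy⟩ := exists_ne_genericPoint hdim
  have h : closure {genericPoint X} = ({genericPoint X} : Set X) := IsClosed.closure_eq hx
  rw [genericPoint_closure] at h
  exact hy (by simpa using h.le (Set.mem_univ y))

end

variable {L : Type} [Field L] {X : Scheme.{0}} [AlgebraicGeometry.IsIntegral X]
  (str : X ⟶ Spec (CommRingCat.of L))

theorem stalkInc_injective (x : X) : Function.Injective (stalkInc str x) :=
  IsFractionRing.injective (X.presheaf.stalk x) X.functionField

theorem valuationRing_stalk [Smooth str] (hdim : topologicalKrullDim X = 1) (x : X) :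
    ValuationRing (X.presheaf.stalk x) := by
  obtain ⟨U, hU, V, hV, hx, e, hf⟩ := Smooth.exists_isStandardSmooth str x
  have hne : Nonempty V := ⟨x, hx⟩
  have hUtop : U = ⊤ := by
    refine top_le_iff.1 fun y _ => ?_
    rw [Subsingleton.elim (α := PrimeSpectrum L) y (str x)]
    exact e hx
  subst hUtop
  have hR : IsField Γ(Spec (CommRingCat.of L), ⊤) :=
    (Scheme.ΓSpecIso (CommRingCat.of L)).commRingCatIsoToRingEquiv.toMulEquiv.isField
      (Field.toIsField L)
  let := hR.toField
  have := krullDimLE_coordRing str hV hdim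
  let : Algebra (CoordRing str V hV) (X.presheaf.stalk x) :=
    X.presheaf.algebra_section_stalk (U := V) ⟨x, hx⟩
  let p : Ideal (CoordRing str V hV) := (hV.primeIdealOf ⟨x, hx⟩).asIdeal
  have hprime : p.IsPrime :=
    (hV.primeIdealOf ⟨x, hx⟩).2
  have hloc : IsLocalization.AtPrime (R := CoordRing str V hV) (X.presheaf.stalk x) p :=
    hV.isLocalization_stalk ⟨x, hx⟩
  exact valuationRing_of_isStandardSmooth (A := CoordRing str V hV) (K := FunField str)
    (S := X.presheaf.stalk x) _ hf p

theorem stalkInc_mem_or [Smooth str] (hdim : topologicalKrullDim X = 1) (x : X) (y : FunField str) :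
    y ∈ (stalkInc str x).range ∨ y⁻¹ ∈ (stalkInc str x).range := by
  have := valuationRing_stalk str hdim x
  exact ValuationRing.isInteger_or_isInteger (X.presheaf.stalk x) (K := X.functionField) y

theorem stalkInc_range_ne_top {x : X}
    (hx : x ≠ genericPoint X) : (stalkInc str x).range ≠ ⊤ := by
  intro h
  have hfield : IsField (X.presheaf.stalk x) :=
    (RingEquiv.ofBijective (stalkInc str x) ⟨stalkInc_injective str x,
      RingHom.range_eq_top.1 h⟩).toMulEquiv.isField (Field.toIsField _)
  have : Subsingleton (PrimeSpectrum (X.presheaf.stalk x)) := by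
    have := @PrimeSpectrum.instUnique _ hfield.toField
    exact inferInstance
  have h1 : gen str (IsLocalRing.closedPoint (FunField str)) ∈ Set.range (gen str) := ⟨_, rfl⟩
  rw [range_gen, ← map_stalkInc str x] at h1
  have h2 := Subsingleton.elim (α := PrimeSpectrum (X.presheaf.stalk x))
    (Spec.map (CommRingCat.ofHom (stalkInc str x)) (IsLocalRing.closedPoint (FunField str)))
    (IsLocalRing.closedPoint (X.presheaf.stalk x))
  exact hx ((Scheme.fromSpecStalk_closedPoint.symm.trans
    (congrArg (X.fromSpecStalk x) h2.symm)).trans h1)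

theorem stalkInc_surjective_of_eq {x : X} (hx : x = genericPoint X) :
    Function.Surjective (stalkInc str x) := by
  subst hx
  intro y
  have h := X.presheaf.stalkSpecializes_refl (genericPoint X)
  exact ⟨y, DFunLike.congr_fun (congrArg CommRingCat.Hom.hom h) y⟩

/-- The place of the function field attached to a non-generic point. -/
noncomputable def placeAt [Smooth str] (hdim : topologicalKrullDim X = 1) {x : X}
    (hx : x ≠ genericPoint X) : Place L (FunField str) :=
  ⟨{ (stalkInc str x).range with mem_or_inv_mem' := stalkInc_mem_or str hdim x },
    fun h => stalkInc_range_ne_top str hx (by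
      ext y
      refine ⟨fun _ => trivial, fun _ => ?_⟩
      have : y ∈ (⊤ : ValuationSubring (FunField str)) := trivial
      rw [← h] at this
      exact this),
    fun c => exists_algebraMap_eq_stalkInc str x c⟩

variable [Smooth str] (hdim : topologicalKrullDim X = 1)

theorem mem_placeAt {x : X} (hx : x ≠ genericPoint X) (y : FunField str) :
    y ∈ (placeAt str hdim hx).1 ↔ ∃ s, stalkInc str x s = y := Iff.rfl

theorem funAut_smul_placeAt [IsAlgClosed L] (g : Aut (Over.mk str)) {x y : X}
    (hxy : g.hom.left x = y) (hx : x ≠ genericPoint X) (hy : y ≠ genericPoint X) :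
    funAut str g • placeAt str hdim hy = placeAt str hdim hx := by
  have := isCurveField str hdim
  obtain ⟨θ, hθ⟩ := funAut_stalkInc str g hxy
  refine Place.eq_of_le fun z hz => ?_
  rw [Place.mem_smul, mem_placeAt] at hz
  obtain ⟨s, hs⟩ := hz
  refine ⟨θ s, ?_⟩
  rw [← hθ, hs]
  exact (funAut str g).apply_symm_apply z

theorem exists_eq_placeAt [IsAlgClosed L] [IsProper str] (P : Place L (FunField str)) :
    ∃ (x : X) (hx : x ≠ genericPoint X), P = placeAt str hdim hx := by
  have := isCurveField str hdim
  let ιL : L →+* P.1 := (algebraMap L (FunField str)).codRestrict P.1.toSubring P.2.algebraMap_mem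
  have hval : ValuativeCriterion str := by
    have h : IsProper str := inferInstance
    rw [IsProper.eq_valuativeCriterion] at h
    exact h.1.1.1
  let S : ValuativeCommSq str :=
    { R := P.1, K := FunField str, i₁ := gen str, i₂ := Spec.map (CommRingCat.ofHom ιL)
      commSq := ⟨by
        rw [gen_str, ← Spec.map_comp]
        rfl⟩ }
  obtain ⟨⟨f, hf, -⟩⟩ := (hval.existence S).exists_lift
  obtain ⟨φ, hφ⟩ := exists_comp_eq_stalkInc str (algebraMap P.1 (FunField str)) f hf rfl
  have hle : ∀ s, stalkInc str _ s ∈ P.1 := fun s => by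
    rw [← hφ]
    exact (φ s).2
  have hx : f (IsLocalRing.closedPoint P.1) ≠ genericPoint X := by
    refine fun h => P.2.ne_top (top_le_iff.1 fun y _ => ?_)
    obtain ⟨s, rfl⟩ := stalkInc_surjective_of_eq str h y
    exact hle s
  exact ⟨_, hx, (Place.eq_of_le fun y hy => by obtain ⟨s, rfl⟩ := hy; exact hle s).symm⟩

end CurveField

end

section
namespace CurveField

/-- If the automorphisms of a smooth proper curve act transitively on its closed points and its
function field is not purely transcendental, then the automorphisms fixing a closed point form a
set of at most `24` elements. -/
theorem card_aut_fixing_point_le {L : Type} [Field L] [IsAlgClosed L] {X : Scheme.{0}}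
    [AlgebraicGeometry.IsIntegral X] (str : X ⟶ Spec (CommRingCat.of L)) [Smooth str]
    [IsProper str] (hdim : topologicalKrullDim X = 1)
    (hnr : ¬ ∃ z ∉ (algebraMap L (FunField str)).range, ∀ y : FunField str,
      ∃ p q : Polynomial L, q ≠ 0 ∧ Polynomial.aeval z q * y = Polynomial.aeval z p)
    (hom : ∀ x y : X, Scheme.IsClosedPoint x → Scheme.IsClosedPoint y →
      ∃ g : Aut (Over.mk str), g.hom.left x = y)
    {x : X} (hx : Scheme.IsClosedPoint x) :
    {g : Aut (Over.mk str) | g.hom.left x = x}.Finite ∧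
      {g : Aut (Over.mk str) | g.hom.left x = x}.ncard ≤ 24 := by
  have := isCurveField str hdim
  have hx' := IsClosedPoint.ne_genericPoint hdim hx
  have htr : ∀ P Q : Place L (FunField str), ∃ σ : FunField str ≃ₐ[L] FunField str,
      σ • P = Q := by
    intro P Q
    obtain ⟨a, ha, rfl⟩ := exists_eq_placeAt str hdim P
    obtain ⟨b, hb, rfl⟩ := exists_eq_placeAt str hdim Q
    obtain ⟨g, hg⟩ := hom b a (isClosedPoint_of_ne_genericPoint hdim hb)
      (isClosedPoint_of_ne_genericPoint hdim ha)
    exact ⟨funAut str g, funAut_smul_placeAt str hdim g hg hb ha⟩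
  obtain ⟨hfin, hcard⟩ := card_stabilizer_le_of_transitive hnr htr (placeAt str hdim hx')
  have hmaps : Set.MapsTo (funAut str) {g : Aut (Over.mk str) | g.hom.left x = x}
      {σ | σ • placeAt str hdim hx' = placeAt str hdim hx'} :=
    fun g hg => funAut_smul_placeAt str hdim g hg hx' hx'
  have hinj := (funAut_injective str).injOn (s := {g : Aut (Over.mk str) | g.hom.left x = x})
  exact ⟨Set.Finite.of_injOn hmaps hinj hfin,
    (Set.ncard_le_ncard_of_injOn _ hmaps hinj hfin).trans hcard⟩

end CurveField

end

section
namespace CurveField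

theorem constHom_bijective (k : Type) [CommRing k] (n : ℕ) :
    Function.Bijective (constHom k n) := by
  constructor
  · intro a b h
    exact MvPolynomial.C_injective _ _ (congrArg Subtype.val h)
  · rintro ⟨p, hp⟩
    have hp' : p.IsHomogeneous 0 := hp
    refine ⟨MvPolynomial.coeff 0 p, Subtype.ext ?_⟩
    exact (MvPolynomial.totalDegree_eq_zero_iff_eq_C.1
      ((MvPolynomial.totalDegree_zero_iff_isHomogeneous _).2 hp')).symm

instance projSpace_finiteType (k : Type) [CommRing k] (n : ℕ) :
    Algebra.FiniteType (MvPolynomial.homogeneousSubmodule (Fin (n + 1)) k 0)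
      (MvPolynomial (Fin (n + 1)) k) := by
  have h : ((algebraMap (MvPolynomial.homogeneousSubmodule (Fin (n + 1)) k 0)
      (MvPolynomial (Fin (n + 1)) k)).comp (constHom k n)).FiniteType :=
    RingHom.finiteType_algebraMap.2 (inferInstanceAs
      (Algebra.FiniteType k (MvPolynomial (Fin (n + 1)) k)))
  exact RingHom.finiteType_algebraMap.1 (RingHom.FiniteType.of_comp_finiteType h)

instance isProper_projSpace_str (k : Type) [CommRing k] (n : ℕ) :
    IsProper (ProjSpace.str k n) := by
  have : IsIso (CommRingCat.ofHom (constHom k n)) :=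
    (ConcreteCategory.isIso_iff_bijective _).2 (constHom_bijective k n)
  have h : IsProper (Proj.toSpecZero (MvPolynomial.homogeneousSubmodule (Fin (n + 1)) k)) :=
    inferInstance
  exact MorphismProperty.comp_mem @IsProper _ _ h inferInstance

theorem IsProjectiveOver.isProper {k : Type} [Field k] {X : Scheme.{0}}
    {str : X ⟶ Spec (CommRingCat.of k)} (h : IsProjectiveOver k X str) : IsProper str := by
  obtain ⟨n, f, hf, rfl⟩ := h
  infer_instance

end CurveField

end

section
namespace CurveField

theorem aeval_mul_of_isHomogeneous {R S σ : Type*} [CommRing R] [CommRing S] [Algebra R S]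
    {p : MvPolynomial σ R} {n : ℕ} (hp : p.IsHomogeneous n) (u : S) (g : σ → S) :
    MvPolynomial.aeval (fun i => u * g i) p = u ^ n * MvPolynomial.aeval g p := by
  rw [MvPolynomial.aeval_def, MvPolynomial.aeval_def, MvPolynomial.eval₂_eq,
    MvPolynomial.eval₂_eq, Finset.mul_sum]
  refine Finset.sum_congr rfl fun d hd => ?_
  simp only [mul_pow, Finset.prod_mul_distrib, Finset.prod_pow_eq_pow_sum]
  rw [← hp.degree_eq_sum_deg_support hd]
  ring

section

variable (k : Type) [Field k]

/-- The coordinate ring of the standard chart of the projective line. -/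
abbrev LineChartRing : Type :=
  HomogeneousLocalization.Away (MvPolynomial.homogeneousSubmodule (Fin 2) k)
    (MvPolynomial.X 0 : MvPolynomial (Fin 2) k)

theorem X_mem_one (i : Fin 2) : (MvPolynomial.X i : MvPolynomial (Fin 2) k) ∈
    MvPolynomial.homogeneousSubmodule (Fin 2) k 1 := MvPolynomial.isHomogeneous_X _ _

/-- The inhomogeneous coordinate on the standard chart of the projective line. -/
noncomputable def lineCoord : LineChartRing k :=
  HomogeneousLocalization.Away.mk _ (X_mem_one k 0) 1 (MvPolynomial.X 1) (X_mem_one k 1)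

/-- The inclusion of constants in the chart ring. -/
noncomputable def lineConst : k →+* LineChartRing k :=
  (HomogeneousLocalization.fromZeroRingHom
    (MvPolynomial.homogeneousSubmodule (Fin 2) k) _).comp (constHom k 1)

/-- The map from polynomials to the chart ring. -/
noncomputable def lineMap : Polynomial k →+* LineChartRing k :=
  Polynomial.eval₂RingHom (lineConst k) (lineCoord k)

abbrev LineLoc : Type := Localization.Away (MvPolynomial.X 0 : MvPolynomial (Fin 2) k)

theorem val_lineConst (c : k) : (lineConst k c).val = algebraMap k (LineLoc k) c := by
  rw [IsScalarTower.algebraMap_apply k (MvPolynomial (Fin 2) k) (LineLoc k)]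
  exact Localization.mk_one_eq_algebraMap _

theorem mul_val_lineCoord :
    algebraMap (MvPolynomial (Fin 2) k) (LineLoc k) (MvPolynomial.X 0) * (lineCoord k).val =
      algebraMap (MvPolynomial (Fin 2) k) (LineLoc k) (MvPolynomial.X 1) := by
  rw [lineCoord, HomogeneousLocalization.Away.val_mk, Localization.mk_eq_mk']
  have := IsLocalization.mk'_spec' (LineLoc k) (MvPolynomial.X 1 : MvPolynomial (Fin 2) k)
    (⟨MvPolynomial.X 0 ^ 1, 1, rfl⟩ :
      Submonoid.powers (MvPolynomial.X 0 : MvPolynomial (Fin 2) k))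
  simpa only [pow_one] using this

theorem val_lineMap (p : Polynomial k) :
    (lineMap k p).val = Polynomial.aeval (lineCoord k).val p := by
  have h : ((algebraMap (LineChartRing k) (LineLoc k)).comp (lineMap k)) =
      (Polynomial.aeval (R := k) (lineCoord k).val).toRingHom := by
    refine Polynomial.ringHom_ext (fun c => ?_) ?_
    · simp [lineMap, val_lineConst]
    · simp [lineMap]
  exact DFunLike.congr_fun h p

theorem lineMap_bijective : Function.Bijective (lineMap k) := by
  constructor
  · let χ : LineLoc k →+* Polynomial k := IsLocalization.Away.lift
      (g := (MvPolynomial.aeval (R := k) ![1, Polynomial.X]).toRingHom)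
      (MvPolynomial.X 0 : MvPolynomial (Fin 2) k) (by simp)
    have hχ : ∀ a, χ (algebraMap _ _ a) = MvPolynomial.aeval (R := k) ![1, Polynomial.X] a :=
      fun a => IsLocalization.Away.lift_eq _ _ _
    have hc : χ (lineCoord k).val = Polynomial.X := by
      have := congrArg χ (mul_val_lineCoord k)
      rw [map_mul, hχ, hχ] at this
      simpa using this
    refine Function.LeftInverse.injective (g := fun y => χ y.val) fun p => ?_
    have h : χ.comp (Polynomial.aeval (R := k) (lineCoord k).val).toRingHom = RingHom.id _ := by
      refine Polynomial.ringHom_ext (fun c => ?_) ?_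
      · have : χ (algebraMap k (LineLoc k) c) = Polynomial.C c := by
          rw [IsScalarTower.algebraMap_apply k (MvPolynomial (Fin 2) k) (LineLoc k), hχ]
          simp
        simpa using this
      · simpa using hc
    exact (congrArg χ (val_lineMap k p)).trans (DFunLike.congr_fun h p)
  · intro y
    obtain ⟨n, a, ha, rfl⟩ := HomogeneousLocalization.Away.mk_surjective _ (X_mem_one k 0) y
    refine ⟨MvPolynomial.aeval (R := k) ![1, Polynomial.X] a, ?_⟩
    apply HomogeneousLocalization.val_injective
    rw [val_lineMap, HomogeneousLocalization.Away.val_mk, Localization.mk_eq_mk', eq_comm,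
      IsLocalization.mk'_eq_iff_eq_mul]
    have ha' : a.IsHomogeneous n := by simpa using ha
    have h1 := aeval_mul_of_isHomogeneous ha'
      (algebraMap (MvPolynomial (Fin 2) k) (LineLoc k) (MvPolynomial.X 0))
      ![1, (lineCoord k).val]
    have h2 : (fun i => algebraMap (MvPolynomial (Fin 2) k) (LineLoc k) (MvPolynomial.X 0) *
        ![1, (lineCoord k).val] i) =
        fun i => algebraMap (MvPolynomial (Fin 2) k) (LineLoc k) (MvPolynomial.X i) := by
      funext i
      fin_cases i
      · simp
      · exact mul_val_lineCoord k
    have h3 : (MvPolynomial.aeval (R := k) fun i =>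
        algebraMap (MvPolynomial (Fin 2) k) (LineLoc k) (MvPolynomial.X i)) =
        IsScalarTower.toAlgHom k (MvPolynomial (Fin 2) k) (LineLoc k) := by
      ext i; simp
    have h4 : (Polynomial.aeval (R := k) (lineCoord k).val).comp
        (MvPolynomial.aeval (R := k) ![1, Polynomial.X]) =
        MvPolynomial.aeval (R := k) ![1, (lineCoord k).val] := by
      ext i
      fin_cases i <;> simp
    rw [h2, h3] at h1
    have h5 := DFunLike.congr_fun h4 a
    simp only [AlgHom.comp_apply] at h5
    rw [h5, mul_comm]
    simpa using h1

theorem exists_openImmersion_line_proj : ∃ j : Spec (CommRingCat.of (Polynomial k)) ⟶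
      Proj (MvPolynomial.homogeneousSubmodule (Fin 2) k), IsOpenImmersion j ∧
      j ≫ Proj.toSpecZero _ ≫ Spec.map (CommRingCat.ofHom (constHom k 1)) =
        Spec.map (CommRingCat.ofHom (algebraMap k (Polynomial k))) := by
  have : IsIso (CommRingCat.ofHom (lineMap k)) :=
    (ConcreteCategory.isIso_iff_bijective _).2 (lineMap_bijective k)
  refine ⟨inv (Spec.map (CommRingCat.ofHom (lineMap k))) ≫
    Proj.awayι _ _ (X_mem_one k 0) one_pos, inferInstance, ?_⟩
  rw [Category.assoc, IsIso.inv_comp_eq, Proj.awayι_toSpecZero_assoc,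
    ← Spec.map_comp, ← Spec.map_comp, ← CommRingCat.ofHom_comp, ← CommRingCat.ofHom_comp]
  congr 2
  ext c
  simp [lineMap, lineConst]

/-- The affine line is an open subscheme of the projective line. -/
theorem exists_openImmersion_line : ∃ j : Spec (CommRingCat.of (Polynomial k)) ⟶ ProjSpace k 1,
    IsOpenImmersion j ∧
      j ≫ ProjSpace.str k 1 = Spec.map (CommRingCat.ofHom (algebraMap k (Polynomial k))) :=
  exists_openImmersion_line_proj k

end

/-- The generic point of projective space. -/
noncomputable def projGenericPoint (k : Type) [Field k] (n : ℕ) :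
    ProjectiveSpectrum (MvPolynomial.homogeneousSubmodule (Fin (n + 1)) k) where
  asHomogeneousIdeal := ⊥
  isPrime := by
    rw [HomogeneousIdeal.toIdeal_bot]
    exact Ideal.isPrime_bot
  not_irrelevant_le h := by
    have h0 : (MvPolynomial.X 0 : MvPolynomial (Fin (n + 1)) k) ∈
        HomogeneousIdeal.irrelevant (MvPolynomial.homogeneousSubmodule (Fin (n + 1)) k) := by
      exact HomogeneousIdeal.mem_irrelevant_of_mem _ one_pos (MvPolynomial.isHomogeneous_X _ _)
    exact MvPolynomial.X_ne_zero 0 (h h0)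

/-- Nonempty open subsets of projective space are dense. -/
theorem dense_of_nonempty_projSpace {k : Type} [Field k] {n : ℕ} (V : (ProjSpace k n).Opens)
    (hV : (V : Set (ProjSpace k n)).Nonempty) : Dense (V : Set (ProjSpace k n)) := by
  have hcl : ∀ y, y ∈ closure ({projGenericPoint k n} : Set (ProjectiveSpectrum _)) :=
    fun y => (ProjectiveSpectrum.le_iff_mem_closure _ _ _).1 (bot_le (a := y.asHomogeneousIdeal))
  obtain ⟨y, hy⟩ := hV
  have hmem : projGenericPoint k n ∈ (V : Set (ProjSpace k n)) := by
    obtain ⟨z, hz, hz'⟩ := mem_closure_iff.1 (hcl y) V.1 V.2 hy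
    exact hz' ▸ hz
  exact fun z => closure_mono (Set.singleton_subset_iff.2 hmem) (hcl z)

end CurveField

end

section
namespace CurveField

section

variable {L A K : Type} [Field L] [CommRing A] [Field K] [Algebra L A] [Algebra A K]
  [Algebra L K] [IsScalarTower L A K]

theorem exists_mul_pow_mem_of_adjoin {T : Set K} {a : A}
    (hT : ∀ y ∈ T, ∃ n : ℕ, y * algebraMap A K a ^ n ∈ (algebraMap A K).range) {y : K}
    (hy : y ∈ Algebra.adjoin L T) :
    ∃ n : ℕ, y * algebraMap A K a ^ n ∈ (algebraMap A K).range := by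
  induction hy using Algebra.adjoin_induction with
  | mem y hy => exact hT y hy
  | algebraMap r =>
    exact ⟨0, algebraMap L A r, by simp [← IsScalarTower.algebraMap_apply]⟩
  | add y z _ _ hy hz =>
    obtain ⟨n, u, hu⟩ := hy
    obtain ⟨m, v, hv⟩ := hz
    refine ⟨n + m, u * a ^ m + v * a ^ n, ?_⟩
    rw [map_add, map_mul, map_mul, hu, hv, map_pow, map_pow]
    ring
  | mul y z _ _ hy hz =>
    obtain ⟨n, u, hu⟩ := hy
    obtain ⟨m, v, hv⟩ := hz
    refine ⟨n + m, u * v, ?_⟩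
    rw [map_mul, hu, hv]
    ring

/-- A finitely generated subalgebra of the fraction field becomes integral after inverting one
nonzero element. -/
theorem exists_common_denominator [IsDomain A] [IsFractionRing A K] (B : Type) [CommRing B]
    [Algebra L B] [Algebra B K] [IsScalarTower L B K] [Algebra.FiniteType L B] :
    ∃ a : A, a ≠ 0 ∧ ∀ y ∈ (algebraMap B K).range,
      ∃ n : ℕ, y * algebraMap A K a ^ n ∈ (algebraMap A K).range := by
  classical
  obtain ⟨s, hs⟩ := Algebra.FiniteType.out (R := L) (A := B)
  obtain ⟨a, ha⟩ := IsLocalization.exist_integer_multiples_of_finset (nonZeroDivisors A)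
    (s.image (algebraMap B K))
  refine ⟨a, nonZeroDivisors.ne_zero a.2, ?_⟩
  rintro _ ⟨b, rfl⟩
  refine exists_mul_pow_mem_of_adjoin (L := L) (T := algebraMap B K '' s) ?_ ?_
  · rintro y hy
    obtain ⟨c, hc⟩ := ha y (by simpa using hy)
    exact ⟨1, c, by rw [hc, Algebra.smul_def]; ring⟩
  · have h : algebraMap B K b ∈ (Algebra.adjoin L (s : Set B)).map (IsScalarTower.toAlgHom L B K) :=
      ⟨b, hs ▸ trivial, rfl⟩
    rwa [AlgHom.map_adjoin] at h

/-- Adjoining to `A` the elements of `T` together with the inverses of `a` and `b` amounts to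
localizing at one element, provided that `T` is contained in the localization of `A` at `a`. -/
theorem exists_openImmersion_of_adjoin [IsDomain A] [IsFractionRing A K] {T : Set K} {a : A}
    (ha : a ≠ 0)
    (hT : ∀ y ∈ T, ∃ n : ℕ, y * algebraMap A K a ^ n ∈ (algebraMap A K).range) {b : K} (hb : b ≠ 0)
    (hbT : b ∈ T) {C : Subalgebra L K}
    (hC : C = Algebra.adjoin L ((algebraMap A K).range ∪ T ∪ {(algebraMap A K a)⁻¹, b⁻¹})) :
    ∃ f : A →ₐ[L] C, IsOpenImmersion (Spec.map (CommRingCat.ofHom f.toRingHom)) := by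
  have hmem : ∀ x ∈ ((algebraMap A K).range ∪ T ∪ {(algebraMap A K a)⁻¹, b⁻¹} : Set K), x ∈ C :=
    fun x hx => hC ▸ Algebra.subset_adjoin hx
  let f : A →ₐ[L] C := (IsScalarTower.toAlgHom L A K).codRestrict C
    fun x => hmem _ (Or.inl (Or.inl ⟨x, rfl⟩))
  have hinj : Function.Injective (algebraMap A K) := IsFractionRing.injective A K
  have ha' : algebraMap A K a ≠ 0 := by simpa using hinj.ne ha
  obtain ⟨l, b', hb'⟩ := hT b hbT
  have hb0 : algebraMap A K b' ≠ 0 := hb' ▸ mul_ne_zero hb (pow_ne_zero _ ha')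
  let _ : Algebra A C := f.toRingHom.toAlgebra
  have hval : ∀ x : A, ((algebraMap A C x : C) : K) = algebraMap A K x := fun x => rfl
  have hx : algebraMap A K (a * b') = b * algebraMap A K a ^ (l + 1) := by
    rw [map_mul, hb']; ring
  have hloc : IsLocalization.Away (a * b') C := by
    refine ⟨?_, ?_, ?_⟩
    · rintro ⟨_, n, rfl⟩
      simp only [map_pow]
      refine IsUnit.pow _ ?_
      have h1 : (algebraMap A K a)⁻¹ ∈ C := hmem _ (by simp)
      have h2 : b⁻¹ ∈ C := hmem _ (by simp)
      refine IsUnit.of_mul_eq_one ⟨_, C.mul_mem h2 (C.pow_mem h1 (l + 1))⟩ (Subtype.ext ?_)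
      rw [MulMemClass.coe_mul, hval, hx]
      field_simp
      simpa using mul_inv_cancel₀ (pow_ne_zero (l + 1) ha')
    · rintro ⟨y, hy⟩
      have hyx : ∃ n : ℕ, y * algebraMap A K (a * b') ^ n ∈ (algebraMap A K).range := by
        rw [hC] at hy
        refine exists_mul_pow_mem_of_adjoin ?_ hy
        rintro z ((⟨u, rfl⟩ | hz) | (rfl | rfl))
        · exact ⟨0, u, by simp⟩
        · obtain ⟨n, u, hu⟩ := hT z hz
          refine ⟨n, u * b' ^ n, ?_⟩
          rw [map_mul, hu, map_mul, map_pow]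
          ring
        · exact ⟨1, b', by rw [map_mul]; field_simp⟩
        · exact ⟨1, a ^ (l + 1), by rw [hx, map_pow]; field_simp⟩
      obtain ⟨n, u, hu⟩ := hyx
      refine ⟨(u, ⟨(a * b') ^ n, n, rfl⟩), Subtype.ext ?_⟩
      rw [MulMemClass.coe_mul, hval, hval, hu, map_pow]
    · intro x y hxy
      exact ⟨1, by rw [hinj (congrArg Subtype.val hxy)]⟩
  exact ⟨f, IsOpenImmersion.of_isLocalization (a * b')⟩

end
end CurveField

end

section
namespace CurveField

/-- Two finitely generated domains with the same fraction field have a common localization. -/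
theorem exists_common_localization {L A B K : Type} [Field L] [CommRing A] [CommRing B] [Field K]
    [Algebra L A] [Algebra A K] [Algebra L B] [Algebra B K] [Algebra L K] [IsScalarTower L A K]
    [IsScalarTower L B K] [IsDomain A] [IsDomain B] [IsFractionRing A K] [IsFractionRing B K]
    [Algebra.FiniteType L A] [Algebra.FiniteType L B] :
    ∃ (C : Subalgebra L K) (f : A →ₐ[L] C) (g : B →ₐ[L] C),
      IsOpenImmersion (Spec.map (CommRingCat.ofHom f.toRingHom)) ∧
      IsOpenImmersion (Spec.map (CommRingCat.ofHom g.toRingHom)) := by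
  obtain ⟨a, ha, haB⟩ := exists_common_denominator (L := L) (A := A) (K := K) B
  obtain ⟨b, hb, hbA⟩ := exists_common_denominator (L := L) (A := B) (K := K) A
  have ha' : algebraMap A K a ≠ 0 := by simpa using (IsFractionRing.injective A K).ne ha
  have hb' : algebraMap B K b ≠ 0 := by simpa using (IsFractionRing.injective B K).ne hb
  obtain ⟨f, hf⟩ := exists_openImmersion_of_adjoin (L := L) (T := (algebraMap B K).range)
    ha haB hb' (Set.mem_range_self b) rfl
  obtain ⟨g, hg⟩ := exists_openImmersion_of_adjoin (L := L) (T := (algebraMap A K).range)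
    hb hbA ha' (Set.mem_range_self a) (congrArg (Algebra.adjoin L) (congrArg₂ (· ∪ ·)
      (Set.union_comm ((algebraMap A K).range : Set K) _) (Set.pair_comm _ _)))
  exact ⟨_, f, g, hf, hg⟩

theorem isFractionRing_of_generator {L K : Type} [Field L] [IsAlgClosed L] [Field K] [Algebra L K]
    {z : K} (hz : z ∉ (algebraMap L K).range)
    (hgen : ∀ y : K, ∃ p q : Polynomial L, q ≠ 0 ∧
      Polynomial.aeval z q * y = Polynomial.aeval z p) :
    @IsFractionRing (Polynomial L) _ K _ (Polynomial.aeval (R := L) z).toRingHom.toAlgebra := by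
  let _ : Algebra (Polynomial L) K := (Polynomial.aeval (R := L) z).toRingHom.toAlgebra
  have hinj : Function.Injective (algebraMap (Polynomial L) K) := by
    refine transcendental_iff_injective.1 fun h => hz ?_
    exact minpoly.mem_range_of_degree_eq_one L z
      (IsAlgClosed.degree_eq_one_of_irreducible L (minpoly.irreducible h.isIntegral))
  refine ⟨fun q => ?_, fun y => ?_, fun {p q} h => ⟨1, by rw [hinj h]⟩⟩
  · exact (map_ne_zero_iff _ hinj).2 (nonZeroDivisors.ne_zero q.2) |>.isUnit
  · obtain ⟨p, q, hq, h⟩ := hgen y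
    exact ⟨(p, ⟨q, mem_nonZeroDivisors_of_ne_zero hq⟩), by rw [mul_comm]; exact h⟩

/-- An integral scheme of finite type over an algebraically closed field `L` whose function field
is `L(z)` for a single nonconstant `z` is rational. -/
theorem birationalOver_line {L : Type} [Field L] [IsAlgClosed L] {X : Scheme.{0}}
    [AlgebraicGeometry.IsIntegral X] (str : X ⟶ Spec (CommRingCat.of L))
    [LocallyOfFiniteType str]
    (h : ∃ z ∉ (algebraMap L (FunField str)).range, ∀ y : FunField str,
      ∃ p q : Polynomial L, q ≠ 0 ∧ Polynomial.aeval z q * y = Polynomial.aeval z p) :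
    BirationalOver L X (ProjSpace L 1) str (ProjSpace.str L 1) := by
  obtain ⟨z, hz, hgen⟩ := h
  have hfrac := isFractionRing_of_generator hz hgen
  let _ : Algebra (Polynomial L) (FunField str) :=
    (Polynomial.aeval (R := L) z).toRingHom.toAlgebra
  have : IsScalarTower L (Polynomial L) (FunField str) :=
    .of_algebraMap_eq fun c => (Polynomial.aeval_C z c).symm
  obtain ⟨_, ⟨U : X.Opens, hU, rfl⟩, hxU, -⟩ := X.isBasis_affineOpens.exists_subset_of_mem_open
    (Set.mem_univ (genericPoint X)) isOpen_univ
  have hU : IsAffineOpen U := hU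
  have : Nonempty U := ⟨_, hxU⟩
  obtain ⟨C, f, g, hf, hg⟩ := exists_common_localization (L := L) (A := CoordRing str U hU)
    (B := Polynomial L) (K := FunField str)
  obtain ⟨j, hj, hjs⟩ := exists_openImmersion_line L
  let F : Spec (CommRingCat.of C) ⟶ X := Spec.map (CommRingCat.ofHom f.toRingHom) ≫ chart str hU
  let G : Spec (CommRingCat.of C) ⟶ ProjSpace L 1 := Spec.map (CommRingCat.ofHom g.toRingHom) ≫ j
  have hF : F ≫ str = Spec.map (CommRingCat.ofHom (algebraMap L C)) := by
    rw [Category.assoc, chart_str, ← Spec.map_comp, ← CommRingCat.ofHom_comp]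
    exact congrArg (fun φ => Spec.map (CommRingCat.ofHom φ)) f.comp_algebraMap
  have hG : G ≫ ProjSpace.str L 1 = Spec.map (CommRingCat.ofHom (algebraMap L C)) := by
    rw [Category.assoc, hjs, ← Spec.map_comp, ← CommRingCat.ofHom_comp]
    exact congrArg (fun φ => Spec.map (CommRingCat.ofHom φ)) g.comp_algebraMap
  have hFo : IsOpenImmersion F := inferInstance
  have hGo : IsOpenImmersion G := inferInstance
  have : Nonempty (Spec (CommRingCat.of C)) := inferInstanceAs (Nonempty (PrimeSpectrum C))
  obtain ⟨w⟩ := this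
  refine ⟨F.opensRange, G.opensRange, F.opensRange.isOpen.dense ⟨F w, w, rfl⟩,
    dense_of_nonempty_projSpace _ ⟨G w, w, rfl⟩,
    F.isoOpensRange.symm ≪≫ G.isoOpensRange, ?_⟩
  rw [← cancel_epi F.isoOpensRange.hom]
  simp [hF, hG]

end CurveField

end

section
namespace CurveField

section

variable {k L : Type} [Field k] [Field L] {X Y : Scheme.{0}} {sX : X ⟶ Spec (CommRingCat.of k)}
  {sY : Y ⟶ Spec (CommRingCat.of L)} {s : Spec (CommRingCat.of L) ⟶ Spec (CommRingCat.of k)}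
  [IsIso s] {p : Y ⟶ X} [IsIso p]

theorem conj_comp (h : p ≫ sX = sY ≫ s) {g : X ⟶ X} (hg : g ≫ sX = sX) :
    (p ≫ g ≫ inv p) ≫ sY = sY := by
  have h' : inv p ≫ sY = sX ≫ inv s := by
    rw [IsIso.inv_comp_eq, ← Category.assoc, h, Category.assoc, IsIso.hom_inv_id, Category.comp_id]
  rw [Category.assoc, Category.assoc, h', reassoc_of% hg, ← h', IsIso.hom_inv_id_assoc]

/-- Transport of automorphisms along an isomorphism of schemes over an isomorphism of bases. -/
noncomputable def conjAut (h : p ≫ sX = sY ≫ s) (g : Aut (Over.mk sX)) : Aut (Over.mk sY) where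
  hom := Over.homMk (U := Over.mk sY) (V := Over.mk sY) (p ≫ g.hom.left ≫ inv p)
    (conj_comp h (Over.w g.hom))
  inv := Over.homMk (U := Over.mk sY) (V := Over.mk sY) (p ≫ g.inv.left ≫ inv p)
    (conj_comp h (Over.w g.inv))
  hom_inv_id := by
    have := congrArg CommaMorphism.left g.hom_inv_id
    refine Over.OverMorphism.ext ?_
    have h1 : (p ≫ g.hom.left ≫ inv p) ≫ p ≫ g.inv.left ≫ inv p =
        p ≫ (g.hom.left ≫ g.inv.left) ≫ inv p := by simp
    refine h1.trans ?_
    rw [hom_left_inv_left]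
    simp
  inv_hom_id := by
    refine Over.OverMorphism.ext ?_
    have h1 : (p ≫ g.inv.left ≫ inv p) ≫ p ≫ g.hom.left ≫ inv p =
        p ≫ (g.inv.left ≫ g.hom.left) ≫ inv p := by simp
    refine h1.trans ?_
    rw [inv_left_hom_left]
    simp

theorem conjAut_left (h : p ≫ sX = sY ≫ s) (g : Aut (Over.mk sX)) :
    (conjAut h g).hom.left ≫ p = p ≫ g.hom.left := by
  have : (p ≫ g.hom.left ≫ inv p) ≫ p = p ≫ g.hom.left := by simp
  exact this

theorem conjAut_injective (h : p ≫ sX = sY ≫ s) : Function.Injective (conjAut h) := by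
  intro g g' hgg
  have h1 := conjAut_left h g
  rw [hgg, conjAut_left, cancel_epi] at h1
  ext1
  exact Over.OverMorphism.ext h1.symm

theorem conjAut_apply (h : p ≫ sX = sY ≫ s) {g : Aut (Over.mk sX)} {y : Y}
    (hg : g.hom.left (p y) = p y) : (conjAut h g).hom.left y = y := by
  have h1 : p ((conjAut h g).hom.left y) = g.hom.left (p y) :=
    congrArg (fun f : Y ⟶ X => f y) (conjAut_left h g)
  exact p.isOpenEmbedding.injective (h1.trans hg)

end

/-- The automorphisms of an elliptic curve over an algebraically closed field that fix a closed
point form a set of at most `24` elements. -/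
theorem EllipticCurveOver.card_aut_fixing_point_le {k : Type} [Field k] [IsAlgClosed k]
    (E : EllipticCurveOver k) {z : E.X} (hz : Scheme.IsClosedPoint z) :
    {g : Aut (Over.mk E.str) | g.hom.left z = z}.Finite ∧
      {g : Aut (Over.mk E.str) | g.hom.left z = z}.ncard ≤ 24 := by
  let s := Spec.map (CommRingCat.ofHom (algebraMap k (AlgebraicClosure k)))
  have hiso : IsIso (CommRingCat.ofHom (algebraMap k (AlgebraicClosure k))) :=
    (ConcreteCategory.isIso_iff_bijective _).2 IsAlgClosed.algebraMap_bijective_of_isIntegral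
  have hs : IsIso s := inferInstance
  let p : BaseChangeToClosure k E.X E.str ⟶ E.X := Limits.pullback.fst E.str s
  have hp : IsIso p := inferInstanceAs (IsIso (Limits.pullback.fst E.str s))
  let sY := BaseChangeToClosure.str k E.X E.str
  have hcomm : p ≫ E.str = sY ≫ s := Limits.pullback.condition
  have hE : AlgebraicGeometry.IsIntegral E.X := E.integral
  have hsm : Smooth E.str := E.smooth
  have hpr : IsProper E.str := IsProjectiveOver.isProper E.projective
  have hsmY : Smooth sY := inferInstanceAs (Smooth (Limits.pullback.snd E.str s))
  have hprY : IsProper sY := inferInstanceAs (IsProper (Limits.pullback.snd E.str s))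
  let e : BaseChangeToClosure k E.X E.str ≃ₜ E.X := Scheme.homeoOfIso (asIso p)
  have hez : e (e.symm z) = z := e.apply_symm_apply z
  have hne : Nonempty (BaseChangeToClosure k E.X E.str) := ⟨e.symm z⟩
  have hint : AlgebraicGeometry.IsIntegral (BaseChangeToClosure k E.X E.str) :=
    isIntegral_of_isOpenImmersion p
  have hdim : topologicalKrullDim (BaseChangeToClosure k E.X E.str) = 1 :=
    (IsHomeomorph.topologicalKrullDim_eq e e.isHomeomorph).trans E.dim_one
  have hy : Scheme.IsClosedPoint (e.symm z) := by
    have : ({e.symm z} : Set _) = e ⁻¹' {z} := by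
      ext w
      simp [e.eq_symm_apply]
    rw [Scheme.IsClosedPoint, this]
    exact IsClosed.preimage e.continuous hz
  obtain ⟨hfin, hcard⟩ := CurveField.card_aut_fixing_point_le sY hdim
    (fun h => E.geom_nonrational (birationalOver_line sY h)) E.geom_homogeneous hy
  have hmaps : Set.MapsTo (conjAut hcomm) {g : Aut (Over.mk E.str) | g.hom.left z = z}
      {g | g.hom.left (e.symm z) = e.symm z} := by
    intro g hg
    have hg : g.hom.left z = z := hg
    refine conjAut_apply hcomm ?_
    have hez : p (e.symm z) = z := hez
    rw [hez, hg]
  have hinj := (conjAut_injective hcomm).injOn (s := {g : Aut (Over.mk E.str) | g.hom.left z = z})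
  exact ⟨Set.Finite.of_injOn hmaps hinj hfin,
    (Set.ncard_le_ncard_of_injOn _ hmaps hinj hfin).trans hcard⟩

end CurveField


end

/-- Let `E` be an elliptic curve over an algebraically closed field `k` and let `Γ` be a
group of automorphisms of `E` (as a curve over `k`) preserving a nonempty finite subset
`Z ⊆ E` of closed points.  Then `Γ` is finite and `|Γ| ≤ 24 * |Z|`. -/
theorem card_automorphisms_preserving_finite_set_le
    (k : Type) [Field k] [IsAlgClosed k] (Eℓ : EllipticCurveOver k)
    (Γ : Subgroup (Aut (Over.mk Eℓ.str)))
    (Z : Set Eℓ.X) (hZfin : Z.Finite) (hZne : Z.Nonempty)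
    (hZcl : ∀ z ∈ Z, Scheme.IsClosedPoint z)
    (hpres : ∀ g ∈ Γ, g.hom.left.base '' Z = Z) :
    Finite Γ ∧ Nat.card Γ ≤ 24 * Nat.card Z := by
  classical
  obtain ⟨z, hz⟩ := hZne
  obtain ⟨hfin, hcard⟩ := CurveField.EllipticCurveOver.card_aut_fixing_point_le Eℓ (hZcl z hz)
  set S := {g : Aut (Over.mk Eℓ.str) | g.hom.left z = z} with hS
  let ev : Aut (Over.mk Eℓ.str) → Eℓ.X := fun g => g.hom.left z
  have hev : ∀ g ∈ Γ, ev g ∈ Z := fun g hg => (hpres g hg).le ⟨z, hz, rfl⟩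
  have hfib : ∀ g₀, Set.MapsTo (g₀⁻¹ * ·) {g | ev g = ev g₀} S := by
    intro g₀ g hg
    have hg : g.hom.left z = g₀.hom.left z := hg
    have h1 : g₀.inv.left (g.hom.left z) = z := by
      rw [hg]
      exact congrArg (fun f : Eℓ.X ⟶ Eℓ.X => f z) (CurveField.hom_left_inv_left Eℓ.str g₀)
    exact h1
  have hfibfin : ∀ g₀, {g | ev g = ev g₀}.Finite := fun g₀ =>
    Set.Finite.of_injOn (hfib g₀) (mul_right_injective g₀⁻¹).injOn hfin
  have hfibcard : ∀ g₀, {g | ev g = ev g₀}.ncard ≤ 24 := fun g₀ =>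
    (Set.ncard_le_ncard_of_injOn _ (hfib g₀) (mul_right_injective g₀⁻¹).injOn hfin).trans hcard
  have hΓ : (Γ : Set (Aut (Over.mk Eℓ.str))).Finite := by
    refine Set.Finite.of_finite_fibers ev (hZfin.subset ?_) ?_
    · rintro _ ⟨g, hg, rfl⟩
      exact hev g hg
    · rintro _ ⟨g₀, -, rfl⟩
      exact (hfibfin g₀).subset fun g hg => hg.2
  refine ⟨hΓ, ?_⟩
  have h := Finset.card_le_mul_card_image_of_maps_to (f := ev) (s := hΓ.toFinset)
    (t := hZfin.toFinset) (by simpa using hev) 24 fun w _ => by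
      by_cases hw : ∃ g₀, ev g₀ = w
      · obtain ⟨g₀, rfl⟩ := hw
        refine le_trans ?_ (hfibcard g₀)
        rw [← Set.ncard_coe_finset]
        exact Set.ncard_le_ncard (fun g hg => by simpa using (Finset.mem_filter.1 hg).2)
          (hfibfin g₀)
      · rw [Finset.filter_eq_empty_iff.2 fun g _ hg => hw ⟨g, hg⟩]
        simp
  rwa [← Set.ncard_eq_toFinset_card _ hΓ, ← Set.ncard_eq_toFinset_card _ hZfin] at h
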